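/- arXiv:1904.01285 — 2 statements merged into one kernel-verified Lean document; each statement's English description precedes it below -/
import Mathlib

section
/- For every countable ordinal α ≥ 1, there exists a finite alphabet A and a subshift X ⊆ A^ℤ in CPE class α, i.e., the relation EP(X) is equalizing and has close-up rank α. -/
open Filter Topology Set

namespace CPE

universe u

/-- The left shift map on bi-infinite sequences: `(σ x) i = x (i+1)`. -/
def shiftMap {A : Type*} (x : ℤ → A) : ℤ → A := fun i => x (i + 1)

/-- The shift by `m`: `(σ^m x) i = x (i + m)`. -/
def shiftZ {A : Type*} (m : ℤ) (x : ℤ → A) : ℤ → A := fun i => x (i + m)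

/-- A subshift: a closed shift-invariant subset of the full shift. -/
def IsSubshift {A : Type*} [TopologicalSpace A] (X : Set (ℤ → A)) : Prop :=
  IsClosed X ∧ shiftMap '' X = X

/-- The orbit closure of a point. -/
def orbitClosure {A : Type*} [TopologicalSpace A] (x : ℤ → A) : Set (ℤ → A) :=
  closure {y | ∃ m : ℤ, y = shiftZ m x}

/-- A Toeplitz point: every coordinate repeats along some arithmetic progression. -/
def IsToeplitz {A : Type*} (x : ℤ → A) : Prop :=
  ∀ i : ℤ, ∃ n : ℕ, 0 < n ∧ ∀ m : ℤ, x (i + m * n) = x i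

/-- A minimal subshift: a nonempty subshift with no nonempty proper subshift. -/
def IsMinimalSubshift {A : Type*} [TopologicalSpace A] (M : Set (ℤ → A)) : Prop :=
  IsSubshift M ∧ M.Nonempty ∧ ∀ M' ⊆ M, IsSubshift M' → M'.Nonempty → M' = M

/-- The words of length `n` appearing in points of `X`. -/
def lang {A : Type*} (X : Set (ℤ → A)) (n : ℕ) : Set (Fin n → A) :=
  {w | ∃ x ∈ X, ∀ i : Fin n, x (i : ℤ) = w i}

/-- `X` has zero (topological) entropy: `lim (log |L_n(X)|)/n = 0`. -/
def HasZeroEntropy {A : Type*} (X : Set (ℤ → A)) : Prop :=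
  Tendsto (fun n : ℕ => Real.log ((lang X n).ncard) / n) atTop (nhds 0)

/-- `N(𝒰 ∨ σ⁻¹𝒰 ∨ ⋯ ∨ σ^{-(n-1)}𝒰)` for the two-element cover `𝒰 = (C0, C1)`:
the minimal number of sets of the form `⋂_{i<n} σ^{-i} C_{u i}` needed to cover `X`. -/
noncomputable def coverNum {A : Type*} (X C0 C1 : Set (ℤ → A)) (n : ℕ) : ℕ :=
  sInf {m | ∃ S : Finset (Fin n → Bool), S.card = m ∧
    X ⊆ ⋃ u ∈ S, ⋂ i : Fin n, shiftMap^[(i : ℕ)] ⁻¹' (if u i then C1 else C0)}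

/-- The topological entropy `h(𝒰)` of the two-element cover `𝒰 = (C0, C1)` of a subshift `X`.
By subadditivity (Fekete's lemma) the limit `lim_n (1/n) log N_n` exists and equals the
infimum `⨅_{n ≥ 1} (1/n) log N_n`, which we use as the definition. -/
noncomputable def coverEntropy {A : Type*} (X C0 C1 : Set (ℤ → A)) : ℝ :=
  ⨅ n : ℕ, Real.log (coverNum X C0 C1 (n + 1)) / (n + 1)

/-- `(x, y)` is an entropy pair of the subshift `X`: `x ≠ y` and for all disjoint closed
neighborhoods `U` of `x` and `V` of `y` (in `X`), the cover `(Uᶜ, Vᶜ)` has positive entropy. -/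
def IsEntropyPair {A : Type*} [TopologicalSpace A] (X : Set (ℤ → A)) (x y : ℤ → A) : Prop :=
  x ∈ X ∧ y ∈ X ∧ x ≠ y ∧
    ∀ U V : Set (ℤ → A), IsClosed U → IsClosed V → U ∈ nhdsWithin x X → V ∈ nhdsWithin y X →
      Disjoint U V → 0 < coverEntropy X Uᶜ Vᶜ

/-- `EP(X)`: the entropy pairs of `X` together with the diagonal on `X`. -/
def EP {A : Type*} [TopologicalSpace A] (X : Set (ℤ → A)) : Set ((ℤ → A) × (ℤ → A)) :=
  {p | IsEntropyPair X p.1 p.2} ∪ {p | p.1 ∈ X ∧ p.1 = p.2}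

/-- The close-up process on a relation `E`: `E^(0) = E`; at a successor step `α + 1` one takes
the topological closure if `α + 1` is odd (i.e. `α` is even), and the transitive closure if
`α + 1` is even (i.e. `α` is odd); at limit steps one takes the union.  (An ordinal is even
iff it is of the form `λ + 2n` with `λ` a limit ordinal and `n ∈ ℕ`, iff its residue mod `2`
is `0`.)  When `E` is closed this agrees with the process of Barbieri–García-Ramos started at
`E^(1) = E`, since then `E^(1) = closure E = E`. -/
noncomputable def closeUp {α : Type u} [TopologicalSpace α] (E : Set (α × α))
    (o : Ordinal.{u}) : Set (α × α) :=
  Ordinal.limitRecOn o E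
    (fun β ih => if β % 2 = 0 then closure ih
      else {p | Relation.TransGen (fun a b => (a, b) ∈ ih) p.1 p.2})
    (fun β _ ih => ⋃ γ : Set.Iio β, ih γ.1 γ.2)

/-- The close-up rank of `E`: the least ordinal `λ` (with `λ ≥ 1` if `E` is closed, matching
the convention `E^(ζ) = E`, `ζ = 1` for closed `E`) such that `E^(λ) = E^(λ+1)`. -/
noncomputable def closeUpRank {α : Type u} [TopologicalSpace α] (E : Set (α × α)) :
    Ordinal.{u} :=
  sInf {o | (IsClosed E → 1 ≤ o) ∧ closeUp E o = closeUp E (o + 1)}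

/-- `E^[k] = {(x₁, …, x_k) : ∀ i j, (x_i, x_j) ∈ E}`. -/
def relPow {α : Type*} (E : Set (α × α)) (k : ℕ) : Set (Fin k → α) :=
  {v | ∀ i j, (v i, v j) ∈ E}

/-- `(E^[k])²` viewed inside `α^{k+k}` via concatenation of the two `k`-tuples. -/
def pairSet {α : Type*} (E : Set (α × α)) (k : ℕ) : Set (Fin (k + k) → α) :=
  {w | ∃ u ∈ relPow E k, ∃ v ∈ relPow E k, w = Fin.append u v}

end CPE

namespace CPE

section CloseUp

open Ordinal Order

theorem ordinal_mod_two (β : Ordinal.{u}) : β % 2 = 0 ∨ β % 2 = 1 := by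
  have h : β % 2 < 2 := Ordinal.mod_lt _ two_ne_zero
  have h2 : (2 : Ordinal.{u}) = 1 + 1 := by norm_num
  rw [h2] at h
  have h' := Order.lt_add_one_iff.1 h
  rw [← h2] at h'
  rcases h'.lt_or_eq with h3 | h3
  · left; exact Order.lt_one_iff.1 h3
  · right; exact h3

theorem ordinal_odd_add_one {β : Ordinal.{u}} (h : β % 2 = 1) : (β + 1) % 2 = 0 := by
  have h1 := Ordinal.div_add_mod β 2
  rw [h] at h1
  rw [← h1, add_assoc]
  have h2 : (1 : Ordinal.{u}) + 1 = 2 := by norm_num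
  rw [h2, Ordinal.mul_add_mod_self, Ordinal.mod_self]

theorem ordinal_even_add_one {β : Ordinal.{u}} (h : β % 2 = 0) : (β + 1) % 2 = 1 := by
  have h1 := Ordinal.div_add_mod β 2
  rw [h, add_zero] at h1
  rw [← h1, Ordinal.mul_add_mod_self]
  exact Ordinal.mod_eq_of_lt (by norm_num)

theorem ordinal_limit_even {β : Ordinal.{u}} (h : IsSuccLimit β) : β % 2 = 0 := by
  rcases ordinal_mod_two β with h1 | h1
  · exact h1
  · have h2 := Ordinal.div_add_mod β 2
    rw [h1] at h2
    have h3 := h.succ_lt (a := 2 * (β / 2)) (by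
      conv_rhs => rw [← h2]
      exact Order.lt_add_one_iff.2 le_rfl)
    rw [Order.succ_eq_add_one, h2] at h3
    exact absurd h3 (lt_irrefl _)

theorem ordinal_cases (β : Ordinal.{u}) :
    β = 0 ∨ (∃ γ, β = γ + 1) ∨ IsSuccLimit β := by
  rcases Ordinal.zero_or_succ_or_isSuccLimit β with h | ⟨γ, h⟩ | h
  · exact Or.inl h
  · exact Or.inr (Or.inl ⟨γ, by rw [← h, Order.succ_eq_add_one]⟩)
  · exact Or.inr (Or.inr h)

variable {T : Type u} [TopologicalSpace T] {E : Set (T × T)}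

theorem closeUp_zero (E : Set (T × T)) : closeUp E 0 = E := by
  simp [closeUp]

theorem closeUp_add_one_even (E : Set (T × T)) {β : Ordinal.{u}} (h : β % 2 = 0) :
    closeUp E (β + 1) = closure (closeUp E β) := by
  simp [closeUp, h]

theorem closeUp_add_one_odd (E : Set (T × T)) {β : Ordinal.{u}} (h : β % 2 = 1) :
    closeUp E (β + 1) =
      {p | Relation.TransGen (fun a b => (a, b) ∈ closeUp E β) p.1 p.2} := by
  simp [closeUp, h]

theorem closeUp_limit (E : Set (T × T)) {β : Ordinal.{u}} (h : IsSuccLimit β) :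
    closeUp E β = ⋃ γ : Set.Iio β, closeUp E γ.1 := by
  simp only [closeUp]
  rw [Ordinal.limitRecOn_limit _ _ _ _ h]

theorem closeUp_induction (E : Set (T × T)) (P : Ordinal.{u} → Set (T × T) → Prop)
    (zero : P 0 E)
    (even : ∀ β, β % 2 = 0 → P β (closeUp E β) → P (β + 1) (closure (closeUp E β)))
    (odd : ∀ β, β % 2 = 1 → P β (closeUp E β) →
      P (β + 1) {p | Relation.TransGen (fun a b => (a, b) ∈ closeUp E β) p.1 p.2})
    (limit : ∀ β, IsSuccLimit β → (∀ γ < β, P γ (closeUp E γ)) →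
      P β (⋃ γ : Set.Iio β, closeUp E γ.1)) (β : Ordinal.{u}) : P β (closeUp E β) := by
  induction β using Ordinal.limitRecOn with
  | zero => rwa [closeUp_zero]
  | add_one β ih =>
    rcases ordinal_mod_two β with h | h
    · rw [closeUp_add_one_even E h]; exact even β h ih
    · rw [closeUp_add_one_odd E h]; exact odd β h ih
  | limit β h ih => rw [closeUp_limit E h]; exact limit β h ih

theorem closeUp_subset_add_one (E : Set (T × T)) (β : Ordinal.{u}) :
    closeUp E β ⊆ closeUp E (β + 1) := by
  rcases ordinal_mod_two β with h | h
  · rw [closeUp_add_one_even E h]; exact subset_closure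
  · rw [closeUp_add_one_odd E h]; exact fun p hp => Relation.TransGen.single hp

theorem closeUp_mono (E : Set (T × T)) {β γ : Ordinal.{u}} (h : β ≤ γ) :
    closeUp E β ⊆ closeUp E γ := by
  induction γ using Ordinal.limitRecOn with
  | zero => rw [nonpos_iff_eq_zero.1 h]
  | add_one γ ih =>
    rcases h.lt_or_eq with h1 | h1
    · exact (ih (Order.lt_add_one_iff.1 h1)).trans (closeUp_subset_add_one E γ)
    · rw [h1]
  | limit γ hγ ih =>
    rcases h.lt_or_eq with h1 | h1
    · rw [closeUp_limit E hγ]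
      exact fun p hp => Set.mem_iUnion.2 ⟨⟨β, h1⟩, hp⟩
    · rw [h1]

theorem closeUp_trans_of_even (E : Set (T × T)) {β : Ordinal.{u}} (h : β % 2 = 0)
    (h0 : β ≠ 0) {a b c : T} (hab : (a, b) ∈ closeUp E β) (hbc : (b, c) ∈ closeUp E β) :
    (a, c) ∈ closeUp E β := by
  have key : ∀ γ : Ordinal.{u}, γ % 2 = 1 → (a, b) ∈ closeUp E (γ + 1) →
      (b, c) ∈ closeUp E (γ + 1) → (a, c) ∈ closeUp E (γ + 1) := by
    intro γ hγ h1 h2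
    rw [closeUp_add_one_odd E hγ] at *
    exact Relation.TransGen.trans h1 h2
  rcases ordinal_cases β with rfl | ⟨γ, rfl⟩ | hl
  · exact absurd rfl h0
  · rcases ordinal_mod_two γ with h1 | h1
    · rw [ordinal_even_add_one h1] at h; exact absurd h one_ne_zero
    · exact key γ h1 hab hbc
  · have hab' := hab
    have hbc' := hbc
    rw [closeUp_limit E hl] at hab' hbc'
    obtain ⟨⟨γ₁, hγ₁⟩, h1⟩ := Set.mem_iUnion.1 hab'
    obtain ⟨⟨γ₂, hγ₂⟩, h2⟩ := Set.mem_iUnion.1 hbc'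
    have hm : max γ₁ γ₂ < β := max_lt hγ₁ hγ₂
    have hm1 : max γ₁ γ₂ + 1 < β := by rw [← Order.succ_eq_add_one]; exact hl.succ_lt hm
    have hm2 : max γ₁ γ₂ + 1 + 1 < β := by
      conv_lhs => rw [← Order.succ_eq_add_one]
      exact hl.succ_lt hm1
    have a1 := closeUp_mono E (le_max_left γ₁ γ₂) h1
    have a2 := closeUp_mono E (le_max_right γ₁ γ₂) h2
    rcases ordinal_mod_two (max γ₁ γ₂) with h3 | h3
    · exact closeUp_mono E hm2.le (key _ (ordinal_even_add_one h3)
        (closeUp_mono E (by rw [add_assoc]; exact le_self_add) a1)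
        (closeUp_mono E (by rw [add_assoc]; exact le_self_add) a2))
    · exact closeUp_mono E hm1.le (key _ h3
        (closeUp_subset_add_one E _ a1) (closeUp_subset_add_one E _ a2))

theorem closeUp_subset_of_closed_of_trans {F : Set (T × T)} (hE : E ⊆ F) (hF : IsClosed F)
    (hT : ∀ a b c, (a, b) ∈ F → (b, c) ∈ F → (a, c) ∈ F) (β : Ordinal.{u}) :
    closeUp E β ⊆ F := by
  refine closeUp_induction E (fun _ S => S ⊆ F) hE (fun β _ h => closure_minimal h hF) ?_ ?_ β
  · intro β _ h p hp
    have : ∀ y, Relation.TransGen (fun a b => (a, b) ∈ closeUp E β) p.1 y → (p.1, y) ∈ F := by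
      intro y hy
      induction hy with
      | single h1 => exact h h1
      | tail _ h2 ih => exact hT _ _ _ ih (h h2)
    exact this _ hp
  · intro β _ h
    exact Set.iUnion_subset fun γ => h γ.1 γ.2

theorem closeUp_subset_prod {X : Set T} (hX : IsClosed X) (hE : E ⊆ X ×ˢ X)
    (β : Ordinal.{u}) : closeUp E β ⊆ X ×ˢ X :=
  closeUp_subset_of_closed_of_trans hE (hX.prod hX) (fun _ _ _ h1 h2 => ⟨h1.1, h2.2⟩) β

theorem isClosed_closeUp_of_odd (E : Set (T × T)) {β : Ordinal.{u}} (h : β % 2 = 1) :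
    IsClosed (closeUp E β) := by
  rcases ordinal_cases β with rfl | ⟨γ, rfl⟩ | hl
  · simp at h
  · rcases ordinal_mod_two γ with h1 | h1
    · rw [closeUp_add_one_even E h1]; exact isClosed_closure
    · rw [ordinal_odd_add_one h1] at h; exact absurd h zero_ne_one
  · rw [ordinal_limit_even hl] at h; exact absurd h zero_ne_one

theorem closeUp_eq_of_stable (E : Set (T × T)) {β γ : Ordinal.{u}} (h0 : β ≠ 0)
    (h : closeUp E β = closeUp E (β + 1)) (hγ : β ≤ γ) : closeUp E γ = closeUp E β := by
  refine Set.Subset.antisymm ?_ (closeUp_mono E hγ)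
  have hE : E ⊆ closeUp E β := by
    conv_lhs => rw [← closeUp_zero E]
    exact closeUp_mono E zero_le
  rcases ordinal_mod_two β with h1 | h1
  · refine closeUp_subset_of_closed_of_trans hE ?_
      (fun _ _ _ ha hb => closeUp_trans_of_even E h1 h0 ha hb) γ
    rw [h, closeUp_add_one_even E h1]; exact isClosed_closure
  · refine closeUp_subset_of_closed_of_trans hE (isClosed_closeUp_of_odd E h1) ?_ γ
    intro a b c ha hb
    rw [h] at ha hb ⊢
    exact closeUp_trans_of_even E (ordinal_odd_add_one h1) (by simp) ha hb

theorem closeUpRank_eq {X : Set T} (hX : IsClosed X) (hE : IsClosed E) (hEX : E ⊆ X ×ˢ X)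
    {α : Ordinal.{u}} (hα : 1 ≤ α) (h1 : closeUp E α = X ×ˢ X)
    (h2 : ∀ β, 1 ≤ β → β < α → closeUp E β ≠ X ×ˢ X) : closeUpRank E = α := by
  have hmem : α ∈ {o | (IsClosed E → 1 ≤ o) ∧ closeUp E o = closeUp E (o + 1)} :=
    ⟨fun _ => hα, Set.Subset.antisymm (closeUp_subset_add_one E α)
      (h1 ▸ closeUp_subset_prod hX hEX _)⟩
  refine le_antisymm (csInf_le' hmem) (le_csInf ⟨α, hmem⟩ ?_)
  rintro β ⟨hβ1, hβ2⟩
  by_contra! hlt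
  exact h2 β (hβ1 hE) hlt ((closeUp_eq_of_stable E (one_le_iff_ne_zero.1 (hβ1 hE)) hβ2
    hlt.le).symm.trans h1)

end CloseUp

end CPE

namespace CPE

section Shift

variable {A : Type*}

theorem shiftZ_shiftZ (a b : ℤ) (x : ℤ → A) : shiftZ a (shiftZ b x) = shiftZ (a + b) x := by
  funext i; simp only [shiftZ]; congr 1; ring

theorem shiftZ_zero (x : ℤ → A) : shiftZ 0 x = x := by
  funext i; simp [shiftZ]

theorem iterate_shiftMap (n : ℕ) (x : ℤ → A) : shiftMap^[n] x = shiftZ n x := by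
  induction n generalizing x with
  | zero => simp [shiftZ_zero]
  | succ n ih =>
    rw [Function.iterate_succ_apply, ih]
    funext i; simp only [shiftZ, shiftMap]; congr 1; push_cast; ring

/-- Two configurations agree on the window `[-N, N]`. -/
def Agree (N : ℤ) (x y : ℤ → A) : Prop := ∀ i, -N ≤ i → i ≤ N → x i = y i

theorem Agree.mono {N M : ℤ} {x y : ℤ → A} (h : Agree N x y) (hM : M ≤ N) : Agree M x y :=
  fun i h1 h2 => h i (by omega) (by omega)

variable [TopologicalSpace A]

theorem continuous_shiftZ (a : ℤ) : Continuous (shiftZ (A := A) a) :=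
  continuous_pi fun _ => continuous_apply _

theorem eventually_agree [DiscreteTopology A] (N : ℤ) (x : ℤ → A) :
    ∀ᶠ y in 𝓝 x, Agree N x y := by
  have : ∀ᶠ y in 𝓝 x, ∀ i ∈ Finset.Icc (-N) N, x i = y i := by
    rw [Filter.eventually_all_finset]
    intro i _
    have h := (continuous_apply (A := fun _ : ℤ => A) i).tendsto x
    rw [nhds_discrete A, tendsto_pure] at h
    filter_upwards [h] with y hy using hy.symm
  filter_upwards [this] with y hy i h1 h2
  exact hy i (Finset.mem_Icc.2 ⟨h1, h2⟩)

theorem exists_agree_of_mem_nhds {x : ℤ → A} {U : Set (ℤ → A)} (hU : U ∈ 𝓝 x) :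
    ∃ N : ℤ, 0 ≤ N ∧ ∀ y, Agree N x y → y ∈ U := by
  rw [nhds_pi, Filter.mem_pi] at hU
  obtain ⟨I, hI, t, ht, hs⟩ := hU
  obtain ⟨B, hB⟩ := (hI.image (fun i : ℤ => |i|)).bddAbove
  refine ⟨max B 0, le_max_right _ _, fun y hy => hs ?_⟩
  intro i hi
  have h1 : |i| ≤ B := hB ⟨i, hi, rfl⟩
  have h2 := abs_le.1 (h1.trans (le_max_left B 0))
  rw [← hy i h2.1 h2.2]
  exact mem_of_mem_nhds (ht i)

theorem mem_closure_iff_agree [DiscreteTopology A] {S : Set (ℤ → A)} {x : ℤ → A} :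
    x ∈ closure S ↔ ∀ N : ℤ, ∃ y ∈ S, Agree N x y := by
  rw [mem_closure_iff_nhds]
  constructor
  · intro h N
    obtain ⟨y, h1, h2⟩ := h _ (eventually_agree N x)
    exact ⟨y, h2, h1⟩
  · intro h U hU
    obtain ⟨N, _, hN⟩ := exists_agree_of_mem_nhds hU
    obtain ⟨y, h1, h2⟩ := h N
    exact ⟨y, hN y h2, h1⟩

theorem mem_closure_prod_iff_agree [DiscreteTopology A] {S : Set ((ℤ → A) × (ℤ → A))}
    {p : (ℤ → A) × (ℤ → A)} :
    p ∈ closure S ↔ ∀ N : ℤ, ∃ q ∈ S, Agree N p.1 q.1 ∧ Agree N p.2 q.2 := by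
  rw [mem_closure_iff_nhds]
  constructor
  · intro h N
    obtain ⟨q, h1, h2⟩ := h _ (prod_mem_nhds (eventually_agree N p.1) (eventually_agree N p.2))
    exact ⟨q, h2, h1.1, h1.2⟩
  · intro h U hU
    obtain ⟨U1, h1, U2, h2, hs⟩ := mem_nhds_prod_iff.1 hU
    obtain ⟨N1, _, hN1⟩ := exists_agree_of_mem_nhds h1
    obtain ⟨N2, _, hN2⟩ := exists_agree_of_mem_nhds h2
    obtain ⟨q, hq, ha, hb⟩ := h (max N1 N2)
    exact ⟨q, hs ⟨hN1 _ (ha.mono (le_max_left _ _)), hN2 _ (hb.mono (le_max_right _ _))⟩, hq⟩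

theorem isClosed_agree [DiscreteTopology A] (N : ℤ) (x : ℤ → A) : IsClosed {y | Agree N x y} := by
  have : {y | Agree N x y} = ⋂ i ∈ Set.Icc (-N) N, {y : ℤ → A | y i = x i} := by
    ext y
    simp only [Agree, mem_ofPred_eq, mem_iInter, mem_Icc]
    exact ⟨fun h i hi => (h i hi.1 hi.2).symm, fun h i h1 h2 => (h i ⟨h1, h2⟩).symm⟩
  rw [this]
  exact isClosed_biInter fun i _ => isClosed_eq (continuous_apply i) continuous_const

end Shift

/-- Binary configurations. -/
abbrev Cfg : Type := ℤ → Fin 2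

theorem fin_two_cases (a : Fin 2) : a = 0 ∨ a = 1 := by omega

section Blocks

variable {l : Fin 2 → ℤ} {W : Fin 2 → ℤ → Fin 2}

/-- Left end of the `k`-th block when the letters of `x` are replaced by blocks of lengths `l`
and block `0` starts at the origin. -/
noncomputable def pos (l : Fin 2 → ℤ) (x : Cfg) (k : ℤ) : ℤ :=
  ∑ i ∈ Finset.Ico 0 k, l (x i) - ∑ i ∈ Finset.Ico k 0, l (x i)

@[simp] theorem pos_zero (l : Fin 2 → ℤ) (x : Cfg) : pos l x 0 = 0 := by simp [pos]

theorem pos_add_one (l : Fin 2 → ℤ) (x : Cfg) (k : ℤ) :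
    pos l x (k + 1) = pos l x k + l (x k) := by
  unfold pos
  rcases le_or_gt 0 k with h | h
  · rw [Finset.Ico_eq_empty_of_le h, Finset.Ico_eq_empty_of_le (show (0 : ℤ) ≤ k + 1 by omega),
      show Finset.Ico 0 (k + 1) = insert k (Finset.Ico 0 k) by ext; simp; omega,
      Finset.sum_insert (by simp)]
    ring
  · rw [Finset.Ico_eq_empty_of_le h.le, Finset.Ico_eq_empty_of_le (show k + 1 ≤ 0 by omega),
      show Finset.Ico k 0 = insert k (Finset.Ico (k + 1) 0) by ext; simp; omega,
      Finset.sum_insert (by simp)]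
    ring

theorem eq_pos_of_step {x : Cfg} {f : ℤ → ℤ} (h : ∀ k, f (k + 1) = f k + l (x k)) (k : ℤ) :
    f k = f 0 + pos l x k := by
  induction k using Int.induction_on with
  | zero => simp
  | succ k ih => rw [h, pos_add_one, ih]; ring
  | pred k ih =>
    have h1 := h (-k - 1)
    have h2 := pos_add_one l x (-k - 1)
    rw [sub_add_cancel] at h1 h2
    linarith

theorem pos_shiftZ (l : Fin 2 → ℤ) (x : Cfg) (j k : ℤ) :
    pos l (shiftZ j x) k = pos l x (k + j) - pos l x j := by
  have := eq_pos_of_step (l := l) (x := shiftZ j x) (f := fun k => pos l x (k + j))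
    (fun k => by
      show pos l x (k + 1 + j) = pos l x (k + j) + l (x (k + j))
      rw [← pos_add_one]; congr 1; ring) k
  simp only [zero_add] at this
  linarith

theorem pos_mono_add (hl : ∀ a, 1 ≤ l a) (x : Cfg) {j k : ℤ} (h : j ≤ k) :
    pos l x j + (k - j) ≤ pos l x k := by
  induction k, h using Int.leInduction with
  | base => simp
  | succ k _ ih => rw [pos_add_one]; have := hl (x k); omega

theorem pos_le_iff (hl : ∀ a, 1 ≤ l a) (x : Cfg) {j k : ℤ} :
    pos l x j ≤ pos l x k ↔ j ≤ k := by
  constructor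
  · intro h; by_contra! h1; have := pos_mono_add hl x h1.le; omega
  · intro h; have := pos_mono_add hl x h; omega

theorem pos_lt_iff (hl : ∀ a, 1 ≤ l a) (x : Cfg) {j k : ℤ} :
    pos l x j < pos l x k ↔ j < k := by
  rw [← not_le, pos_le_iff hl, not_le]

theorem pos_inj (hl : ∀ a, 1 ≤ l a) (x : Cfg) {j k : ℤ} :
    pos l x j = pos l x k ↔ j = k := by
  rw [le_antisymm_iff, pos_le_iff hl, pos_le_iff hl, le_antisymm_iff]

theorem exists_blk (hl : ∀ a, 1 ≤ l a) (x : Cfg) (m : ℤ) :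
    ∃ k, pos l x k ≤ m ∧ m < pos l x (k + 1) := by
  have hb : ∃ b : ℤ, ∀ z : ℤ, pos l x z ≤ m → z ≤ b := by
    refine ⟨|m|, fun z hz => ?_⟩
    by_contra! h
    have h0 := abs_nonneg m
    have h1 := pos_mono_add hl x (show (0 : ℤ) ≤ z by omega)
    rw [pos_zero] at h1
    have := le_abs_self m
    omega
  have hi : ∃ z : ℤ, pos l x z ≤ m := by
    refine ⟨-|m|, ?_⟩
    have h0 := abs_nonneg m
    have h1 := pos_mono_add hl x (show -|m| ≤ 0 by omega)
    rw [pos_zero] at h1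
    have := neg_abs_le m
    omega
  obtain ⟨k, h1, h2⟩ := Int.exists_greatest_of_bdd hb hi
  refine ⟨k, h1, ?_⟩
  by_contra! h
  have := h2 _ h
  omega

/-- The index of the block containing `m`. -/
noncomputable def blk (l : Fin 2 → ℤ) (x : Cfg) (m : ℤ) : ℤ :=
  Classical.epsilon fun k => pos l x k ≤ m ∧ m < pos l x (k + 1)

/-- The block substitution replacing each letter `a` by the word `W a` of length `l a`. -/
noncomputable def sub (l : Fin 2 → ℤ) (W : Fin 2 → ℤ → Fin 2) (x : Cfg) : Cfg := fun m =>
  W (x (blk l x m)) (m - pos l x (blk l x m))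

theorem blk_eq (hl : ∀ a, 1 ≤ l a) (x : Cfg) {m k : ℤ} (h1 : pos l x k ≤ m)
    (h2 : m < pos l x (k + 1)) : blk l x m = k := by
  have := Classical.epsilon_spec (exists_blk hl x m)
  have a1 : blk l x m < k + 1 := (pos_lt_iff hl x).1 (this.1.trans_lt h2)
  have a2 : k < blk l x m + 1 := (pos_lt_iff hl x).1 (h1.trans_lt this.2)
  omega

theorem sub_pos_add (hl : ∀ a, 1 ≤ l a) (W : Fin 2 → ℤ → Fin 2) (x : Cfg) {k i : ℤ}
    (h1 : 0 ≤ i) (h2 : i < l (x k)) : sub l W x (pos l x k + i) = W (x k) i := by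
  have := blk_eq hl x (m := pos l x k + i) (k := k) (by omega) (by rw [pos_add_one]; omega)
  unfold sub
  rw [this]; congr 1; ring

theorem exists_pos_add (hl : ∀ a, 1 ≤ l a) (x : Cfg) (m : ℤ) :
    ∃ k i, m = pos l x k + i ∧ 0 ≤ i ∧ i < l (x k) := by
  obtain ⟨k, h1, h2⟩ := exists_blk hl x m
  rw [pos_add_one] at h2
  exact ⟨k, m - pos l x k, by ring, by omega, by omega⟩

theorem sub_shiftZ (hl : ∀ a, 1 ≤ l a) (W : Fin 2 → ℤ → Fin 2) (x : Cfg) (j : ℤ) :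
    sub l W (shiftZ j x) = shiftZ (pos l x j) (sub l W x) := by
  funext m
  obtain ⟨k, i, rfl, h1, h2⟩ := exists_pos_add hl (shiftZ j x) m
  rw [sub_pos_add hl W _ h1 h2]
  have h3 : shiftZ j x k = x (k + j) := rfl
  rw [h3] at h2 ⊢
  show _ = sub l W x (pos l (shiftZ j x) k + i + pos l x j)
  rw [pos_shiftZ, show pos l x (k + j) - pos l x j + i + pos l x j = pos l x (k + j) + i by ring,
    sub_pos_add hl W _ h1 h2]

theorem pos_congr {x x' : Cfg} {a b : ℤ} (ha : a ≤ 0) (hb : 0 ≤ b)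
    (h : ∀ i, a ≤ i → i < b → x i = x' i) {k : ℤ} (h1 : a ≤ k) (h2 : k ≤ b) :
    pos l x k = pos l x' k := by
  unfold pos
  congr 1
  · exact Finset.sum_congr rfl fun i hi => by
      rw [Finset.mem_Ico] at hi; rw [h i (by omega) (by omega)]
  · exact Finset.sum_congr rfl fun i hi => by
      rw [Finset.mem_Ico] at hi; rw [h i (by omega) (by omega)]

theorem sub_congr (hl : ∀ a, 1 ≤ l a) (W : Fin 2 → ℤ → Fin 2) {x x' : Cfg} {a b : ℤ}
    (ha : a ≤ 0) (hb : 0 ≤ b) (h : ∀ i, a ≤ i → i < b → x i = x' i) {m : ℤ}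
    (h1 : pos l x a ≤ m) (h2 : m < pos l x b) : sub l W x m = sub l W x' m := by
  obtain ⟨k, i, rfl, h3, h4⟩ := exists_pos_add hl x m
  have hk1 : k < b := (pos_lt_iff hl x).1 (by omega)
  have hk2 : a < k + 1 := (pos_lt_iff hl x).1 (by rw [pos_add_one]; omega)
  rw [sub_pos_add hl W x h3 h4, pos_congr ha hb h (by omega) hk1.le,
    h k (by omega) hk1, sub_pos_add hl W x' h3 (by rwa [← h k (by omega) hk1])]

theorem sub_agree (hl : ∀ a, 1 ≤ l a) (W : Fin 2 → ℤ → Fin 2) {x x' : Cfg} {N : ℤ}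
    (hN : 0 ≤ N) (h : Agree N x x') : Agree N (sub l W x) (sub l W x') := by
  intro m h1 h2
  refine sub_congr hl W (a := -N) (b := N + 1) (by omega) (by omega)
    (fun i hi hi' => h i hi (by omega)) ?_ ?_
  · have := pos_mono_add hl x (show -N ≤ 0 by omega)
    rw [pos_zero] at this; omega
  · have := pos_mono_add hl x (show 0 ≤ N + 1 by omega)
    rw [pos_zero] at this; omega

theorem continuous_sub (hl : ∀ a, 1 ≤ l a) (W : Fin 2 → ℤ → Fin 2) :
    Continuous (sub l W) := by
  rw [continuous_iff_continuousAt]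
  intro x U hU
  obtain ⟨N, hN, h⟩ := exists_agree_of_mem_nhds hU
  exact Filter.mem_map.2 ((eventually_agree N x).mono fun y hy => h _ (sub_agree hl W hN hy))

end Blocks

section Codes

variable {l l' : Fin 2 → ℤ}

/-- The words `1 0 0 0 ⋯`. -/
def headWord (_ : Fin 2) (i : ℤ) : Fin 2 := if i = 0 then 1 else 0

/-- The coding of a configuration by the distances between successive ones. -/
noncomputable def code (l : Fin 2 → ℤ) (x : Cfg) : Cfg := sub l headWord x

theorem code_eq_one_iff (hl : ∀ a, 1 ≤ l a) (x : Cfg) (m : ℤ) :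
    code l x m = 1 ↔ ∃ k, m = pos l x k := by
  constructor
  · obtain ⟨k, i, rfl, h1, h2⟩ := exists_pos_add hl x m
    rw [code, sub_pos_add hl _ x h1 h2, headWord]
    split_ifs with h
    · intro _; exact ⟨k, by rw [h, add_zero]⟩
    · intro h; exact absurd h (by decide)
  · rintro ⟨k, rfl⟩
    have := sub_pos_add hl headWord x (k := k) le_rfl (by have := hl (x k); omega)
    rw [add_zero] at this
    rw [code, this]; simp [headWord]

theorem exists_index_shift {f g : ℤ → ℤ} (hf : StrictMono f) (hg : StrictMono g)
    (h1 : ∀ k, ∃ j, g k = f j) (h2 : ∀ k, ∃ j, f k = g j) : ∃ k₀, ∀ k, g k = f (k + k₀) := by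
  obtain ⟨k₀, h0⟩ := h1 0
  refine ⟨k₀, fun k => ?_⟩
  induction k using Int.induction_on with
  | zero => simpa using h0
  | succ k ih =>
    obtain ⟨j, hj⟩ := h1 (k + 1)
    obtain ⟨i, hi⟩ := h2 (k + 1 + k₀)
    have a1 : (k : ℤ) + k₀ < j := hf.lt_iff_lt.1 (by rw [← hj, ← ih]; exact hg (by omega))
    have a2 : (k : ℤ) < i := hg.lt_iff_lt.1 (by rw [← hi, ih]; exact hf (by omega))
    have a3 : f (k + 1 + k₀) ≤ f j := hf.monotone (by omega)
    have a4 : g (k + 1) ≤ g i := hg.monotone (by omega)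
    omega
  | pred k ih =>
    obtain ⟨j, hj⟩ := h1 (-k - 1)
    obtain ⟨i, hi⟩ := h2 (-k - 1 + k₀)
    have a1 : j < -(k : ℤ) + k₀ := hf.lt_iff_lt.1 (by rw [← hj, ← ih]; exact hg (by omega))
    have a2 : i < -(k : ℤ) := hg.lt_iff_lt.1 (by rw [← hi, ih]; exact hf (by omega))
    have a3 : f j ≤ f (-k - 1 + k₀) := hf.monotone (by omega)
    have a4 : g i ≤ g (-k - 1) := hg.monotone (by omega)
    omega

theorem strictMono_pos (hl : ∀ a, 1 ≤ l a) (x : Cfg) : StrictMono (pos l x) :=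
  fun _ _ h => (pos_lt_iff hl x).2 h

theorem exists_shift_of_code_eq (hl : ∀ a, 1 ≤ l a) (hl' : ∀ a, 1 ≤ l' a) {x x' : Cfg}
    {c c' : ℤ} (h : shiftZ c (code l x) = shiftZ c' (code l' x')) :
    ∃ k₀, ∀ k, l (x (k + k₀)) = l' (x' k) := by
  have key : ∀ m, (∃ k, m = pos l x k - c) ↔ ∃ k, m = pos l' x' k - c' := by
    intro m
    have h1 := congrFun h m
    simp only [shiftZ] at h1
    have h2 := code_eq_one_iff hl x (m + c)
    have h3 := code_eq_one_iff hl' x' (m + c')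
    rw [h1, h3] at h2
    simpa only [eq_sub_iff_add_eq] using h2.symm
  obtain ⟨k₀, hk⟩ := exists_index_shift (f := fun k => pos l x k - c)
    (g := fun k => pos l' x' k - c')
    (fun a b hab => by have := strictMono_pos hl x hab; simp only; omega)
    (fun a b hab => by have := strictMono_pos hl' x' hab; simp only; omega)
    (fun k => (key _).2 ⟨k, rfl⟩) (fun k => (key _).1 ⟨k, rfl⟩)
  refine ⟨k₀, fun k => ?_⟩
  have h1 := hk k
  have h2 := hk (k + 1)
  simp only [show k + 1 + k₀ = k + k₀ + 1 by ring, pos_add_one] at h1 h2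
  omega

theorem code_shiftZ (hl : ∀ a, 1 ≤ l a) (x : Cfg) (j : ℤ) :
    code l (shiftZ j x) = shiftZ (pos l x j) (code l x) := sub_shiftZ hl _ x j

theorem exists_shift_of_code_eq_self (hl : ∀ a, 1 ≤ l a) (hne : l 0 ≠ l 1) {x x' : Cfg}
    {c c' : ℤ} (h : shiftZ c (code l x) = shiftZ c' (code l x')) :
    ∃ k₀, x' = shiftZ k₀ x := by
  obtain ⟨k₀, hk⟩ := exists_shift_of_code_eq hl hl h
  refine ⟨k₀, funext fun k => ?_⟩
  have := hk k
  simp only [shiftZ]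
  rcases fin_two_cases (x (k + k₀)) with h1 | h1 <;> rcases fin_two_cases (x' k) with h2 | h2 <;>
    rw [h1, h2] at this ⊢ <;> omega

end Codes

end CPE

namespace CPE

section Pieces

variable {l m : Fin 2 → ℤ} {W V : Fin 2 → ℤ → Fin 2}

theorem pos_const (l : Fin 2 → ℤ) (a : Fin 2) (k : ℤ) : pos l (fun _ => a) k = l a * k := by
  have := eq_pos_of_step (l := l) (x := fun _ => a) (f := fun k => l a * k)
    (fun k => by ring) k
  simpa using this.symm

theorem pos_nonneg (hl : ∀ a, 1 ≤ l a) (x : Cfg) {k : ℤ} (hk : 0 ≤ k) : 0 ≤ pos l x k := by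
  rw [← pos_zero l x]; exact (pos_le_iff hl x).2 hk

theorem pos_ge (hl : ∀ a, 1 ≤ l a) (x : Cfg) {k : ℤ} (hk : 0 ≤ k) : k ≤ pos l x k := by
  have := pos_mono_add hl x hk
  rw [pos_zero] at this; omega

theorem shiftZ_sub_agree_word (hl : ∀ a, 1 ≤ l a) (W : Fin 2 → ℤ → Fin 2) (w : Cfg) (k : ℤ) :
    ∀ i, 0 ≤ i → i < l (w k) → shiftZ (pos l w k) (sub l W w) i = W (w k) i := by
  intro i h1 h2
  rw [← sub_pos_add hl W w h1 h2, shiftZ, add_comm]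

theorem pos_sub (hl : ∀ a, 1 ≤ l a) (W : Fin 2 → ℤ → Fin 2) (m : Fin 2 → ℤ) (w : Cfg) (k : ℤ) :
    pos m (sub l W w) (pos l w k) = pos (fun a => pos m (W a) (l a)) w k := by
  have := eq_pos_of_step (l := fun a => pos m (W a) (l a)) (x := w)
    (f := fun k => pos m (sub l W w) (pos l w k)) (fun k => by
      have h := pos_shiftZ m (sub l W w) (pos l w k) (l (w k))
      rw [add_comm (l (w k)), ← pos_add_one] at h
      have h2 := pos_congr (l := m) (x := shiftZ (pos l w k) (sub l W w)) (x' := W (w k))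
        (a := 0) (b := l (w k)) le_rfl (by have := hl (w k); omega)
        (shiftZ_sub_agree_word hl W w k) (k := l (w k)) (by have := hl (w k); omega) le_rfl
      omega) k
  simpa using this

theorem sub_sub (hl : ∀ a, 1 ≤ l a) (hm : ∀ a, 1 ≤ m a) (W V : Fin 2 → ℤ → Fin 2) (w : Cfg) :
    sub m V (sub l W w) = sub (fun a => pos m (W a) (l a)) (fun a => sub m V (W a)) w := by
  have hl' : ∀ a, 1 ≤ pos m (W a) (l a) := fun a => by
    have := pos_ge hm (W a) (k := l a) (by have := hl a; omega)
    have := hl a; omega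
  funext i
  obtain ⟨k, i, rfl, h1, h2⟩ := exists_pos_add hl' w i
  rw [sub_pos_add hl' _ w h1 h2, ← pos_sub hl]
  have h3 := congrFun (sub_shiftZ hm V (sub l W w) (pos l w k)) i
  rw [shiftZ, add_comm] at h3
  rw [← h3]
  have h0 : 0 ≤ l (w k) := by have := hl (w k); omega
  refine sub_congr hm V (a := 0) (b := l (w k)) le_rfl h0
    (shiftZ_sub_agree_word hl W w k) (by simpa using h1) ?_
  rw [pos_congr (x' := W (w k)) (a := 0) (b := l (w k)) le_rfl h0
    (shiftZ_sub_agree_word hl W w k) h0 le_rfl]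
  exact h2

/-- The number of ones among the first `n` letters. -/
noncomputable def ones (n : ℤ) (u : ℤ → Fin 2) : ℤ := ∑ i ∈ Finset.Ico 0 n, ((u i : ℕ) : ℤ)

theorem pos_eq_ones (l : Fin 2 → ℤ) (u : Cfg) {n : ℤ} (hn : 0 ≤ n) :
    pos l u n = l 0 * n + (l 1 - l 0) * ones n u := by
  rw [pos, Finset.Ico_eq_empty_of_le hn, Finset.sum_empty, sub_zero, ones, Finset.mul_sum,
    show l 0 * n = ∑ i ∈ Finset.Ico 0 n, l 0 by simp [hn, mul_comm], ← Finset.sum_add_distrib]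
  refine Finset.sum_congr rfl fun i _ => ?_
  rcases fin_two_cases (u i) with h | h <;> rw [h] <;> simp

theorem ones_code (hl : ∀ a, 1 ≤ l a) (x : Cfg) {n : ℤ} (hn : 0 ≤ n) :
    ones (pos l x n) (code l x) = n := by
  rw [ones, ← Finset.sum_subset (s₁ := (Finset.Ico 0 n).image (pos l x))]
  · rw [Finset.sum_image fun a _ b _ h => (pos_inj hl x).1 h,
      Finset.sum_congr rfl (g := fun _ => (1 : ℤ))]
    · simp [hn]
    · intro k _
      rw [(code_eq_one_iff hl x _).2 ⟨k, rfl⟩]; rfl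
  · intro i hi
    obtain ⟨k, hk, rfl⟩ := Finset.mem_image.1 hi
    rw [Finset.mem_Ico] at hk ⊢
    exact ⟨pos_nonneg hl x hk.1, (pos_lt_iff hl x).2 hk.2⟩
  · intro i hi hi'
    rcases fin_two_cases (code l x i) with h | h
    · rw [h]; rfl
    · obtain ⟨k, rfl⟩ := (code_eq_one_iff hl x i).1 h
      refine absurd (Finset.mem_image.2 ⟨k, ?_, rfl⟩) hi'
      rw [Finset.mem_Ico] at hi ⊢
      refine ⟨(pos_le_iff hl x).1 (by rw [pos_zero]; exact hi.1), (pos_lt_iff hl x).1 hi.2⟩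

/-- `X` contains every shift of every concatenation of the words `W 0`, `W 1`. -/
structure IsPiece (X : Set Cfg) (l : Fin 2 → ℤ) (W : Fin 2 → ℤ → Fin 2) : Prop where
  one_le : ∀ a, 1 ≤ l a
  mem : ∀ w c, shiftZ c (sub l W w) ∈ X

/-- The pairs of points that are concatenations of `W 0` and `W 1`. -/
def piecePairs (l : Fin 2 → ℤ) (W : Fin 2 → ℤ → Fin 2) : Set (Cfg × Cfg) :=
  {p | ∃ w w' c c', p.1 = shiftZ c (sub l W w) ∧ p.2 = shiftZ c' (sub l W w')}

/-- Pairs lying in a piece whose words have abelianization of determinant `±1`. -/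
def unimodularPairs (X : Set Cfg) : Set (Cfg × Cfg) :=
  {p | ∃ l W, IsPiece X l W ∧ (l 0 * ones (l 1) (W 1) - ones (l 0) (W 0) * l 1 = 1 ∨
    l 0 * ones (l 1) (W 1) - ones (l 0) (W 0) * l 1 = -1) ∧ p ∈ piecePairs l W}

/-- Pairs lying in a piece whose words have coprime lengths. -/
def coprimePairs (X : Set Cfg) : Set (Cfg × Cfg) :=
  {p | ∃ l W, IsPiece X l W ∧ IsCoprime (l 0) (l 1) ∧ p ∈ piecePairs l W}

theorem unimodularPairs_subset_coprimePairs (X : Set Cfg) :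
    unimodularPairs X ⊆ coprimePairs X := by
  rintro p ⟨l, W, h, hd | hd, hp⟩
  · exact ⟨l, W, h, ⟨ones (l 1) (W 1), -ones (l 0) (W 0), by linarith⟩, hp⟩
  · exact ⟨l, W, h, ⟨-ones (l 1) (W 1), ones (l 0) (W 0), by linarith⟩, hp⟩

section Composition

variable {X D : Set Cfg}

theorem IsPiece.code_comp (hm : ∀ a, 1 ≤ m a) (hD : ∀ x ∈ D, ∀ c, shiftZ c (code m x) ∈ X)
    (h : IsPiece D l W) :
    IsPiece X (fun a => pos m (W a) (l a)) (fun a => code m (W a)) := by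
  have hl := h.one_le
  refine ⟨fun a => ?_, fun w c => ?_⟩
  · have := pos_ge hm (W a) (k := l a) (by have := hl a; omega)
    have := hl a; omega
  · have := sub_sub hl hm W headWord w
    unfold code
    rw [← this]
    have h2 := h.mem w 0
    rw [shiftZ_zero] at h2
    exact hD _ h2 c

theorem code_piecePairs (hm : ∀ a, 1 ≤ m a) (hl : ∀ a, 1 ≤ l a) {p : Cfg × Cfg}
    (hp : p ∈ piecePairs l W) (c c' : ℤ) :
    (shiftZ c (code m p.1), shiftZ c' (code m p.2)) ∈
      piecePairs (fun a => pos m (W a) (l a)) (fun a => code m (W a)) := by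
  obtain ⟨w, w', d, d', h1, h2⟩ := hp
  refine ⟨w, w', c + pos m (sub l W w) d, c' + pos m (sub l W w') d', ?_, ?_⟩
  · unfold code
    rw [← sub_sub hl hm, h1, sub_shiftZ hm, shiftZ_shiftZ]
  · unfold code
    rw [← sub_sub hl hm, h2, sub_shiftZ hm, shiftZ_shiftZ]

theorem code_mem_unimodularPairs (hm : ∀ a, 1 ≤ m a) (hm1 : m 1 - m 0 = -1)
    (hD : ∀ x ∈ D, ∀ c, shiftZ c (code m x) ∈ X) {p : Cfg × Cfg}
    (hp : p ∈ unimodularPairs D) (c c' : ℤ) :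
    (shiftZ c (code m p.1), shiftZ c' (code m p.2)) ∈ unimodularPairs X := by
  obtain ⟨l, W, h, hd, hp⟩ := hp
  have hl := h.one_le
  refine ⟨_, _, h.code_comp hm hD, ?_, code_piecePairs hm hl hp c c'⟩
  have h0 : ∀ a, 0 ≤ l a := fun a => zero_le_one.trans (hl a)
  simp only [ones_code hm _ (h0 _)]
  simp only [pos_eq_ones m _ (h0 _), hm1]
  rcases hd with hd | hd
  · left; linear_combination hd
  · right; linear_combination hd

theorem code_mem_coprimePairs (hm : ∀ a, 1 ≤ m a) (hm0 : m 0 = 1)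
    (hD : ∀ x ∈ D, ∀ c, shiftZ c (code m x) ∈ X) {p : Cfg × Cfg}
    (hp : p ∈ unimodularPairs D) (c c' : ℤ) :
    (shiftZ c (code m p.1), shiftZ c' (code m p.2)) ∈ coprimePairs X := by
  obtain ⟨l, W, h, hd, hp⟩ := hp
  have hl := h.one_le
  refine ⟨_, _, h.code_comp hm hD, ?_, code_piecePairs hm hl hp c c'⟩
  have h0 : ∀ a, 0 ≤ l a := fun a => zero_le_one.trans (hl a)
  simp only [pos_eq_ones m _ (h0 _), hm0]
  rcases hd with hd | hd
  · exact ⟨ones (l 1) (W 1), -ones (l 0) (W 0), by linear_combination hd⟩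
  · exact ⟨-ones (l 1) (W 1), ones (l 0) (W 0), by linear_combination -hd⟩

end Composition

end Pieces

section Independence

variable {l : Fin 2 → ℤ}

/-- `x` and `y` can be realized independently along an arithmetic progression, at every
resolution. -/
def IndepPair (X : Set Cfg) (p : Cfg × Cfg) : Prop :=
  ∀ N : ℤ, ∃ L : ℤ, 1 ≤ L ∧ ∀ v : Cfg, ∃ z ∈ X, ∀ j i, -N ≤ i → i ≤ N →
    z (j * L + i) = if v j = 0 then p.1 i else p.2 i

theorem indepPair_of_mem_closure {X : Set Cfg} {S : Set (Cfg × Cfg)}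
    (hS : ∀ p ∈ S, IndepPair X p) {p : Cfg × Cfg} (hp : p ∈ closure S) : IndepPair X p := by
  intro N
  obtain ⟨q, hq, h1, h2⟩ := mem_closure_prod_iff_agree.1 hp N
  obtain ⟨L, hL, h⟩ := hS q hq N
  refine ⟨L, hL, fun v => ?_⟩
  obtain ⟨z, hz, h⟩ := h v
  refine ⟨z, hz, fun j i hi hi' => ?_⟩
  rw [h j i hi hi', h1 i hi hi', h2 i hi hi']

/-- Concatenation of the first `M` letters of `x` with `y`. -/
def cat (M : ℤ) (x y : Cfg) : Cfg := fun i => if i < M then x i else y (i - M)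

theorem pos_cat_left {M : ℤ} (hM : 0 ≤ M) (l : Fin 2 → ℤ) (x y : Cfg) :
    pos l (cat M x y) M = pos l x M :=
  pos_congr le_rfl hM (fun i _ h => by simp [cat, h]) hM le_rfl

theorem pos_cat_add {M n : ℤ} (hM : 0 ≤ M) (hn : 0 ≤ n) (l : Fin 2 → ℤ) (x y : Cfg) :
    pos l (cat M x y) (M + n) = pos l x M + pos l y n := by
  have h := pos_shiftZ l (cat M x y) M n
  rw [pos_congr (x' := y) (a := 0) (b := n) le_rfl hn
    (fun i h _ => by simp [shiftZ, cat, h]) hn le_rfl, pos_cat_left hM, add_comm n] at h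
  omega

theorem sub_cat_left (hl : ∀ a, 1 ≤ l a) (W : Fin 2 → ℤ → Fin 2) {M : ℤ} (hM : 0 ≤ M)
    (x y : Cfg) {i : ℤ} (h1 : 0 ≤ i) (h2 : i < pos l x M) :
    sub l W (cat M x y) i = sub l W x i :=
  sub_congr hl W le_rfl hM (fun i _ h => by simp [cat, h]) (by simpa using h1)
    (by rwa [pos_cat_left hM])

theorem sub_cat_right (hl : ∀ a, 1 ≤ l a) (W : Fin 2 → ℤ → Fin 2) {M n : ℤ} (hM : 0 ≤ M)
    (hn : 0 ≤ n) (x y : Cfg) {i : ℤ} (h1 : 0 ≤ i) (h2 : i < pos l y n) :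
    sub l W (cat M x y) (pos l x M + i) = sub l W y i := by
  have h := congrFun (sub_shiftZ hl W (cat M x y) M) i
  rw [shiftZ, pos_cat_left hM, add_comm] at h
  rw [← h]
  exact (sub_congr hl W le_rfl hn (fun i h _ => by simp [shiftZ, cat, h]) (by simpa using h1)
    h2).symm

theorem exists_pos_eq (hl : ∀ a, 1 ≤ l a) (hc : IsCoprime (l 0) (l 1)) {e : ℤ}
    (he : l 0 * l 1 ≤ e) : ∃ (A : Cfg) (M : ℤ), 0 ≤ M ∧ pos l A M = e := by
  obtain ⟨a, b, hab⟩ := hc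
  have h0 := hl 0
  have h1 := hl 1
  set α := (e * a) % l 1 with hα
  set β := e * b + l 0 * ((e * a) / l 1) with hβ
  have hα0 : 0 ≤ α := Int.emod_nonneg _ (by omega)
  have hα1 : α < l 1 := Int.emod_lt_of_pos _ (by omega)
  have hdm : α + l 1 * ((e * a) / l 1) = e * a := Int.emod_add_mul_ediv _ _
  have hsum : l 0 * α + l 1 * β = e := by
    rw [hβ]; linear_combination l 0 * hdm + e * hab
  have hβ0 : 0 ≤ β := by
    by_contra! h
    nlinarith
  refine ⟨cat α (fun _ => 0) (fun _ => 1), α + β, by omega, ?_⟩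
  rw [pos_cat_add hα0 hβ0, pos_const, pos_const, hsum]

theorem exists_padding (hl : ∀ a, 1 ≤ l a) (hc : IsCoprime (l 0) (l 1))
    (W : Fin 2 → ℤ → Fin 2) (u : Cfg) {n e f : ℤ} (hn : 0 ≤ n) (he : l 0 * l 1 ≤ e)
    (hf : l 0 * l 1 ≤ f) : ∃ (A : Cfg) (M : ℤ), 0 ≤ M ∧ pos l A M = e + pos l u n + f ∧
      ∀ i, 0 ≤ i → i < pos l u n → sub l W A (e + i) = sub l W u i := by
  obtain ⟨A, M, hM, hA⟩ := exists_pos_eq hl hc he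
  obtain ⟨B, M', hM', hB⟩ := exists_pos_eq hl hc hf
  have he0 : 0 ≤ e := by nlinarith [hl 0, hl 1]
  refine ⟨cat (M + n) (cat M A u) B, M + n + M', by omega, ?_, fun i h1 h2 => ?_⟩
  · rw [pos_cat_add (by omega) hM', pos_cat_add hM hn, hA, hB]
  · rw [sub_cat_left hl W (by omega) _ _ (by omega) (by rw [pos_cat_add hM hn]; omega), ← hA,
      sub_cat_right hl W hM hn _ _ h1 h2]

theorem exists_window (hl : ∀ a, 1 ≤ l a) (W : Fin 2 → ℤ → Fin 2) (w : Cfg) (c N : ℤ)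
    (hN : 0 ≤ N) : ∃ (u : Cfg) (n s : ℤ), 0 ≤ n ∧ N ≤ s ∧ s + N < pos l u n ∧
      ∀ i, shiftZ c (sub l W w) i = sub l W u (s + i) := by
  obtain ⟨k, hk1, hk2⟩ := exists_blk hl w (c - N)
  obtain ⟨k', hk1', hk2'⟩ := exists_blk hl w (c + N)
  have : k < k' + 1 := (pos_lt_iff hl w).1 (by omega)
  refine ⟨shiftZ k w, k' + 1 - k, c - pos l w k, by omega, by omega, ?_, fun i => ?_⟩
  · rw [pos_shiftZ, sub_add_cancel]; omega
  · rw [sub_shiftZ hl, shiftZ, shiftZ]; congr 1; ring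

theorem indepPair_of_mem_coprimePairs {X : Set Cfg} {p : Cfg × Cfg} (hp : p ∈ coprimePairs X) :
    IndepPair X p := by
  obtain ⟨l, W, ⟨hl, hX⟩, hc, w, w', c, c', hx, hy⟩ := hp
  intro N'
  obtain ⟨N, hN, hN'⟩ : ∃ N : ℤ, 0 ≤ N ∧ N' ≤ N := ⟨max N' 0, le_max_right _ _, le_max_left _ _⟩
  obtain ⟨u, n, s, hn, hs, hsN, hu⟩ := exists_window hl W w c N hN
  obtain ⟨u', n', s', hn', hs', hsN', hu'⟩ := exists_window hl W w' c' N hN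
  obtain ⟨A, M, hM, hA, hA'⟩ := exists_padding hl hc W u (e := l 0 * l 1 + s')
    (f := l 0 * l 1 + s + pos l u' n') hn (by omega) (by omega)
  obtain ⟨B, M', hM', hB, hB'⟩ := exists_padding hl hc W u' (e := l 0 * l 1 + s)
    (f := l 0 * l 1 + s' + pos l u n) hn' (by omega) (by omega)
  have hF : 1 ≤ l 0 * l 1 := by nlinarith [hl 0, hl 1]
  set L := pos l A M with hL
  have hLB : pos l B M' = L := by rw [hA, hB]; ring
  have hM0 : 1 ≤ M := by
    have : 0 < M := (pos_lt_iff hl A).1 (by rw [pos_zero]; omega)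
    omega
  have hM0' : 1 ≤ M' := by
    have : 0 < M' := (pos_lt_iff hl B).1 (by rw [pos_zero]; omega)
    omega
  refine ⟨L, by omega, fun v => ?_⟩
  set lm : Fin 2 → ℤ := fun a => if a = 0 then M else M' with hlm
  set Wm : Fin 2 → ℤ → Fin 2 := fun a => if a = 0 then A else B with hWm
  have hlm1 : ∀ a, 1 ≤ lm a := fun a => by simp only [hlm]; split_ifs <;> omega
  have hcomp := sub_sub hlm1 hl Wm W v
  have hlen : (fun a => pos l (Wm a) (lm a)) = fun _ => L := by
    funext a; simp only [hlm, hWm]; split_ifs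
    · rfl
    · exact hLB
  rw [hlen] at hcomp
  have hpos : ∀ j, pos (fun _ : Fin 2 => L) v j = j * L := fun j => by
    have := eq_pos_of_step (l := fun _ : Fin 2 => L) (x := v) (f := fun j => j * L)
      (fun k => by ring) j
    simpa using this.symm
  refine ⟨shiftZ (l 0 * l 1 + s + s') (sub l W (sub lm Wm v)), hX _ _, fun j i h1 h2 => ?_⟩
  rw [hcomp, shiftZ, show j * L + i + (l 0 * l 1 + s + s') = pos (fun _ => L) v j +
    (l 0 * l 1 + s + s' + i) by rw [hpos]; ring,
    sub_pos_add (fun _ => by omega) _ _ (by omega) (by omega)]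
  simp only [hWm]
  split_ifs with hv
  · rw [hx, hu, show l 0 * l 1 + s + s' + i = l 0 * l 1 + s' + (s + i) by ring,
      hA' _ (by omega) (by omega)]
  · rw [hy, hu', show l 0 * l 1 + s + s' + i = l 0 * l 1 + s + (s' + i) by ring,
      hB' _ (by omega) (by omega)]

end Independence

end CPE

namespace CPE

section Entropy

variable {X : Set Cfg}

/-- The word `u` names a piece of the joined cover containing `z`. -/
def Names (U V : Set Cfg) {n : ℕ} (u : Fin n → Bool) (z : Cfg) : Prop :=
  ∀ i : Fin n, shiftZ ((i : ℕ) : ℤ) z ∈ if u i then Vᶜ else Uᶜ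

theorem coverNum_set_eq (U V : Set Cfg) (n : ℕ) :
    coverNum X Uᶜ Vᶜ n = sInf {m | ∃ S : Finset (Fin n → Bool), S.card = m ∧
      ∀ z ∈ X, ∃ u ∈ S, Names U V u z} := by
  unfold coverNum
  congr 1
  ext m
  refine exists_congr fun S => and_congr_right fun _ => ?_
  constructor
  · intro h z hz
    have := h hz
    simp only [mem_iUnion, mem_iInter, mem_preimage, iterate_shiftMap] at this
    obtain ⟨u, hu, hi⟩ := this
    exact ⟨u, hu, hi⟩
  · intro h z hz
    obtain ⟨u, hu, hi⟩ := h z hz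
    simp only [mem_iUnion, mem_iInter, mem_preimage, iterate_shiftMap]
    exact ⟨u, hu, hi⟩

theorem coverNum_le {U V : Set Cfg} {n : ℕ} (S : Finset (Fin n → Bool))
    (h : ∀ z ∈ X, ∃ u ∈ S, Names U V u z) : coverNum X Uᶜ Vᶜ n ≤ S.card := by
  rw [coverNum_set_eq]
  exact Nat.sInf_le ⟨S, rfl, h⟩

theorem le_coverNum {U V : Set Cfg} (hUV : Disjoint U V) {n k : ℕ}
    (h : ∀ S : Finset (Fin n → Bool), (∀ z ∈ X, ∃ u ∈ S, Names U V u z) → k ≤ S.card) :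
    k ≤ coverNum X Uᶜ Vᶜ n := by
  rw [coverNum_set_eq]
  refine le_csInf ⟨_, Finset.univ, rfl, fun z _ => ?_⟩ ?_
  · classical
    refine ⟨fun i => decide (shiftZ ((i : ℕ) : ℤ) z ∈ U), Finset.mem_univ _, fun i => ?_⟩
    by_cases hz : shiftZ ((i : ℕ) : ℤ) z ∈ U
    · simpa [hz] using Set.disjoint_left.1 hUV hz
    · simp [hz]
  · rintro _ ⟨S, rfl, hS⟩
    exact h S hS

theorem exists_agree_of_mem_nhdsWithin {x : Cfg} {U : Set Cfg} (hU : U ∈ 𝓝[X] x) :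
    ∃ N : ℤ, 0 ≤ N ∧ ∀ y ∈ X, Agree N x y → y ∈ U := by
  rw [mem_nhdsWithin_iff_exists_mem_nhds_inter] at hU
  obtain ⟨U', hU', h⟩ := hU
  obtain ⟨N, hN, hN'⟩ := exists_agree_of_mem_nhds hU'
  exact ⟨N, hN, fun y hy hy' => h ⟨hN' y hy', hy⟩⟩

theorem IndepPair.isEntropyPair (hX : ∀ x ∈ X, ∀ c, shiftZ c x ∈ X) {x y : Cfg}
    (hx : x ∈ X) (hy : y ∈ X) (hne : x ≠ y) (h : IndepPair X (x, y)) :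
    IsEntropyPair X x y := by
  refine ⟨hx, hy, hne, fun U V _ _ hU hV hUV => ?_⟩
  obtain ⟨N₁, hN₁, hU'⟩ := exists_agree_of_mem_nhdsWithin hU
  obtain ⟨N₂, hN₂, hV'⟩ := exists_agree_of_mem_nhdsWithin hV
  obtain ⟨L', hL', hind⟩ := h (max N₁ N₂)
  lift L' to ℕ using by omega with L
  have hL : 1 ≤ L := by exact_mod_cast hL'
  have hbound : ∀ n : ℕ, 2 ^ (n / L + 1) ≤ coverNum X Uᶜ Vᶜ (n + 1) := by
    intro n
    refine le_coverNum hUV fun S hS => ?_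
    have hlt : ∀ j : Fin (n / L + 1), (j : ℕ) * L < n + 1 := fun j => by
      have h1 : (j : ℕ) ≤ n / L := by omega
      have := (Nat.mul_le_mul_right L h1).trans (Nat.div_mul_le_self n L)
      omega
    have key : ∀ v : Fin (n / L + 1) → Fin 2, ∃ u ∈ S, ∀ j : Fin (n / L + 1),
        (u ⟨(j : ℕ) * L, hlt j⟩ = true ↔ v j = 0) := by
      intro v
      obtain ⟨z, hz, hzv⟩ := hind fun j =>
        if hj : j.toNat < n / L + 1 then v ⟨j.toNat, hj⟩ else 0
      obtain ⟨u, hu, hnu⟩ := hS z hz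
      refine ⟨u, hu, fun j => ?_⟩
      have h1 := hnu ⟨(j : ℕ) * L, hlt j⟩
      simp only [Nat.cast_mul] at h1
      have h2 := hzv (j : ℕ)
      simp only [Int.toNat_natCast, Fin.is_lt, dif_pos, Fin.eta] at h2
      rcases fin_two_cases (v j) with hv | hv
      · have h3 : shiftZ ((j : ℕ) * L : ℤ) z ∈ U := by
          refine hU' _ (hX z hz _) fun i hi hi' => ?_
          have := h2 i (by omega) (by omega)
          rw [if_pos hv] at this
          rw [shiftZ, add_comm]; exact this.symm
        have h4 : u ⟨(j : ℕ) * L, hlt j⟩ = true := by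
          by_contra hc
          rw [if_neg hc] at h1
          exact h1 h3
        simp [h4, hv]
      · have h3 : shiftZ ((j : ℕ) * L : ℤ) z ∈ V := by
          refine hV' _ (hX z hz _) fun i hi hi' => ?_
          have := h2 i (by omega) (by omega)
          rw [if_neg (by rw [hv]; decide)] at this
          rw [shiftZ, add_comm]; exact this.symm
        have h4 : ¬ u ⟨(j : ℕ) * L, hlt j⟩ = true := by
          intro hc
          rw [if_pos hc] at h1
          exact h1 h3
        simp only [hv, h4]; decide
    choose f hf hfv using key
    have hinj : Function.Injective f := fun v v' hvv => by
      funext j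
      have h1 := hfv v j
      rw [hvv, hfv v' j] at h1
      rcases fin_two_cases (v j) with a | a <;> rcases fin_two_cases (v' j) with b | b <;>
        rw [a, b] at h1 ⊢ <;> exact absurd h1 (by decide)
    calc 2 ^ (n / L + 1) = (Finset.univ.image f).card := by
          rw [Finset.card_image_of_injective _ hinj]; simp
      _ ≤ S.card := Finset.card_le_card fun u hu => by
          obtain ⟨v, _, rfl⟩ := Finset.mem_image.1 hu
          exact hf v
  have hLpos : (0 : ℝ) < L := by exact_mod_cast hL
  refine lt_of_lt_of_le (b := Real.log 2 / L) (div_pos (Real.log_pos one_lt_two) hLpos)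
    (le_ciInf fun n => ?_)
  have h1 : (n + 1 : ℝ) ≤ L * (n / L + 1 : ℕ) := by
    have := Nat.lt_mul_div_succ n (show 0 < L by omega)
    exact_mod_cast this
  have h2 : ((n / L + 1 : ℕ) : ℝ) * Real.log 2 ≤ Real.log (coverNum X Uᶜ Vᶜ (n + 1)) := by
    rw [← Real.log_pow]
    exact Real.log_le_log (by positivity) (by exact_mod_cast hbound n)
  rw [div_le_div_iff₀ hLpos (by positivity)]
  have h3 := Real.log_pos one_lt_two
  nlinarith

theorem IsEntropyPair.mem_of_saturated {R : Set (Cfg × Cfg)} (hR : IsClosed R)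
    (hrefl : ∀ x ∈ X, (x, x) ∈ R)
    (hsat : ∀ x y, (x, y) ∈ R → ∀ i j, (shiftZ i x, shiftZ j y) ∈ R) {x y : Cfg}
    (h : IsEntropyPair X x y) : (x, y) ∈ R := by
  by_contra hxy
  obtain ⟨hx, hy, hne, h⟩ := h
  have h1 : ∃ N, ∀ q ∈ R, ¬ (Agree N x q.1 ∧ Agree N y q.2) := by
    rw [← hR.closure_eq, mem_closure_prod_iff_agree] at hxy
    push Not at hxy
    obtain ⟨N, hN⟩ := hxy
    exact ⟨N, fun q hq hc => hN q hq hc.1 hc.2⟩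
  obtain ⟨N₁, hN₁⟩ := h1
  obtain ⟨i, hi⟩ := Function.ne_iff.1 hne
  obtain ⟨N, hN, hiN⟩ : ∃ N, N₁ ≤ N ∧ |i| ≤ N := ⟨max N₁ |i|, le_max_left _ _, le_max_right _ _⟩
  have hdisj : Disjoint {z | Agree N x z} {z | Agree N y z} := by
    rw [Set.disjoint_left]
    intro z h1 h2
    have h3 := abs_le.1 hiN
    exact hi ((h1 i h3.1 h3.2).trans (h2 i h3.1 h3.2).symm)
  have hpos := h _ _ (isClosed_agree N x) (isClosed_agree N y)
    (mem_nhdsWithin_of_mem_nhds (eventually_agree N x))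
    (mem_nhdsWithin_of_mem_nhds (eventually_agree N y)) hdisj
  have hle : ∀ n : ℕ, coverNum X {z | Agree N x z}ᶜ {z | Agree N y z}ᶜ (n + 1) ≤ 2 := by
    intro n
    refine (coverNum_le {fun _ => false, fun _ => true} fun z hz => ?_).trans Finset.card_le_two
    by_cases hc : ∃ j : Fin (n + 1), Agree N x (shiftZ ((j : ℕ) : ℤ) z)
    · obtain ⟨j, hj⟩ := hc
      refine ⟨fun _ => true, by simp, fun k => ?_⟩
      simp only [if_true]
      intro hk
      exact hN₁ _ (hsat z z (hrefl z hz) ((j : ℕ) : ℤ) ((k : ℕ) : ℤ)) ⟨hj.mono hN, hk.mono hN⟩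
    · refine ⟨fun _ => false, by simp, fun k => ?_⟩
      simp only [Bool.false_eq_true, if_false]
      exact fun hk => hc ⟨k, hk⟩
  set c := coverEntropy X {z | Agree N x z}ᶜ {z | Agree N y z}ᶜ with hc
  have hcle : ∀ n : ℕ, c ≤ Real.log 2 / (n + 1) := by
    intro n
    refine (ciInf_le ⟨0, ?_⟩ n).trans ?_
    · rintro _ ⟨k, rfl⟩
      exact div_nonneg (Real.log_natCast_nonneg _) (by positivity)
    · refine div_le_div_of_nonneg_right ?_ (by positivity)
      rcases Nat.eq_zero_or_pos
        (coverNum X {z | Agree N x z}ᶜ {z | Agree N y z}ᶜ (n + 1)) with h0 | h0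
      · rw [h0]; simpa using (Real.log_pos one_lt_two).le
      · exact Real.log_le_log (by exact_mod_cast h0) (by exact_mod_cast hle n)
  obtain ⟨n, hn⟩ := exists_nat_gt (Real.log 2 / c)
  have h2 := hcle n
  rw [le_div_iff₀ (by positivity)] at h2
  rw [div_lt_iff₀ hpos] at hn
  nlinarith

theorem EP_eq_of_saturated {R : Set (Cfg × Cfg)} (hX : ∀ x ∈ X, ∀ c, shiftZ c x ∈ X)
    (hR : IsClosed R) (hRX : R ⊆ X ×ˢ X) (hrefl : ∀ x ∈ X, (x, x) ∈ R)
    (hsat : ∀ x y, (x, y) ∈ R → ∀ i j, (shiftZ i x, shiftZ j y) ∈ R)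
    (hcp : R ⊆ closure (coprimePairs X)) : EP X = R := by
  ext ⟨x, y⟩
  constructor
  · rintro (h | ⟨h, h'⟩)
    · exact IsEntropyPair.mem_of_saturated hR hrefl hsat h
    · simp only at h h'
      subst h'
      exact hrefl x h
  · intro h
    by_cases hxy : x = y
    · exact Or.inr ⟨(hRX h).1, hxy⟩
    · exact Or.inl (IndepPair.isEntropyPair hX (hRX h).1 (hRX h).2 hxy
        (indepPair_of_mem_closure (fun _ => indepPair_of_mem_coprimePairs) (hcp h)))

theorem isSubshift_of_shiftZ (hc : IsClosed X) (hX : ∀ x ∈ X, ∀ c, shiftZ c x ∈ X) :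
    IsSubshift X := by
  refine ⟨hc, Set.Subset.antisymm ?_ fun x hx => ⟨shiftZ (-1) x, hX x hx _, ?_⟩⟩
  · rintro _ ⟨x, hx, rfl⟩
    exact hX x hx 1
  · funext i; simp [shiftMap, shiftZ]

end Entropy

end CPE

namespace CPE

open Order

section Relations

/-- A relation invariant under independent shifts of both coordinates. -/
def Saturated (R : Set (Cfg × Cfg)) : Prop :=
  ∀ x y, (x, y) ∈ R → ∀ i j, (shiftZ i x, shiftZ j y) ∈ R

theorem Saturated.closure {R : Set (Cfg × Cfg)} (h : Saturated R) : Saturated (closure R) := by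
  intro x y hxy i j
  exact map_mem_closure (f := fun p : Cfg × Cfg => (shiftZ i p.1, shiftZ j p.2))
    (((continuous_shiftZ i).comp continuous_fst).prodMk
      ((continuous_shiftZ j).comp continuous_snd)) hxy (fun p hp => h p.1 p.2 hp i j)

theorem Saturated.transGen {R : Set (Cfg × Cfg)} (h : Saturated R) :
    Saturated {p | Relation.TransGen (fun a b => (a, b) ∈ R) p.1 p.2} := by
  intro x y hxy
  change Relation.TransGen (fun a b => (a, b) ∈ R) x y at hxy
  induction hxy with
  | single hb => exact fun i j => Relation.TransGen.single (h _ _ hb i j)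
  | tail _ hb ih =>
    exact fun i j => Relation.TransGen.tail (ih i 0) (h _ _ hb 0 j)

theorem Saturated.closeUp {R : Set (Cfg × Cfg)} (h : Saturated R) (β : Ordinal.{0}) :
    Saturated (closeUp R β) := by
  refine closeUp_induction R (fun _ S => Saturated S) h (fun _ _ h => h.closure)
    (fun _ _ h => h.transGen) ?_ β
  intro β _ ih x y hxy i j
  obtain ⟨γ, hγ⟩ := mem_iUnion.1 hxy
  exact mem_iUnion.2 ⟨γ, ih γ.1 γ.2 x y hγ i j⟩

/-- If a closed relation `G` assigns to each point at most one orbit and maps `E` into `F`, then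
it maps every close-up stage of `E` into that of `F`. -/
theorem exists_mem_closeUp_of_closed {G E F : Set (Cfg × Cfg)} (hG : IsClosed G)
    (hGu : ∀ y x x', (y, x) ∈ G → (y, x') ∈ G → ∃ k, x' = shiftZ k x) (hF : Saturated F)
    (hE : ∀ p ∈ E, ∃ q ∈ F, (p.1, q.1) ∈ G ∧ (p.2, q.2) ∈ G) (β : Ordinal.{0}) :
    ∀ p ∈ closeUp E β, ∃ q ∈ closeUp F β, (p.1, q.1) ∈ G ∧ (p.2, q.2) ∈ G := by
  refine closeUp_induction E (fun β S => ∀ p ∈ S, ∃ q ∈ closeUp F β,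
    (p.1, q.1) ∈ G ∧ (p.2, q.2) ∈ G) ?_ ?_ ?_ ?_ β
  · rwa [closeUp_zero]
  · intro β hβ ih
    rw [closeUp_add_one_even F hβ]
    set T : Set ((Cfg × Cfg) × (Cfg × Cfg)) :=
      {t | t.2 ∈ closure (closeUp F β) ∧ (t.1.1, t.2.1) ∈ G ∧ (t.1.2, t.2.2) ∈ G} with hT
    have hTc : IsClosed T :=
      (isClosed_closure.preimage continuous_snd).inter
        ((hG.preimage (by fun_prop : Continuous fun t : (Cfg × Cfg) × (Cfg × Cfg) =>
          (t.1.1, t.2.1))).inter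
        (hG.preimage (by fun_prop : Continuous fun t : (Cfg × Cfg) × (Cfg × Cfg) =>
          (t.1.2, t.2.2))))
    have hpc : IsClosed (Prod.fst '' T) := isClosedMap_fst_of_compactSpace _ hTc
    intro p hp
    have hsub : closeUp E β ⊆ Prod.fst '' T := fun p hp => by
      obtain ⟨q, hq, h1, h2⟩ := ih p hp
      exact ⟨(p, q), ⟨subset_closure hq, h1, h2⟩, rfl⟩
    obtain ⟨⟨_, q⟩, ⟨hq, h1, h2⟩, rfl⟩ := closure_minimal hsub hpc hp
    exact ⟨q, hq, h1, h2⟩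
  · intro β hβ ih p hp
    rw [closeUp_add_one_odd F hβ]
    have : ∀ z, Relation.TransGen (fun a b => (a, b) ∈ closeUp E β) p.1 z →
        ∃ q : Cfg × Cfg, Relation.TransGen (fun a b => (a, b) ∈ closeUp F β) q.1 q.2 ∧
          (p.1, q.1) ∈ G ∧ (z, q.2) ∈ G := by
      intro z hz
      induction hz with
      | single hb =>
        obtain ⟨q, hq, h1, h2⟩ := ih _ hb
        exact ⟨q, Relation.TransGen.single hq, h1, h2⟩
      | tail _ hb ih' =>
        obtain ⟨q, hq, h1, h2⟩ := ih'
        obtain ⟨r, hr, h3, h4⟩ := ih _ hb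
        obtain ⟨k, hk⟩ := hGu _ _ _ h3 h2
        refine ⟨(q.1, r.2), Relation.TransGen.tail hq ?_, h1, h4⟩
        rw [hk]
        have := hF.closeUp β _ _ (show (r.1, r.2) ∈ closeUp F β from hr) k 0
        rwa [shiftZ_zero] at this
    obtain ⟨q, hq, h1, h2⟩ := this _ hp
    exact ⟨q, hq, h1, h2⟩
  · intro β hβ ih p hp
    obtain ⟨γ, hγ⟩ := mem_iUnion.1 hp
    obtain ⟨q, hq, h1, h2⟩ := ih γ.1 γ.2 p hγ
    exact ⟨q, closeUp_mono F γ.2.le hq, h1, h2⟩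

theorem continuous_code {l : Fin 2 → ℤ} (hl : ∀ a, 1 ≤ l a) (c : ℤ) :
    Continuous fun x : Cfg => shiftZ c (code l x) :=
  (continuous_shiftZ c).comp (continuous_sub hl _)

theorem continuous_code_prod {l : Fin 2 → ℤ} (hl : ∀ a, 1 ≤ l a) (c c' : ℤ) :
    Continuous fun p : Cfg × Cfg => (shiftZ c (code l p.1), shiftZ c' (code l p.2)) :=
  ((continuous_code hl c).comp continuous_fst).prodMk
    ((continuous_code hl c').comp continuous_snd)

theorem code_mem_closeUp {l : Fin 2 → ℤ} (hl : ∀ a, 1 ≤ l a) {E F : Set (Cfg × Cfg)}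
    (hE : ∀ x y, (x, y) ∈ E → ∀ c c', (shiftZ c (code l x), shiftZ c' (code l y)) ∈ F)
    (β : Ordinal.{0}) : ∀ x y, (x, y) ∈ closeUp E β → ∀ c c',
      (shiftZ c (code l x), shiftZ c' (code l y)) ∈ closeUp F β := by
  refine closeUp_induction E (fun β S => ∀ x y, (x, y) ∈ S → ∀ c c',
    (shiftZ c (code l x), shiftZ c' (code l y)) ∈ closeUp F β) ?_ ?_ ?_ ?_ β
  · rwa [closeUp_zero]
  · intro β hβ ih x y hxy c c'
    rw [closeUp_add_one_even F hβ]
    have h : MapsTo (fun p : Cfg × Cfg => (shiftZ c (code l p.1), shiftZ c' (code l p.2)))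
        (closeUp E β) (closeUp F β) := fun p hp => ih p.1 p.2 hp c c'
    exact map_mem_closure (x := (x, y)) (f := fun p : Cfg × Cfg => (shiftZ c (code l p.1),
      shiftZ c' (code l p.2))) (continuous_code_prod hl c c') hxy h
  · intro β hβ ih x y hxy
    rw [closeUp_add_one_odd F hβ]
    change Relation.TransGen (fun a b => (a, b) ∈ closeUp E β) x y at hxy
    induction hxy with
    | single hb => exact fun c c' => Relation.TransGen.single (ih _ _ hb c c')
    | tail _ hb ih' => exact fun c c' => Relation.TransGen.tail (ih' c 0) (ih _ _ hb 0 c')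
  · intro β hβ ih x y hxy c c'
    obtain ⟨γ, hγ⟩ := mem_iUnion.1 hxy
    exact closeUp_mono F γ.2.le (ih γ.1 γ.2 x y hγ c c')

end Relations

/-- A subshift with a closed saturated relation made of independent pairs, equalizing at stage
`α`, whose earlier stages do not relate `0^∞` to points with two consecutive ones. -/
structure Good (D : Set Cfg) (R : Set (Cfg × Cfg)) (α : Ordinal.{0}) : Prop where
  isClosed : IsClosed D
  shift_mem : ∀ x ∈ D, ∀ c, shiftZ c x ∈ D
  isClosed_rel : IsClosed R
  rel_subset : R ⊆ D ×ˢ D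
  refl : ∀ x ∈ D, (x, x) ∈ R
  saturated : Saturated R
  zero_mem : (0 : Cfg) ∈ D
  one_mem : (1 : Cfg) ∈ D
  runs : ∀ K : ℤ, ∃ x ∈ D, x 0 = 1 ∧ ∀ i, 0 < i → i ≤ K → x i = 0
  rel_subset_closure : R ⊆ closure (unimodularPairs D)
  closeUp_eq : closeUp R α = D ×ˢ D
  separated : ∀ β, 1 ≤ β → β < α → ∀ x, (x, 0) ∈ closeUp R β → ¬ (x 0 = 1 ∧ x 1 = 1)

theorem sub_one_id (x : Cfg) : sub (fun _ => 1) (fun a _ => a) x = x := by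
  funext k
  have h := eq_pos_of_step (l := fun _ : Fin 2 => (1 : ℤ)) (x := x) (f := fun k => k)
    (fun k => rfl) k
  have h2 := sub_pos_add (l := fun _ => 1) (fun _ => le_rfl) (fun a _ => a) x (k := k) (i := 0)
    le_rfl one_pos
  rw [zero_add] at h
  rwa [← h, add_zero] at h2

theorem good_univ : Good univ univ 1 where
  isClosed := isClosed_univ
  shift_mem _ _ _ := mem_univ _
  isClosed_rel := isClosed_univ
  rel_subset _ _ := ⟨mem_univ _, mem_univ _⟩
  refl _ _ := mem_univ _
  saturated _ _ _ _ _ := mem_univ _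
  zero_mem := mem_univ _
  one_mem := mem_univ _
  runs K := ⟨fun i => if i = 0 then 1 else 0, mem_univ _, by simp, fun i h _ => by
    simp [h.ne']⟩
  rel_subset_closure := by
    rintro ⟨x, y⟩ -
    refine subset_closure ⟨fun _ => 1, fun a _ => a, ⟨fun _ => le_rfl, fun _ _ => mem_univ _⟩,
      Or.inl (by simp [ones, show Finset.Ico (0 : ℤ) 1 = {0} by rfl]), x, y, 0, 0, ?_, ?_⟩ <;>
    rw [shiftZ_zero, sub_one_id]
  closeUp_eq := by
    have h := closeUp_mono (univ : Set (Cfg × Cfg)) (zero_le (a := (1 : Ordinal.{0})))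
    rw [closeUp_zero] at h
    rw [univ_prod_univ]
    exact univ_subset_iff.1 h
  separated β h1 h2 := absurd h1 (not_le.2 h2)

section CodeSet

variable {l : Fin 2 → ℤ} {D : Set Cfg} {R : Set (Cfg × Cfg)}

/-- All shifts of codings of points of `D`. -/
def codeSet (l : Fin 2 → ℤ) (D : Set Cfg) : Set Cfg :=
  {y | ∃ x ∈ D, ∃ c, y = shiftZ c (code l x)}

/-- All pairs of shifts of codings of pairs in `R`. -/
def codeRel (l : Fin 2 → ℤ) (R : Set (Cfg × Cfg)) : Set (Cfg × Cfg) :=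
  {p | ∃ q ∈ R, ∃ c c', p.1 = shiftZ c (code l q.1) ∧ p.2 = shiftZ c' (code l q.2)}

theorem exists_bounded_shift_code (hl : ∀ a, 1 ≤ l a) (x : Cfg) (c : ℤ) :
    ∃ k i, 0 ≤ i ∧ i < l 0 + l 1 ∧
      shiftZ c (code l x) = shiftZ i (code l (shiftZ k x)) := by
  obtain ⟨k, i, rfl, h1, h2⟩ := exists_pos_add hl x c
  refine ⟨k, i, h1, ?_, ?_⟩
  · have h3 := hl 0
    have h4 := hl 1
    rcases fin_two_cases (x k) with h | h <;> rw [h] at h2 <;> omega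
  · rw [code_shiftZ hl, shiftZ_shiftZ, add_comm]

theorem isClosed_codeRel (hl : ∀ a, 1 ≤ l a) (hR : IsClosed R) (hs : Saturated R) :
    IsClosed (codeRel l R) := by
  have h : codeRel l R = ⋃ i ∈ Set.Ico 0 (l 0 + l 1), ⋃ j ∈ Set.Ico 0 (l 0 + l 1),
      (fun p : Cfg × Cfg => (shiftZ i (code l p.1), shiftZ j (code l p.2))) '' R := by
    ext p
    simp only [mem_iUnion]
    constructor
    · rintro ⟨⟨x, y⟩, hxy, c, c', h1, h2⟩
      obtain ⟨k, i, hi, hi', h3⟩ := exists_bounded_shift_code hl x c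
      obtain ⟨k', j, hj, hj', h4⟩ := exists_bounded_shift_code hl y c'
      exact ⟨i, ⟨hi, hi'⟩, j, ⟨hj, hj'⟩, (shiftZ k x, shiftZ k' y), hs _ _ hxy _ _,
        (Prod.ext (h1.trans h3) (h2.trans h4)).symm⟩
    · rintro ⟨i, _, j, _, q, hq, rfl⟩
      exact ⟨q, hq, i, j, rfl, rfl⟩
  rw [h]
  refine (Set.finite_Ico _ _).isClosed_biUnion fun i _ =>
    (Set.finite_Ico _ _).isClosed_biUnion fun j _ => ?_
  exact (hR.isCompact.image (continuous_code_prod hl i j)).isClosed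

theorem isClosed_codeSet (hl : ∀ a, 1 ≤ l a) (hD : IsClosed D)
    (hs : ∀ x ∈ D, ∀ c, shiftZ c x ∈ D) : IsClosed (codeSet l D) := by
  have h : codeSet l D = ⋃ i ∈ Set.Ico 0 (l 0 + l 1),
      (fun x : Cfg => shiftZ i (code l x)) '' D := by
    ext p
    simp only [mem_iUnion]
    constructor
    · rintro ⟨x, hx, c, h1⟩
      obtain ⟨k, i, hi, hi', h3⟩ := exists_bounded_shift_code hl x c
      exact ⟨i, ⟨hi, hi'⟩, shiftZ k x, hs _ hx _, (h1.trans h3).symm⟩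
    · rintro ⟨i, _, q, hq, rfl⟩
      exact ⟨q, hq, i, rfl⟩
  rw [h]
  exact (Set.finite_Ico _ _).isClosed_biUnion fun i _ =>
    (hD.isCompact.image (continuous_code hl i)).isClosed

theorem codeSet_shift_mem {y : Cfg} (hy : y ∈ codeSet l D) (c : ℤ) :
    shiftZ c y ∈ codeSet l D := by
  obtain ⟨x, hx, c', rfl⟩ := hy
  exact ⟨x, hx, c + c', by rw [shiftZ_shiftZ]⟩

/-- A compact part of the graph of decoding on `codeSet l D`. -/
def codeGraph (l : Fin 2 → ℤ) (D : Set Cfg) : Set (Cfg × Cfg) :=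
  {p | p.2 ∈ D ∧ ∃ c ∈ Set.Ico 0 (l 0 + l 1), p.1 = shiftZ c (code l p.2)}

theorem isClosed_codeGraph (hl : ∀ a, 1 ≤ l a) (hD : IsClosed D) : IsClosed (codeGraph l D) := by
  have h : codeGraph l D = {p | p.2 ∈ D} ∩ ⋃ c ∈ Set.Ico 0 (l 0 + l 1),
      {p | p.1 = shiftZ c (code l p.2)} := by
    ext p
    simp [codeGraph]
  rw [h]
  exact (hD.preimage continuous_snd).inter ((Set.finite_Ico _ _).isClosed_biUnion fun c _ =>
    isClosed_eq continuous_fst ((continuous_code hl c).comp continuous_snd))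

theorem exists_codeGraph (hl : ∀ a, 1 ≤ l a) (hs : ∀ x ∈ D, ∀ c, shiftZ c x ∈ D) {x : Cfg}
    (hx : x ∈ D) (c : ℤ) : ∃ k, (shiftZ c (code l x), shiftZ k x) ∈ codeGraph l D := by
  obtain ⟨k, i, hi, hi', h⟩ := exists_bounded_shift_code hl x c
  exact ⟨k, hs x hx k, i, ⟨hi, hi'⟩, h⟩

theorem codeGraph_unique (hl : ∀ a, 1 ≤ l a) (hne : l 0 ≠ l 1) {y x x' : Cfg}
    (h : (y, x) ∈ codeGraph l D) (h' : (y, x') ∈ codeGraph l D) : ∃ k, x' = shiftZ k x := by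
  obtain ⟨_, c, _, hc⟩ := h
  obtain ⟨_, c', _, hc'⟩ := h'
  exact exists_shift_of_code_eq_self hl hne (hc.symm.trans hc')

end CodeSet

section CodeUnion

variable {m : ℕ → Fin 2 → ℤ} {D : ℕ → Set Cfg} {R : ℕ → Set (Cfg × Cfg)} {o : ℕ → Ordinal.{0}}

/-- The subshift generated by a sequence of coded sets. -/
def codeUnion (m : ℕ → Fin 2 → ℤ) (D : ℕ → Set Cfg) : Set Cfg :=
  closure (⋃ n, codeSet (m n) (D n))

/-- The closed relation generated by a sequence of coded relations. -/
def codeUnionRel (m : ℕ → Fin 2 → ℤ) (R : ℕ → Set (Cfg × Cfg)) : Set (Cfg × Cfg) :=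
  closure (⋃ n, codeRel (m n) (R n))

theorem codeSet_subset_codeUnion (n : ℕ) : codeSet (m n) (D n) ⊆ codeUnion m D :=
  Set.Subset.trans (subset_iUnion (fun n => codeSet (m n) (D n)) n) subset_closure

theorem codeRel_subset_codeUnionRel (n : ℕ) : codeRel (m n) (R n) ⊆ codeUnionRel m R :=
  Set.Subset.trans (subset_iUnion (fun n => codeRel (m n) (R n)) n) subset_closure

theorem isClosed_codeUnion : IsClosed (codeUnion m D) := isClosed_closure

theorem isClosed_codeUnionRel : IsClosed (codeUnionRel m R) := isClosed_closure

theorem codeUnion_shift_mem : ∀ x ∈ codeUnion m D, ∀ c, shiftZ c x ∈ codeUnion m D := by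
  intro x hx c
  refine map_mem_closure (continuous_shiftZ c) hx fun y hy => ?_
  obtain ⟨n, hn⟩ := mem_iUnion.1 hy
  exact mem_iUnion.2 ⟨n, codeSet_shift_mem hn c⟩

theorem saturated_codeRel {l : Fin 2 → ℤ} {R : Set (Cfg × Cfg)} : Saturated (codeRel l R) := by
  rintro x y ⟨q, hq, c, c', h1, h2⟩ i j
  simp only at h1 h2
  exact ⟨q, hq, i + c, j + c', by simp only [h1, shiftZ_shiftZ],
    by simp only [h2, shiftZ_shiftZ]⟩

theorem saturated_codeUnionRel : Saturated (codeUnionRel m R) := by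
  refine Saturated.closure fun x y hxy i j => ?_
  obtain ⟨n, hn⟩ := mem_iUnion.1 hxy
  exact mem_iUnion.2 ⟨n, saturated_codeRel _ _ hn i j⟩

theorem codeRel_subset_prod (h : ∀ n, Good (D n) (R n) (o n))
    (n : ℕ) :
    codeRel (m n) (R n) ⊆ codeSet (m n) (D n) ×ˢ codeSet (m n) (D n) := by
  rintro p ⟨q, hq, c, c', h1, h2⟩
  have := (h n).rel_subset hq
  exact ⟨⟨q.1, this.1, c, h1⟩, ⟨q.2, this.2, c', h2⟩⟩

theorem codeUnionRel_subset_prod (h : ∀ n, Good (D n) (R n) (o n)) :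
    codeUnionRel m R ⊆ codeUnion m D ×ˢ codeUnion m D := by
  refine closure_minimal (iUnion_subset fun n => ?_) (isClosed_codeUnion.prod isClosed_codeUnion)
  exact (codeRel_subset_prod h n).trans
    (prod_mono (codeSet_subset_codeUnion n) (codeSet_subset_codeUnion n))

theorem codeUnionRel_refl (h : ∀ n, Good (D n) (R n) (o n)) :
    ∀ x ∈ codeUnion m D, (x, x) ∈ codeUnionRel m R := by
  intro x hx
  refine map_mem_closure (f := fun x : Cfg => (x, x)) (by fun_prop) hx fun y hy => ?_
  obtain ⟨n, x, hx, c, rfl⟩ := mem_iUnion.1 hy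
  exact mem_iUnion.2 ⟨n, (x, x), (h n).refl x hx, c, c, rfl, rfl⟩

theorem codeUnionRel_subset_closure (h : ∀ n, Good (D n) (R n) (o n))
    (hm : ∀ n a, 1 ≤ m n a) {S : Set (Cfg × Cfg)}
    (hS : ∀ n, ∀ p ∈ unimodularPairs (D n), ∀ c c',
      (shiftZ c (code (m n) p.1), shiftZ c' (code (m n) p.2)) ∈ S) :
    codeUnionRel m R ⊆ closure S := by
  refine closure_minimal (iUnion_subset fun n => ?_) isClosed_closure
  rintro p ⟨q, hq, c, c', h1, h2⟩
  have hmaps : MapsTo (fun p : Cfg × Cfg => (shiftZ c (code (m n) p.1),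
    shiftZ c' (code (m n) p.2))) (unimodularPairs (D n)) S := fun p hp => hS n p hp c c'
  rw [show p = (p.1, p.2) from rfl, h1, h2]
  exact map_mem_closure (f := fun p : Cfg × Cfg => (shiftZ c (code (m n) p.1),
    shiftZ c' (code (m n) p.2))) (continuous_code_prod (hm n) c c')
    ((h n).rel_subset_closure hq) hmaps

theorem code_mem_codeUnion {n : ℕ} {x : Cfg} (hx : x ∈ D n) (c : ℤ) :
    shiftZ c (code (m n) x) ∈ codeUnion m D :=
  codeSet_subset_codeUnion n ⟨x, hx, c, rfl⟩

theorem code_mem_closeUp_codeUnionRel (hm : ∀ n a, 1 ≤ m n a) {n : ℕ} {β : Ordinal.{0}}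
    {x y : Cfg} (hxy : (x, y) ∈ closeUp (R n) β) (c c' : ℤ) :
    (shiftZ c (code (m n) x), shiftZ c' (code (m n) y)) ∈ closeUp (codeUnionRel m R) β :=
  code_mem_closeUp (hm n) (fun x y hxy c c' =>
    codeRel_subset_codeUnionRel n ⟨(x, y), hxy, c, c', rfl, rfl⟩) β x y hxy c c'

variable {M : Set Cfg}

theorem isClosed_biUnion_codeSet_union (h : ∀ n, Good (D n) (R n) (o n))
    (hm : ∀ n a, 1 ≤ m n a) (hM : IsClosed M)
    (hsep : ∀ y ∉ M, ∃ n₀ : ℕ, ∀ᶠ z in 𝓝 y, ∀ n ≥ n₀, z ∉ codeSet (m n) (D n)) (S : Set ℕ) :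
    IsClosed ((⋃ n ∈ S, codeSet (m n) (D n)) ∪ M) := by
  refine isClosed_of_closure_subset fun y hy => ?_
  by_contra hc
  have hyM : y ∉ M := fun h => hc (Or.inr h)
  obtain ⟨n₀, hn₀⟩ := hsep y hyM
  have hcl : IsClosed (⋃ n ∈ S ∩ Set.Iio n₀, codeSet (m n) (D n)) :=
    ((Set.finite_Iio n₀).subset inter_subset_right).isClosed_biUnion fun n _ =>
      isClosed_codeSet (hm n) (h n).isClosed (h n).shift_mem
  have hy' : y ∉ ⋃ n ∈ S ∩ Set.Iio n₀, codeSet (m n) (D n) := fun hmem => hc (Or.inl (by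
    simp only [mem_iUnion] at hmem ⊢
    obtain ⟨n, hn, hz⟩ := hmem
    exact ⟨n, hn.1, hz⟩))
  have hev := (hM.isOpen_compl.mem_nhds hyM)
  have hev' := (hcl.isOpen_compl.mem_nhds hy')
  obtain ⟨z, ⟨⟨hz1, hz2⟩, hz3⟩, hz4⟩ := mem_closure_iff_nhds.1 hy _
    (Filter.inter_mem (Filter.inter_mem hn₀ hev) hev')
  rcases hz4 with hz4 | hz4
  · simp only [mem_iUnion] at hz4
    obtain ⟨n, hn, hz⟩ := hz4
    rcases lt_or_ge n n₀ with hlt | hge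
    · exact hz3 (by simp only [mem_iUnion]; exact ⟨n, ⟨hn, hlt⟩, hz⟩)
    · exact hz1 n hge hz
  · exact hz2 hz4

theorem codeUnion_subset (h : ∀ n, Good (D n) (R n) (o n))
    (hm : ∀ n a, 1 ≤ m n a) (hM : IsClosed M)
    (hsep : ∀ y ∉ M, ∃ n₀ : ℕ, ∀ᶠ z in 𝓝 y, ∀ n ≥ n₀, z ∉ codeSet (m n) (D n)) :
    codeUnion m D ⊆ (⋃ n, codeSet (m n) (D n)) ∪ M := by
  have := isClosed_biUnion_codeSet_union h hm hM hsep univ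
  simp only [mem_univ, iUnion_true] at this
  exact closure_minimal subset_union_left this

theorem codeUnionRel_subset (h : ∀ n, Good (D n) (R n) (o n))
    (hm : ∀ n a, 1 ≤ m n a)
    (hsep : ∀ y ∉ M, ∃ n₀ : ℕ, ∀ᶠ z in 𝓝 y, ∀ n ≥ n₀, z ∉ codeSet (m n) (D n)) :
    codeUnionRel m R ⊆ (⋃ n, codeRel (m n) (R n)) ∪ M ×ˢ M := by
  intro p hp
  by_contra hc
  have hev : ∃ n₀ : ℕ, ∀ᶠ q in 𝓝 p, ∀ n ≥ n₀, q ∉ codeRel (m n) (R n) := by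
    have hpM : p.1 ∉ M ∨ p.2 ∉ M := by
      by_contra! h'
      exact hc (Or.inr h')
    rcases hpM with h' | h'
    · obtain ⟨n₀, hn₀⟩ := hsep _ h'
      refine ⟨n₀, (continuous_fst.tendsto p).eventually hn₀ |>.mono fun q hq n hn hqn => ?_⟩
      exact hq n hn (codeRel_subset_prod h n hqn).1
    · obtain ⟨n₀, hn₀⟩ := hsep _ h'
      refine ⟨n₀, (continuous_snd.tendsto p).eventually hn₀ |>.mono fun q hq n hn hqn => ?_⟩
      exact hq n hn (codeRel_subset_prod h n hqn).2
  obtain ⟨n₀, hn₀⟩ := hev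
  have hcl : IsClosed (⋃ n ∈ Set.Iio n₀, codeRel (m n) (R n)) :=
    (Set.finite_Iio n₀).isClosed_biUnion fun n _ =>
      isClosed_codeRel (hm n) (h n).isClosed_rel (h n).saturated
  have hp' : p ∉ ⋃ n ∈ Set.Iio n₀, codeRel (m n) (R n) := fun hmem => hc (Or.inl (by
    simp only [mem_iUnion] at hmem ⊢
    obtain ⟨n, hn, hz⟩ := hmem
    exact ⟨n, hz⟩))
  obtain ⟨z, ⟨hz1, hz3⟩, hz4⟩ := mem_closure_iff_nhds.1 hp _
    (Filter.inter_mem hn₀ (hcl.isOpen_compl.mem_nhds hp'))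
  obtain ⟨n, hz⟩ := mem_iUnion.1 hz4
  rcases lt_or_ge n n₀ with hlt | hge
  · exact hz3 (by simp only [mem_iUnion]; exact ⟨n, hlt, hz⟩)
  · exact hz1 n hge hz

end CodeUnion

end CPE

namespace CPE

open Order

section CodeLemmas

variable {l : Fin 2 → ℤ} {D : Set Cfg}

theorem code_const_eq_one_iff (hl : ∀ a, 1 ≤ l a) (a : Fin 2) (i : ℤ) :
    code l (fun _ => a) i = 1 ↔ ∃ k, i = l a * k := by
  rw [code_eq_one_iff hl]
  simp only [pos_const]

theorem cfg_ext_one {x y : Cfg} (h : ∀ i, x i = 1 ↔ y i = 1) : x = y := by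
  funext i
  have := h i
  rcases fin_two_cases (x i) with h1 | h1 <;> rcases fin_two_cases (y i) with h2 | h2 <;>
    rw [h1, h2] at this ⊢ <;> exact absurd this (by decide)

theorem exists_le_gap_of_codeSet (hl : ∀ a, 1 ≤ l a) {z : Cfg} (hz : z ∈ codeSet l D) {i j : ℤ}
    (hij : i < j) (hi : z i = 1) (hj : z j = 1) : ∃ a, l a ≤ j - i := by
  obtain ⟨x, _, c, rfl⟩ := hz
  obtain ⟨k, hk⟩ := (code_eq_one_iff hl x _).1 hi
  obtain ⟨k', hk'⟩ := (code_eq_one_iff hl x _).1 hj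
  have h1 : k < k' := (pos_lt_iff hl x).1 (by omega)
  have h2 := (pos_le_iff hl x).2 (show k + 1 ≤ k' by omega)
  rw [pos_add_one] at h2
  exact ⟨x k, by omega⟩

theorem eq_const_of_forall {x : Cfg} {a : Fin 2} {k₀ : ℤ} (h : ∀ k, x (k + k₀) = a) :
    x = fun _ => a := by
  funext k
  have := h (k - k₀)
  rwa [sub_add_cancel] at this

end CodeLemmas

section Chain

/-- Block lengths of the `n`-th level of the chain. -/
def chainLen (n : ℕ) (a : Fin 2) : ℤ := if a = 0 then n + 2 else n + 1

theorem one_le_chainLen (n : ℕ) (a : Fin 2) : 1 ≤ chainLen n a := by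
  unfold chainLen; split_ifs <;> omega

@[simp] theorem chainLen_zero (n : ℕ) : chainLen n 0 = n + 2 := rfl

@[simp] theorem chainLen_one (n : ℕ) : chainLen n 1 = n + 1 := rfl

theorem chainLen_ge (n : ℕ) (a : Fin 2) : (n + 1 : ℤ) ≤ chainLen n a := by
  unfold chainLen; split_ifs <;> omega

theorem chainLen_le (n : ℕ) (a : Fin 2) : chainLen n a ≤ (n + 2 : ℤ) := by
  unfold chainLen; split_ifs <;> omega

theorem chainLen_ne (n : ℕ) : chainLen n 0 ≠ chainLen n 1 := by simp

/-- The configurations with at most one `1`. -/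
def sparse : Set Cfg := {y | ∀ i j, y i = 1 → y j = 1 → i = j}

theorem isClosed_sparse : IsClosed sparse := by
  refine isClosed_of_closure_subset fun y hy i j hi hj => ?_
  obtain ⟨z, hz, h⟩ := mem_closure_iff_agree.1 hy (max |i| |j|)
  have h1 := abs_le.1 (le_max_left |i| |j|)
  have h2 := abs_le.1 (le_max_right |i| |j|)
  exact hz i j ((h i h1.1 h1.2).symm.trans hi) ((h j h2.1 h2.2).symm.trans hj)

theorem zero_mem_sparse : (0 : Cfg) ∈ sparse := fun i _ h =>
  absurd h (by simp)

variable {D : ℕ → Set Cfg} {R : ℕ → Set (Cfg × Cfg)} {o : ℕ → Ordinal.{0}}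

theorem chain_eventually {y : Cfg} (hy : y ∉ sparse) :
    ∃ n₀ : ℕ, ∀ᶠ z in 𝓝 y, ∀ n ≥ n₀, z ∉ codeSet (chainLen n) (D n) := by
  have : ∃ i j, i < j ∧ y i = 1 ∧ y j = 1 := by
    by_contra! hc
    refine hy fun i j hi hj => ?_
    by_contra hne
    rcases lt_or_gt_of_ne hne with h | h
    · exact hc i j h hi hj
    · exact hc j i h hj hi
  obtain ⟨i, j, hij, hi, hj⟩ := this
  refine ⟨(j - i).toNat, (eventually_agree (max |i| |j|) y).mono fun z hz n hn hzn => ?_⟩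
  have h1 := abs_le.1 (le_max_left |i| |j|)
  have h2 := abs_le.1 (le_max_right |i| |j|)
  obtain ⟨a, ha⟩ := exists_le_gap_of_codeSet (one_le_chainLen n) hzn hij
    ((hz i h1.1 h1.2).symm.trans hi) ((hz j h2.1 h2.2).symm.trans hj)
  have := chainLen_ge n a
  omega

theorem not_mem_sparse_of_codeSet {l : Fin 2 → ℤ} (hl : ∀ a, 1 ≤ l a) {D : Set Cfg} {y : Cfg}
    (hy : y ∈ codeSet l D) : y ∉ sparse := by
  obtain ⟨x, _, c, rfl⟩ := hy
  intro hs
  have h0 : ∀ k, shiftZ c (code l x) (pos l x k - c) = 1 := fun k => by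
    rw [shiftZ, sub_add_cancel]; exact (code_eq_one_iff hl x _).2 ⟨k, rfl⟩
  have h1 := hs _ _ (h0 0) (h0 1)
  have h2 := (pos_inj hl x (j := 0) (k := 1)).1 (by omega)
  omega

theorem chain_code_eq {n n' : ℕ} (hn : n < n') {x x' : Cfg} {c c' : ℤ}
    (h : shiftZ c (code (chainLen n) x) = shiftZ c' (code (chainLen n') x')) :
    n' = n + 1 ∧ x = 0 ∧ x' = 1 := by
  obtain ⟨k₀, hk⟩ := exists_shift_of_code_eq (one_le_chainLen n) (one_le_chainLen n') h
  have hnn : n' = n + 1 := by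
    have h1 := hk 0
    have h2 := chainLen_le n (x (0 + k₀))
    have h3 := chainLen_ge n' (x' 0)
    omega
  subst hnn
  have key : ∀ k, x (k + k₀) = 0 ∧ x' k = 1 := fun k => by
    have h1 := hk k
    rcases fin_two_cases (x (k + k₀)) with a | a <;> rcases fin_two_cases (x' k) with b | b <;>
      rw [a, b] at h1 ⊢ <;> simp only [chainLen_zero, chainLen_one] at h1 <;>
      first | exact ⟨rfl, rfl⟩ | (exfalso; push_cast at h1; omega)
  exact ⟨rfl, eq_const_of_forall fun k => (key k).1, funext fun k => (key k).2⟩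

/-- The union of the levels below `n`. -/
def chainLower (D : ℕ → Set Cfg) (n : ℕ) : Set Cfg :=
  ⋃ k ∈ Set.Iio n, codeSet (chainLen k) (D k)

/-- The union of the levels above `n` with the sparse configurations. -/
def chainUpper (D : ℕ → Set Cfg) (n : ℕ) : Set Cfg :=
  (⋃ k ∈ Set.Ioi n, codeSet (chainLen k) (D k)) ∪ sparse

theorem mem_chainLower {n : ℕ} {y : Cfg} :
    y ∈ chainLower D n ↔ ∃ k < n, y ∈ codeSet (chainLen k) (D k) := by
  simp [chainLower]

theorem mem_chainUpper {n : ℕ} {y : Cfg} :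
    y ∈ chainUpper D n ↔ (∃ k > n, y ∈ codeSet (chainLen k) (D k)) ∨ y ∈ sparse := by
  simp [chainUpper]

theorem isClosed_chainLower (h : ∀ n, Good (D n) (R n) (o n)) (n : ℕ) :
    IsClosed (chainLower D n) :=
  (Set.finite_Iio n).isClosed_biUnion fun k _ =>
    isClosed_codeSet (one_le_chainLen k) (h k).isClosed (h k).shift_mem

theorem isClosed_chainUpper (h : ∀ n, Good (D n) (R n) (o n)) (n : ℕ) :
    IsClosed (chainUpper D n) :=
  isClosed_biUnion_codeSet_union h one_le_chainLen isClosed_sparse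
    (fun _ => chain_eventually) _

theorem disjoint_chainLower_chainUpper {n : ℕ} {y : Cfg} (h1 : y ∈ chainLower D n)
    (h2 : y ∈ chainUpper D n) : False := by
  obtain ⟨k, hk, hy⟩ := mem_chainLower.1 h1
  rcases mem_chainUpper.1 h2 with ⟨k', hk', x', _, c', rfl⟩ | h2
  · obtain ⟨x, _, c, h⟩ := hy
    have := (chain_code_eq (show k < k' by omega) h.symm).1
    omega
  · exact not_mem_sparse_of_codeSet (one_le_chainLen k) hy h2

/-- The graph collapsing the chain onto its `n`-th level. -/
def chainGraph (D : ℕ → Set Cfg) (n : ℕ) : Set (Cfg × Cfg) :=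
  codeGraph (chainLen n) (D n) ∪ (chainLower D n ×ˢ {1} ∪ chainUpper D n ×ˢ {0})

theorem isClosed_chainGraph (h : ∀ n, Good (D n) (R n) (o n)) (n : ℕ) :
    IsClosed (chainGraph D n) :=
  (isClosed_codeGraph (one_le_chainLen n) (h n).isClosed).union
    (((isClosed_chainLower h n).prod isClosed_singleton).union
      ((isClosed_chainUpper h n).prod isClosed_singleton))

theorem chainGraph_lower {n : ℕ} {y x : Cfg} (h : (y, x) ∈ chainGraph D n)
    (hy : y ∈ chainLower D n) : x = 1 := by
  rcases h with ⟨_, c, _, hc⟩ | ⟨_, h⟩ | ⟨h, _⟩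
  · obtain ⟨k, hk, x', _, c', hy⟩ := mem_chainLower.1 hy
    exact (chain_code_eq hk (hy.symm.trans hc)).2.2
  · exact h
  · exact (disjoint_chainLower_chainUpper hy h).elim

theorem chainGraph_upper {n : ℕ} {y x : Cfg} (h : (y, x) ∈ chainGraph D n)
    (hy : y ∈ chainUpper D n) : x = 0 := by
  rcases h with ⟨hx, c, _, hc⟩ | ⟨h, _⟩ | ⟨_, h⟩
  · rcases mem_chainUpper.1 hy with ⟨k, hk, x', _, c', hy⟩ | hy
    · exact (chain_code_eq hk (hc.symm.trans hy)).2.1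
    · exact (not_mem_sparse_of_codeSet (D := D n) (one_le_chainLen n) ⟨x, hx, c, hc⟩ hy).elim
  · exact (disjoint_chainLower_chainUpper h hy).elim
  · exact h

theorem chainGraph_unique {n : ℕ} (y x x' : Cfg) (h : (y, x) ∈ chainGraph D n)
    (h' : (y, x') ∈ chainGraph D n) : ∃ k, x' = shiftZ k x := by
  rcases h with h | ⟨h, h1⟩ | ⟨h, h1⟩
  · rcases h' with h' | ⟨h', h2⟩ | ⟨h', h2⟩
    · exact codeGraph_unique (one_le_chainLen n) (chainLen_ne n) h h'
    · rw [chainGraph_lower (Or.inl h) h']; exact ⟨0, h2⟩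
    · rw [chainGraph_upper (Or.inl h) h']; exact ⟨0, h2⟩
  · rw [chainGraph_lower h' h, show x = 1 from h1]; exact ⟨0, rfl⟩
  · rw [chainGraph_upper h' h, show x = 0 from h1]; exact ⟨0, rfl⟩

theorem chain_collapse (h : ∀ n, Good (D n) (R n) (o n)) (n : ℕ) (β : Ordinal.{0}) :
    ∀ p ∈ closeUp (codeUnionRel chainLen R) β, ∃ q ∈ closeUp (R n) β,
      (p.1, q.1) ∈ chainGraph D n ∧ (p.2, q.2) ∈ chainGraph D n := by
  refine exists_mem_closeUp_of_closed (isClosed_chainGraph h n) chainGraph_unique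
    (h n).saturated (fun p hp => ?_) β
  rcases codeUnionRel_subset h one_le_chainLen (fun _ => chain_eventually) hp with hp | hp
  · obtain ⟨k, hk⟩ := mem_iUnion.1 hp
    obtain ⟨h1, h2⟩ := codeRel_subset_prod h k hk
    rcases lt_trichotomy k n with hkn | rfl | hkn
    · exact ⟨(1, 1), (h n).refl _ (h n).one_mem,
        Or.inr (Or.inl ⟨mem_chainLower.2 ⟨k, hkn, h1⟩, rfl⟩),
        Or.inr (Or.inl ⟨mem_chainLower.2 ⟨k, hkn, h2⟩, rfl⟩)⟩
    · obtain ⟨⟨x, y⟩, hq, c, c', h3, h4⟩ := hk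
      obtain ⟨hx, hy⟩ := (h k).rel_subset hq
      obtain ⟨i, hi⟩ := exists_codeGraph (one_le_chainLen k) (h k).shift_mem hx c
      obtain ⟨j, hj⟩ := exists_codeGraph (one_le_chainLen k) (h k).shift_mem hy c'
      exact ⟨(shiftZ i x, shiftZ j y), (h k).saturated _ _ hq i j,
        Or.inl (by rw [h3]; exact hi), Or.inl (by rw [h4]; exact hj)⟩
    · exact ⟨(0, 0), (h n).refl _ (h n).zero_mem,
        Or.inr (Or.inr ⟨mem_chainUpper.2 (Or.inl ⟨k, hkn, h1⟩), rfl⟩),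
        Or.inr (Or.inr ⟨mem_chainUpper.2 (Or.inl ⟨k, hkn, h2⟩), rfl⟩)⟩
  · exact ⟨(0, 0), (h n).refl _ (h n).zero_mem,
      Or.inr (Or.inr ⟨mem_chainUpper.2 (Or.inr hp.1), rfl⟩),
      Or.inr (Or.inr ⟨mem_chainUpper.2 (Or.inr hp.2), rfl⟩)⟩

theorem chain_sparse_of_mem_closure (h : ∀ n, Good (D n) (R n) (o n)) {β : Ordinal.{0}}
    (hβ : 1 ≤ β) (ho : ∀ J : ℕ, ∃ n ≥ J, β < o n) {p : Cfg × Cfg}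
    (hp : p ∈ closure (closeUp (codeUnionRel chainLen R) β)) (hp2 : p.2 ∈ sparse) :
    p.1 ∈ sparse := by
  by_contra hp1
  obtain ⟨n₀, hn₀⟩ := chain_eventually (D := D) hp1
  obtain ⟨n, hn, hon⟩ := ho n₀
  have hcl : IsClosed {q : Cfg × Cfg | q.2 ∈ chainLower D (n + 1)} :=
    (isClosed_chainLower h (n + 1)).preimage continuous_snd
  have hev : ∀ᶠ q in 𝓝 p, q ∈ closeUp (codeUnionRel chainLen R) β →
      q.2 ∈ chainLower D (n + 1) := by
    have e1 := (continuous_fst.tendsto p).eventually hn₀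
    have e2 := (continuous_fst.tendsto p).eventually
      (isClosed_sparse.isOpen_compl.eventually_mem hp1)
    filter_upwards [e1, e2] with q h1 h2 hq
    have hX := closeUp_subset_prod isClosed_codeUnion (codeUnionRel_subset_prod h) β hq
    have hsub := codeUnion_subset h one_le_chainLen isClosed_sparse (fun _ => chain_eventually)
    have hq1 : q.1 ∈ chainLower D n := by
      rcases hsub hX.1 with h3 | h3
      · obtain ⟨k, hk⟩ := mem_iUnion.1 h3
        refine mem_chainLower.2 ⟨k, ?_, hk⟩
        by_contra! hc
        exact h1 k (hn.le.trans hc) hk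
      · exact (h2 h3).elim
    have hq2 : q.2 ∉ chainUpper D n := fun hU => by
      obtain ⟨r, hr, h3, h4⟩ := chain_collapse h n β q hq
      have h5 := chainGraph_lower h3 hq1
      have h6 := chainGraph_upper h4 hU
      refine (h n).separated β hβ hon r.1 ?_ ?_
      · rw [← h6]; exact hr
      · rw [h5]; exact ⟨rfl, rfl⟩
    rcases hsub hX.2 with h3 | h3
    · obtain ⟨k, hk⟩ := mem_iUnion.1 h3
      refine mem_chainLower.2 ⟨k, ?_, hk⟩
      by_contra! hc
      exact hq2 (mem_chainUpper.2 (Or.inl ⟨k, by omega, hk⟩))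
    · exact (hq2 (mem_chainUpper.2 (Or.inr h3))).elim
  have hmem : p ∈ closure {q : Cfg × Cfg | q.2 ∈ chainLower D (n + 1)} := by
    rw [mem_closure_iff_nhds]
    intro U hU
    obtain ⟨q, ⟨hqU, hq⟩, hq'⟩ := mem_closure_iff_nhds.1 hp _ (Filter.inter_mem hU hev)
    exact ⟨q, hqU, hq hq'⟩
  rw [hcl.closure_eq] at hmem
  obtain ⟨k, _, hk⟩ := mem_chainLower.1 hmem
  exact not_mem_sparse_of_codeSet (one_le_chainLen k) hk hp2

theorem chain_sparse_odd (h : ∀ n, Good (D n) (R n) (o n)) {ω : Ordinal.{0}} (hω : ω % 2 = 1)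
    (ho : ∀ n, o n = ω) {p : Cfg × Cfg} (hp : p ∈ closeUp (codeUnionRel chainLen R) (ω + 1))
    (hp2 : p.2 ∈ sparse) : p.1 ∈ sparse := by
  have hbase : ∀ q ∈ closeUp (codeUnionRel chainLen R) ω, q.2 ∈ sparse → q.1 ∈ sparse := by
    intro q hq hq2
    rcases ordinal_cases ω with rfl | ⟨γ, rfl⟩ | hl
    · simp at hω
    · rcases ordinal_mod_two γ with hγ | hγ
      · rw [closeUp_add_one_even _ hγ] at hq
        rcases eq_or_ne γ 0 with rfl | hγ0
        · rw [closeUp_zero, isClosed_codeUnionRel.closure_eq] at hq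
          rcases codeUnionRel_subset h one_le_chainLen (fun _ => chain_eventually) hq
            with hq | hq
          · obtain ⟨k, hk⟩ := mem_iUnion.1 hq
            exact (not_mem_sparse_of_codeSet (one_le_chainLen k)
              (codeRel_subset_prod h k hk).2 hq2).elim
          · exact hq.1
        · refine chain_sparse_of_mem_closure h (one_le_iff_ne_zero.2 hγ0)
            (fun J => ⟨J, le_rfl, ?_⟩) hq hq2
          rw [ho]
          exact Order.lt_add_one_iff.2 le_rfl
      · rw [ordinal_odd_add_one hγ] at hω; exact absurd hω zero_ne_one
    · rw [ordinal_limit_even hl] at hω; exact absurd hω zero_ne_one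
  rw [closeUp_add_one_odd _ hω] at hp
  have : ∀ z, Relation.TransGen (fun a b => (a, b) ∈ closeUp (codeUnionRel chainLen R) ω) p.1 z →
      z ∈ sparse → p.1 ∈ sparse := by
    intro z hz
    induction hz with
    | single hb => exact hbase _ hb
    | tail _ hb ih => exact fun hz => ih (hbase _ hb hz)
  exact this _ hp hp2

theorem chain_sparse_limit (h : ∀ n, Good (D n) (R n) (o n)) {ω : Ordinal.{0}}
    (hω : IsSuccLimit ω) (ho : ∀ β < ω, ∀ J : ℕ, ∃ n ≥ J, β < o n) {p : Cfg × Cfg}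
    (hp : p ∈ closeUp (codeUnionRel chainLen R) ω) (hp2 : p.2 ∈ sparse) : p.1 ∈ sparse := by
  rw [closeUp_limit _ hω] at hp
  obtain ⟨⟨β, hβ⟩, hp⟩ := mem_iUnion.1 hp
  have h1 : (1 : Ordinal.{0}) < ω := by
    have := hω.succ_lt (a := 0) (by simpa [pos_iff_ne_zero] using hω.ne_bot)
    simpa [Order.succ_eq_add_one] using this
  exact chain_sparse_of_mem_closure h (le_max_right β 1) (ho _ (max_lt hβ h1))
    (subset_closure (closeUp_mono _ (le_max_left β 1) hp)) hp2

theorem chain_junction (n : ℕ) :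
    code (chainLen n) (fun _ => 0) = code (chainLen (n + 1)) (fun _ => 1) := by
  refine cfg_ext_one fun i => ?_
  rw [code_const_eq_one_iff (one_le_chainLen _), code_const_eq_one_iff (one_le_chainLen _)]
  simp only [chainLen_zero, chainLen_one]
  push_cast
  simp only [show (n : ℤ) + 1 + 1 = n + 2 by ring]

theorem not_exists_eq_mul {g i : ℤ} (h0 : 0 < i) (h1 : i < g) : ¬ ∃ k, i = g * k := by
  rintro ⟨k, rfl⟩
  have hk : 0 < k := by
    by_contra! hc
    nlinarith
  nlinarith

theorem eq_zero_of_ne_one {a : Fin 2} (h : a ≠ 1) : a = 0 := by omega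

theorem zero_mem_codeUnion_chain (h : ∀ n, Good (D n) (R n) (o n)) :
    (0 : Cfg) ∈ codeUnion chainLen D := by
  refine mem_closure_iff_agree.2 fun N => ?_
  refine ⟨shiftZ (N + 1) (code (chainLen (2 * N).toNat) (fun _ => 0)),
    mem_iUnion.2 ⟨_, 0, (h _).zero_mem, _, rfl⟩, fun i h1 h2 => ?_⟩
  refine (eq_zero_of_ne_one fun hc => ?_).symm
  rw [shiftZ, code_const_eq_one_iff (one_le_chainLen _)] at hc
  refine not_exists_eq_mul ?_ ?_ hc
  · omega
  · rw [chainLen_zero]; omega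

theorem good_chain (h : ∀ n, Good (D n) (R n) (o n)) {δ : Ordinal.{0}} (hδ : δ % 2 = 0)
    (hδ0 : δ ≠ 0) (ho : ∀ n, o n ≤ δ)
    (hs : ∀ p ∈ closeUp (codeUnionRel chainLen R) δ, p.2 ∈ sparse → p.1 ∈ sparse) :
    Good (codeUnion chainLen D) (codeUnionRel chainLen R) (δ + 1) where
  isClosed := isClosed_codeUnion
  shift_mem := codeUnion_shift_mem
  isClosed_rel := isClosed_codeUnionRel
  rel_subset := codeUnionRel_subset_prod h
  refl := codeUnionRel_refl h
  saturated := saturated_codeUnionRel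
  zero_mem := zero_mem_codeUnion_chain h
  one_mem := by
    have h1 : (1 : Cfg) = shiftZ 0 (code (chainLen 0) (fun _ => 1)) := by
      rw [shiftZ_zero]
      refine cfg_ext_one fun i => ?_
      rw [code_const_eq_one_iff (one_le_chainLen _)]
      simp
    rw [h1]
    exact code_mem_codeUnion (h 0).one_mem 0
  runs K := by
    refine ⟨shiftZ 0 (code (chainLen K.toNat) (fun _ => 1)),
      code_mem_codeUnion (h _).one_mem 0, ?_, fun i h1 h2 => eq_zero_of_ne_one fun hc => ?_⟩
    · rw [shiftZ_zero]
      exact (code_const_eq_one_iff (one_le_chainLen _) _ _).2 ⟨0, by simp⟩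
    · rw [shiftZ_zero, code_const_eq_one_iff (one_le_chainLen _)] at hc
      refine not_exists_eq_mul h1 ?_ hc
      rw [chainLen_one]; omega
  rel_subset_closure := codeUnionRel_subset_closure h one_le_chainLen fun n p hp c c' =>
    code_mem_unimodularPairs (one_le_chainLen n) (by simp)
      (fun x hx c => code_mem_codeUnion hx c) hp c c'
  closeUp_eq := by
    refine Subset.antisymm (closeUp_subset_prod isClosed_codeUnion
      (codeUnionRel_subset_prod h) _) ?_
    rw [closeUp_add_one_even _ hδ]
    set P : Cfg → Cfg → Prop := fun a b => (a, b) ∈ closeUp (codeUnionRel chainLen R) δ with hP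
    have htr : ∀ {a b c}, P a b → P b c → P a c := fun h1 h2 =>
      closeUp_trans_of_even _ hδ hδ0 h1 h2
    have hlev : ∀ n, ∀ x ∈ D n, ∀ y ∈ D n, ∀ c c',
        P (shiftZ c (code (chainLen n) x)) (shiftZ c' (code (chainLen n) y)) := by
      intro n x hx y hy c c'
      refine closeUp_mono _ (ho n) (code_mem_closeUp_codeUnionRel one_le_chainLen ?_ c c')
      rw [(h n).closeUp_eq]
      exact ⟨hx, hy⟩
    set J : ℕ → Cfg := fun n => shiftZ 0 (code (chainLen n) (fun _ => 0)) with hJ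
    have hJs : ∀ n, J n = shiftZ 0 (code (chainLen (n + 1)) (fun _ => 1)) := fun n => by
      rw [hJ, ← chain_junction]
    have hJ0 : ∀ n, P (J 0) (J n) ∧ P (J n) (J 0) := by
      intro n
      induction n with
      | zero =>
        exact ⟨hlev 0 _ (h 0).zero_mem _ (h 0).zero_mem 0 0,
          hlev 0 _ (h 0).zero_mem _ (h 0).zero_mem 0 0⟩
      | succ n ih =>
        have h1 : P (J n) (J (n + 1)) := by
          rw [hJs n]; exact hlev (n + 1) _ (h _).one_mem _ (h _).zero_mem 0 0
        have h2 : P (J (n + 1)) (J n) := by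
          rw [hJs n]; exact hlev (n + 1) _ (h _).zero_mem _ (h _).one_mem 0 0
        exact ⟨htr ih.1 h1, htr h2 ih.2⟩
    have hsub : (⋃ n, codeSet (chainLen n) (D n)) ×ˢ (⋃ n, codeSet (chainLen n) (D n)) ⊆
        closeUp (codeUnionRel chainLen R) δ := by
      rintro ⟨y, y'⟩ ⟨hy, hy'⟩
      obtain ⟨n, x, hx, c, h1⟩ := mem_iUnion.1 hy
      obtain ⟨n', x', hx', c', h2⟩ := mem_iUnion.1 hy'
      simp only at h1 h2
      subst h1 h2
      exact htr (hlev n x hx _ (h n).zero_mem c 0) (htr (hJ0 n).2 (htr (hJ0 n').1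
        (hlev n' _ (h n').zero_mem x' hx' 0 c')))
    have := closure_mono hsub
    rwa [closure_prod_eq] at this
  separated β _ hβ2 x hx hx' := by
    have h1 := hs _ (closeUp_mono _ (Order.lt_add_one_iff.1 hβ2) hx) zero_mem_sparse
    have := h1 0 1 hx'.1 hx'.2
    omega

end Chain

end CPE

namespace CPE

open Order

section Bouquet

/-- Block lengths of the `n`-th petal of the bouquet. -/
def bouqLen (n : ℕ) (a : Fin 2) : ℤ := if a = 0 then 1 else n + 2

theorem one_le_bouqLen (n : ℕ) (a : Fin 2) : 1 ≤ bouqLen n a := by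
  unfold bouqLen; split_ifs <;> omega

@[simp] theorem bouqLen_zero (n : ℕ) : bouqLen n 0 = 1 := rfl

@[simp] theorem bouqLen_one (n : ℕ) : bouqLen n 1 = n + 2 := rfl

theorem bouqLen_ne (n : ℕ) : bouqLen n 0 ≠ bouqLen n 1 := by simp; omega

/-- The configurations in which the ones form an interval. -/
def intervals : Set Cfg := {y | ∀ i l j, i < l → l < j → y i = 1 → y j = 1 → y l = 1}

theorem isClosed_intervals : IsClosed intervals := by
  refine isClosed_of_closure_subset fun y hy i l j hil hlj hi hj => ?_
  obtain ⟨z, hz, h⟩ := mem_closure_iff_agree.1 hy (max |i| |j|)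
  have h1 := abs_le.1 (le_max_left |i| |j|)
  have h2 := abs_le.1 (le_max_right |i| |j|)
  rw [h l (by omega) (by omega)]
  exact hz i l j hil hlj ((h i h1.1 h1.2).symm.trans hi) ((h j h2.1 h2.2).symm.trans hj)

theorem one_mem_intervals : (1 : Cfg) ∈ intervals := fun _ _ _ _ _ _ _ => rfl

/-- An interior zero of a coded configuration lies in a long block. -/
theorem bouq_gap {n : ℕ} {x : Cfg} {i l j : ℤ} (hil : i < l) (hlj : l < j)
    (hi : code (bouqLen n) x i = 1) (hl : code (bouqLen n) x l = 0)
    (hj : code (bouqLen n) x j = 1) : (n + 2 : ℤ) ≤ j - i := by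
  obtain ⟨k, hk⟩ := (code_eq_one_iff (one_le_bouqLen n) x _).1 hi
  obtain ⟨k', hk'⟩ := (code_eq_one_iff (one_le_bouqLen n) x _).1 hj
  obtain ⟨s, t, hst, ht, ht'⟩ := exists_pos_add (one_le_bouqLen n) x l
  have ht0 : t ≠ 0 := by
    rintro rfl
    have := (code_eq_one_iff (one_le_bouqLen n) x l).2 ⟨s, by omega⟩
    rw [hl] at this
    exact absurd this (by decide)
  have hs := pos_add_one (bouqLen n) x s
  have h1 : k < s + 1 := (pos_lt_iff (one_le_bouqLen n) x).1 (by omega)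
  have h2 : s < k' := (pos_lt_iff (one_le_bouqLen n) x).1 (by omega)
  have h3 := (pos_le_iff (one_le_bouqLen n) x).2 (show k ≤ s by omega)
  have h4 := (pos_le_iff (one_le_bouqLen n) x).2 (show s + 1 ≤ k' by omega)
  rcases fin_two_cases (x s) with hx | hx <;> rw [hx] at hs ht' <;>
    simp only [bouqLen_zero, bouqLen_one] at hs ht' <;> omega

theorem bouq_gap_of_codeSet {n : ℕ} {D : Set Cfg} {z : Cfg} (hz : z ∈ codeSet (bouqLen n) D)
    {i l j : ℤ} (hil : i < l) (hlj : l < j) (hi : z i = 1) (hl : z l = 0) (hj : z j = 1) :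
    (n + 2 : ℤ) ≤ j - i := by
  obtain ⟨x, _, c, rfl⟩ := hz
  have := bouq_gap (i := i + c) (l := l + c) (j := j + c) (by omega) (by omega) hi hl hj
  omega

theorem bouq_code_eq {n n' : ℕ} (hn : n ≠ n') {x x' : Cfg} {c c' : ℤ}
    (h : shiftZ c (code (bouqLen n) x) = shiftZ c' (code (bouqLen n') x')) : x = 0 := by
  obtain ⟨k₀, hk⟩ := exists_shift_of_code_eq (one_le_bouqLen n) (one_le_bouqLen n') h
  refine eq_const_of_forall (k₀ := k₀) fun k => ?_
  have h1 := hk k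
  rcases fin_two_cases (x (k + k₀)) with a | a <;> rcases fin_two_cases (x' k) with b | b <;>
    rw [a, b] at h1 <;> simp only [bouqLen_zero, bouqLen_one] at h1 <;>
    first | exact a | (exfalso; omega)

theorem bouq_code_interval {n : ℕ} {x : Cfg} {c : ℤ}
    (h : shiftZ c (code (bouqLen n) x) ∈ intervals) : x = 0 := by
  funext k
  refine eq_zero_of_ne_one fun hk => ?_
  have hp := pos_add_one (bouqLen n) x k
  rw [hk, bouqLen_one] at hp
  have h0 : ∀ k, shiftZ c (code (bouqLen n) x) (pos (bouqLen n) x k - c) = 1 := fun k => by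
    rw [shiftZ, sub_add_cancel]; exact (code_eq_one_iff (one_le_bouqLen n) x _).2 ⟨k, rfl⟩
  have h1 := h _ (pos (bouqLen n) x k - c + 1) _ (by omega) (by omega) (h0 k) (h0 (k + 1))
  rw [shiftZ, code_eq_one_iff (one_le_bouqLen n)] at h1
  obtain ⟨s, hs⟩ := h1
  have h2 : k < s := (pos_lt_iff (one_le_bouqLen n) x).1 (by omega)
  have h3 : s < k + 1 := (pos_lt_iff (one_le_bouqLen n) x).1 (by omega)
  omega

theorem bouq_hub (n : ℕ) (c : ℤ) : shiftZ c (code (bouqLen n) 0) = 1 := by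
  refine cfg_ext_one fun i => ?_
  rw [shiftZ, show (0 : Cfg) = fun _ => 0 from rfl, code_const_eq_one_iff (one_le_bouqLen _)]
  simp

theorem cfg_one_ne_zero : (1 : Cfg) ≠ 0 := fun h => absurd (congrFun h 0) (by decide)

variable {D : ℕ → Set Cfg} {R : ℕ → Set (Cfg × Cfg)} {o : ℕ → Ordinal.{0}}

theorem bouq_eventually {y : Cfg} (hy : y ∉ intervals) :
    ∃ n₀ : ℕ, ∀ᶠ z in 𝓝 y, ∀ n ≥ n₀, z ∉ codeSet (bouqLen n) (D n) := by
  have : ∃ i l j, i < l ∧ l < j ∧ y i = 1 ∧ y j = 1 ∧ y l = 0 := by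
    by_contra! hc
    exact hy fun i l j hil hlj hi hj => (fin_two_cases _).resolve_left (hc i l j hil hlj hi hj)
  obtain ⟨i, l, j, hil, hlj, hi, hj, hl⟩ := this
  refine ⟨(j - i).toNat, (eventually_agree (max |i| |j|) y).mono fun z hz n hn hzn => ?_⟩
  have h1 := abs_le.1 (le_max_left |i| |j|)
  have h2 := abs_le.1 (le_max_right |i| |j|)
  have := bouq_gap_of_codeSet hzn hil hlj ((hz i h1.1 h1.2).symm.trans hi)
    ((hz l (by omega) (by omega)).symm.trans hl) ((hz j h2.1 h2.2).symm.trans hj)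
  omega

/-- The union of the petals other than the `n`-th one with the interval configurations. -/
def bouqRest (D : ℕ → Set Cfg) (n : ℕ) : Set Cfg :=
  (⋃ k ∈ {k | k ≠ n}, codeSet (bouqLen k) (D k)) ∪ intervals

theorem mem_bouqRest {n : ℕ} {y : Cfg} :
    y ∈ bouqRest D n ↔ (∃ k ≠ n, y ∈ codeSet (bouqLen k) (D k)) ∨ y ∈ intervals := by
  simp [bouqRest]

theorem isClosed_bouqRest (h : ∀ n, Good (D n) (R n) (o n)) (n : ℕ) :
    IsClosed (bouqRest D n) :=
  isClosed_biUnion_codeSet_union h one_le_bouqLen isClosed_intervals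
    (fun _ => bouq_eventually) _

/-- The graph collapsing the bouquet onto its `n`-th petal. -/
def bouqGraph (D : ℕ → Set Cfg) (n : ℕ) : Set (Cfg × Cfg) :=
  codeGraph (bouqLen n) (D n) ∪ bouqRest D n ×ˢ {0}

theorem isClosed_bouqGraph (h : ∀ n, Good (D n) (R n) (o n)) (n : ℕ) :
    IsClosed (bouqGraph D n) :=
  (isClosed_codeGraph (one_le_bouqLen n) (h n).isClosed).union
    ((isClosed_bouqRest h n).prod isClosed_singleton)

theorem bouqGraph_rest {n : ℕ} {y x : Cfg} (h : (y, x) ∈ bouqGraph D n)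
    (hy : y ∈ bouqRest D n) : x = 0 := by
  rcases h with ⟨hx, c, _, hc⟩ | ⟨_, h⟩
  · simp only at hc
    rcases mem_bouqRest.1 hy with ⟨k, hk, x', _, c', hy⟩ | hy
    · exact bouq_code_eq hk.symm (hc.symm.trans hy)
    · exact bouq_code_interval (hc ▸ hy)
  · exact h

theorem bouqGraph_unique {n : ℕ} (y x x' : Cfg) (h : (y, x) ∈ bouqGraph D n)
    (h' : (y, x') ∈ bouqGraph D n) : ∃ k, x' = shiftZ k x := by
  rcases h with h | ⟨h, h1⟩
  · rcases h' with h' | ⟨h', h2⟩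
    · exact codeGraph_unique (one_le_bouqLen n) (bouqLen_ne n) h h'
    · rw [bouqGraph_rest (Or.inl h) h']; exact ⟨0, h2⟩
  · rw [bouqGraph_rest h' h, show x = 0 from h1]; exact ⟨0, rfl⟩

theorem bouq_collapse (h : ∀ n, Good (D n) (R n) (o n)) (n : ℕ) (β : Ordinal.{0}) :
    ∀ p ∈ closeUp (codeUnionRel bouqLen R) β, ∃ q ∈ closeUp (R n) β,
      (p.1, q.1) ∈ bouqGraph D n ∧ (p.2, q.2) ∈ bouqGraph D n := by
  refine exists_mem_closeUp_of_closed (isClosed_bouqGraph h n) bouqGraph_unique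
    (h n).saturated (fun p hp => ?_) β
  rcases codeUnionRel_subset h one_le_bouqLen (fun _ => bouq_eventually) hp with hp | hp
  · obtain ⟨k, hk⟩ := mem_iUnion.1 hp
    obtain ⟨h1, h2⟩ := codeRel_subset_prod h k hk
    rcases eq_or_ne k n with rfl | hkn
    · obtain ⟨⟨x, y⟩, hq, c, c', h3, h4⟩ := hk
      obtain ⟨hx, hy⟩ := (h k).rel_subset hq
      obtain ⟨i, hi⟩ := exists_codeGraph (one_le_bouqLen k) (h k).shift_mem hx c
      obtain ⟨j, hj⟩ := exists_codeGraph (one_le_bouqLen k) (h k).shift_mem hy c'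
      exact ⟨(shiftZ i x, shiftZ j y), (h k).saturated _ _ hq i j,
        Or.inl (by rw [h3]; exact hi), Or.inl (by rw [h4]; exact hj)⟩
    · exact ⟨(0, 0), (h n).refl _ (h n).zero_mem,
        Or.inr ⟨mem_bouqRest.2 (Or.inl ⟨k, hkn, h1⟩), rfl⟩,
        Or.inr ⟨mem_bouqRest.2 (Or.inl ⟨k, hkn, h2⟩), rfl⟩⟩
  · exact ⟨(0, 0), (h n).refl _ (h n).zero_mem,
      Or.inr ⟨mem_bouqRest.2 (Or.inr hp.1), rfl⟩,
      Or.inr ⟨mem_bouqRest.2 (Or.inr hp.2), rfl⟩⟩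

theorem bouq_not_rel_rest (h : ∀ n, Good (D n) (R n) (o n)) {n : ℕ} {β : Ordinal.{0}}
    (hβ : 1 ≤ β) (hβn : β < o n) {x y' : Cfg} {c : ℤ} (hx : x ∈ D n) {k : ℤ} (hk : x k = 1)
    (hk' : x (k + 1) = 1) (hy' : y' ∈ bouqRest D n)
    (hp : (shiftZ c (code (bouqLen n) x), y') ∈ closeUp (codeUnionRel bouqLen R) β) : False := by
  obtain ⟨q, hq, h1, h2⟩ := bouq_collapse h n β _ hp
  obtain ⟨s, hs⟩ := exists_codeGraph (one_le_bouqLen n) (h n).shift_mem hx c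
  obtain ⟨r, hr⟩ := bouqGraph_unique _ _ _ h1 (Or.inl hs)
  have h3 := (h n).saturated.closeUp β q.1 q.2 hq (k - s + r) 0
  rw [bouqGraph_rest h2 hy', ← shiftZ_shiftZ, ← hr, shiftZ_shiftZ, sub_add_cancel] at h3
  refine (h n).separated β hβ hβn _ h3 ⟨?_, ?_⟩
  · simpa [shiftZ] using hk
  · simpa [shiftZ, add_comm] using hk'

theorem bouq_not_mem_closure (h : ∀ n, Good (D n) (R n) (o n)) {γ : Ordinal.{0}}
    (hγ : 1 ≤ γ) (hγ0 : γ < o 0) :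
    (shiftZ 0 (code (bouqLen 0) 1), shiftZ 0 (code (bouqLen 1) 1)) ∉
      closure (closeUp (codeUnionRel bouqLen R) γ) := by
  intro hp
  have hcl := isClosed_codeSet (one_le_bouqLen 0) (h 0).isClosed (h 0).shift_mem
  have hn0 : shiftZ 0 (code (bouqLen 1) 1) ∉ codeSet (bouqLen 0) (D 0) := by
    rintro ⟨x, _, c, hc⟩
    exact cfg_one_ne_zero (bouq_code_eq one_ne_zero hc)
  obtain ⟨⟨y, y'⟩, ⟨hy, hy'⟩, hyy⟩ := mem_closure_iff_nhds.1 hp _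
    (prod_mem_nhds (eventually_agree 3 _) (hcl.isOpen_compl.mem_nhds hn0))
  have hev : ∀ i : ℤ, code (bouqLen 0) 1 i = 1 ↔ ∃ k, i = 2 * k := fun i =>
    code_const_eq_one_iff (one_le_bouqLen 0) 1 i
  have hval : ∀ i, -3 ≤ i → i ≤ 3 → (y i = 1 ↔ ∃ k, i = 2 * k) := fun i h1 h2 => by
    rw [← hev i, ← shiftZ_zero (code (bouqLen 0) 1), show y i = _ from (hy i h1 h2).symm]
  have hy0 : y 0 = 1 := (hval 0 (by norm_num) (by norm_num)).2 ⟨0, by norm_num⟩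
  have hy2 : y 2 = 1 := (hval 2 (by norm_num) (by norm_num)).2 ⟨1, by norm_num⟩
  have hy1 : y 1 ≠ 1 := fun hc => by
    obtain ⟨k, hk⟩ := (hval 1 (by norm_num) (by norm_num)).1 hc; omega
  have hy3 : y 3 ≠ 1 := fun hc => by
    obtain ⟨k, hk⟩ := (hval 3 (by norm_num) (by norm_num)).1 hc; omega
  have hX := closeUp_subset_prod isClosed_codeUnion (codeUnionRel_subset_prod h) γ hyy
  have hsub := codeUnion_subset h one_le_bouqLen isClosed_intervals (fun _ => bouq_eventually)
  have hrest : y' ∈ bouqRest D 0 := by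
    rcases hsub hX.2 with h3 | h3
    · obtain ⟨k, hk⟩ := mem_iUnion.1 h3
      refine mem_bouqRest.2 (Or.inl ⟨k, ?_, hk⟩)
      rintro rfl
      exact hy' hk
    · exact mem_bouqRest.2 (Or.inr h3)
  have hy0' : y ∈ codeSet (bouqLen 0) (D 0) := by
    rcases hsub hX.1 with h3 | h3
    · obtain ⟨k, hk⟩ := mem_iUnion.1 h3
      have := bouq_gap_of_codeSet hk (i := 0) (l := 1) (j := 2) (by norm_num) (by norm_num) hy0
        (eq_zero_of_ne_one hy1) hy2
      obtain rfl : k = 0 := by omega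
      exact hk
    · exact absurd (h3 0 1 2 (by norm_num) (by norm_num) hy0 hy2) hy1
  obtain ⟨x, hx, c, rfl⟩ := hy0'
  have hpos : ∀ s, shiftZ c (code (bouqLen 0) x) (pos (bouqLen 0) x s - c) = 1 := fun s => by
    rw [shiftZ, sub_add_cancel]; exact (code_eq_one_iff (one_le_bouqLen 0) x _).2 ⟨s, rfl⟩
  have hstep : ∀ s, shiftZ c (code (bouqLen 0) x) (pos (bouqLen 0) x s - c + 1) ≠ 1 →
      x s = 1 ∧ pos (bouqLen 0) x (s + 1) = pos (bouqLen 0) x s + 2 := fun s hs => by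
    have h1 := pos_add_one (bouqLen 0) x s
    rcases fin_two_cases (x s) with h2 | h2 <;> rw [h2] at h1 <;>
      simp only [bouqLen_zero, bouqLen_one] at h1
    · refine (hs ?_).elim
      rw [show pos (bouqLen 0) x s - c + 1 = pos (bouqLen 0) x (s + 1) - c by omega]
      exact hpos _
    · exact ⟨h2, by omega⟩
  obtain ⟨s, hs⟩ := (code_eq_one_iff (one_le_bouqLen 0) x _).1 hy0
  obtain ⟨h1, h2⟩ := hstep s (by rwa [← hs, zero_add, sub_self])
  obtain ⟨h3, -⟩ := hstep (s + 1) (by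
    rwa [h2, show pos (bouqLen 0) x s + 2 - c + 1 = 3 by omega])
  exact bouq_not_rel_rest h hγ hγ0 hx h1 h3 hrest hyy

theorem bouq_petal_mem (h : ∀ n, Good (D n) (R n) (o n)) (n : ℕ) :
    shiftZ 0 (code (bouqLen n) 1) ∈ codeUnion bouqLen D :=
  code_mem_codeUnion (h n).one_mem 0

theorem one_mem_bouq (h : ∀ n, Good (D n) (R n) (o n)) : (1 : Cfg) ∈ codeUnion bouqLen D := by
  rw [← bouq_hub 0 0]
  exact code_mem_codeUnion (h 0).zero_mem 0

theorem bouq_ne_odd (h : ∀ n, Good (D n) (R n) (o n)) {ω : Ordinal.{0}} (hω : ω % 2 = 1)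
    (ho : ∀ n, o n = ω) {β : Ordinal.{0}} (hβ : β < ω + 1) :
    closeUp (codeUnionRel bouqLen R) β ≠ codeUnion bouqLen D ×ˢ codeUnion bouqLen D := by
  intro hc
  have hp : (shiftZ 0 (code (bouqLen 0) 1), shiftZ 0 (code (bouqLen 1) 1)) ∈
      closeUp (codeUnionRel bouqLen R) ω :=
    closeUp_mono _ (Order.lt_add_one_iff.1 hβ)
      (hc.symm ▸ ⟨bouq_petal_mem h 0, bouq_petal_mem h 1⟩)
  rcases ordinal_cases ω with rfl | ⟨γ, rfl⟩ | hl
  · simp at hω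
  · rcases ordinal_mod_two γ with hγ | hγ
    · rw [closeUp_add_one_even _ hγ] at hp
      rcases eq_or_ne γ 0 with rfl | hγ0
      · rw [closeUp_zero, isClosed_codeUnionRel.closure_eq] at hp
        rcases codeUnionRel_subset h one_le_bouqLen (fun _ => bouq_eventually) hp with hp | hp
        · obtain ⟨k, hk⟩ := mem_iUnion.1 hp
          obtain ⟨⟨x, _, c, h1⟩, ⟨x', _, c', h2⟩⟩ := codeRel_subset_prod h k hk
          rcases eq_or_ne k 0 with rfl | hk0
          · exact cfg_one_ne_zero (bouq_code_eq one_ne_zero h2)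
          · exact cfg_one_ne_zero (bouq_code_eq hk0.symm h1)
        · exact cfg_one_ne_zero (bouq_code_interval hp.1)
      · refine bouq_not_mem_closure h (one_le_iff_ne_zero.2 hγ0) ?_ hp
        rw [ho]
        exact Order.lt_add_one_iff.2 le_rfl
    · rw [ordinal_odd_add_one hγ] at hω; exact absurd hω zero_ne_one
  · rw [ordinal_limit_even hl] at hω; exact absurd hω zero_ne_one

theorem bouq_ne_of_lt (h : ∀ n, Good (D n) (R n) (o n)) {n : ℕ} {β : Ordinal.{0}}
    (hβ : 1 ≤ β) (hβn : β < o n) :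
    closeUp (codeUnionRel bouqLen R) β ≠ codeUnion bouqLen D ×ˢ codeUnion bouqLen D := by
  intro hc
  have hp : (shiftZ 0 (code (bouqLen n) 1), (1 : Cfg)) ∈ closeUp (codeUnionRel bouqLen R) β :=
    hc.symm ▸ ⟨bouq_petal_mem h n, one_mem_bouq h⟩
  exact bouq_not_rel_rest h hβ hβn (h n).one_mem (k := 0) rfl rfl
    (mem_bouqRest.2 (Or.inr one_mem_intervals)) hp

theorem bouq_zero_run {n : ℕ} {x : Cfg} {k : ℤ} (hk : x k = 1) {N : ℤ} (hN : 2 * N ≤ n) :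
    Agree N (0 : Cfg) (shiftZ (pos (bouqLen n) x k + N + 1) (code (bouqLen n) x)) := by
  intro i h1 h2
  refine (eq_zero_of_ne_one fun hc => ?_).symm
  rw [shiftZ, code_eq_one_iff (one_le_bouqLen n)] at hc
  obtain ⟨s, hs⟩ := hc
  have hp := pos_add_one (bouqLen n) x k
  rw [hk, bouqLen_one] at hp
  have h3 : k < s := (pos_lt_iff (one_le_bouqLen n) x).1 (by omega)
  have h4 : s < k + 1 := (pos_lt_iff (one_le_bouqLen n) x).1 (by omega)
  omega

theorem bouq_self_mem (h : ∀ n, Good (D n) (R n) (o n)) {n : ℕ} {x : Cfg} (hx : x ∈ D n)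
    (c c' : ℤ) : (shiftZ c (code (bouqLen n) x), shiftZ c' (code (bouqLen n) x)) ∈
      ⋃ n, codeRel (bouqLen n) (R n) :=
  mem_iUnion.2 ⟨n, (x, x), (h n).refl x hx, c, c', rfl, rfl⟩

theorem bouq_zero_one (h : ∀ n, Good (D n) (R n) (o n)) :
    ((0 : Cfg), (1 : Cfg)) ∈ codeUnionRel bouqLen R ∧
      ((1 : Cfg), (0 : Cfg)) ∈ codeUnionRel bouqLen R := by
  have key : ∀ N : ℤ, ∃ n : ℕ, ∃ x ∈ D n, ∃ c c',
      Agree N (0 : Cfg) (shiftZ c (code (bouqLen n) x)) ∧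
      Agree N (1 : Cfg) (shiftZ c' (code (bouqLen n) x)) := by
    intro N
    obtain ⟨x, hx, h0, h1⟩ := (h (2 * N).toNat).runs (2 * N + 1)
    refine ⟨_, x, hx, _, pos (bouqLen (2 * N).toNat) x 1 + N, bouq_zero_run h0 (by omega), ?_⟩
    intro i hi hi'
    have hstep : ∀ t : ℕ, (t : ℤ) ≤ 2 * N → pos (bouqLen (2 * N).toNat) x (1 + t) =
        pos (bouqLen (2 * N).toNat) x 1 + t := by
      intro t
      induction t with
      | zero => simp
      | succ t ih =>
        intro ht
        push_cast at ht ⊢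
        rw [← add_assoc, pos_add_one, ih (by omega), h1 _ (by omega) (by omega), bouqLen_zero,
          add_assoc]
    refine ((code_eq_one_iff (one_le_bouqLen _) x _).2 ⟨1 + (i + N), ?_⟩).symm
    have := hstep (i + N).toNat (by omega)
    rw [show (((i + N).toNat : ℕ) : ℤ) = i + N by omega] at this
    omega
  constructor
  · refine mem_closure_prod_iff_agree.2 fun N => ?_
    obtain ⟨n, x, hx, c, c', h1, h2⟩ := key N
    exact ⟨_, bouq_self_mem h hx c c', h1, h2⟩
  · refine mem_closure_prod_iff_agree.2 fun N => ?_
    obtain ⟨n, x, hx, c, c', h1, h2⟩ := key N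
    exact ⟨_, bouq_self_mem h hx c' c, h2, h1⟩

theorem bouq_rel_zero (h : ∀ n, Good (D n) (R n) (o n)) {y : Cfg}
    (hy : y ∈ codeUnion bouqLen D) (hy' : ∀ n, y ∉ codeSet (bouqLen n) (D n)) :
    (y, (0 : Cfg)) ∈ codeUnionRel bouqLen R ∧ ((0 : Cfg), y) ∈ codeUnionRel bouqLen R := by
  have key : ∀ N : ℤ, ∃ n : ℕ, ∃ x ∈ D n, ∃ c c',
      Agree N y (shiftZ c (code (bouqLen n) x)) ∧
      Agree N (0 : Cfg) (shiftZ c' (code (bouqLen n) x)) := by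
    intro N
    have hcl : IsClosed (⋃ n ∈ Set.Iic (2 * N).toNat, codeSet (bouqLen n) (D n)) :=
      (Set.finite_Iic _).isClosed_biUnion fun n _ =>
        isClosed_codeSet (one_le_bouqLen n) (h n).isClosed (h n).shift_mem
    have hyc : y ∉ ⋃ n ∈ Set.Iic (2 * N).toNat, codeSet (bouqLen n) (D n) := by
      simpa using fun n _ => hy' n
    obtain ⟨z, ⟨hz1, hz2⟩, hz⟩ := mem_closure_iff_nhds.1 hy _
      (Filter.inter_mem (eventually_agree N y) (hcl.isOpen_compl.mem_nhds hyc))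
    obtain ⟨n, x, hx, c, rfl⟩ := mem_iUnion.1 hz
    have hn : (2 * N).toNat < n := by
      by_contra! hn
      exact hz2 (mem_iUnion₂.2 ⟨n, hn, x, hx, c, rfl⟩)
    have hx0 : ∃ k, x k = 1 := by
      by_contra! hc
      obtain rfl : x = 0 := funext fun k => eq_zero_of_ne_one (hc k)
      refine hz2 (mem_iUnion₂.2 ⟨0, mem_Iic.2 zero_le, 0, (h 0).zero_mem, 0, ?_⟩)
      rw [bouq_hub, bouq_hub]
    obtain ⟨k, hk⟩ := hx0
    exact ⟨n, x, hx, c, _, hz1, bouq_zero_run hk (by omega)⟩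
  constructor
  · refine mem_closure_prod_iff_agree.2 fun N => ?_
    obtain ⟨n, x, hx, c, c', h1, h2⟩ := key N
    exact ⟨_, bouq_self_mem h hx c c', h1, h2⟩
  · refine mem_closure_prod_iff_agree.2 fun N => ?_
    obtain ⟨n, x, hx, c, c', h1, h2⟩ := key N
    exact ⟨_, bouq_self_mem h hx c' c, h2, h1⟩

theorem bouq_closeUp_eq (h : ∀ n, Good (D n) (R n) (o n)) {δ : Ordinal.{0}} (hδ : δ % 2 = 0)
    (hδ0 : δ ≠ 0) (ho : ∀ n, o n ≤ δ) :
    closeUp (codeUnionRel bouqLen R) δ = codeUnion bouqLen D ×ˢ codeUnion bouqLen D := by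
  refine Subset.antisymm (closeUp_subset_prod isClosed_codeUnion
    (codeUnionRel_subset_prod h) _) ?_
  set P : Cfg → Cfg → Prop := fun a b => (a, b) ∈ closeUp (codeUnionRel bouqLen R) δ with hP
  have htr : ∀ {a b c}, P a b → P b c → P a c := fun h1 h2 =>
    closeUp_trans_of_even _ hδ hδ0 h1 h2
  have hbase : ∀ {a b}, (a, b) ∈ codeUnionRel bouqLen R → P a b := fun hab =>
    closeUp_mono _ (zero_le (a := δ)) (by rwa [closeUp_zero])
  have hhub : ∀ y ∈ codeUnion bouqLen D, P y 1 ∧ P 1 y := by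
    intro y hy
    by_cases hc : ∃ n, y ∈ codeSet (bouqLen n) (D n)
    · obtain ⟨n, x, hx, c, rfl⟩ := hc
      have hR : D n ×ˢ D n ⊆ closeUp (R n) (o n) := (h n).closeUp_eq.ge
      have h1 := code_mem_closeUp_codeUnionRel one_le_bouqLen
        (hR (show (x, (0 : Cfg)) ∈ _ from ⟨hx, (h n).zero_mem⟩)) c 0
      have h2 := code_mem_closeUp_codeUnionRel one_le_bouqLen
        (hR (show ((0 : Cfg), x) ∈ _ from ⟨(h n).zero_mem, hx⟩)) 0 c
      rw [bouq_hub] at h1 h2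
      exact ⟨closeUp_mono _ (ho n) h1, closeUp_mono _ (ho n) h2⟩
    · push Not at hc
      obtain ⟨h1, h2⟩ := bouq_rel_zero h hy hc
      obtain ⟨h3, h4⟩ := bouq_zero_one h
      exact ⟨htr (hbase h1) (hbase h3), htr (hbase h4) (hbase h2)⟩
  rintro ⟨y, y'⟩ ⟨hy, hy'⟩
  exact htr (hhub y hy).1 (hhub y' hy').2

theorem bouq_subset_closure (h : ∀ n, Good (D n) (R n) (o n)) :
    codeUnionRel bouqLen R ⊆ closure (coprimePairs (codeUnion bouqLen D)) :=
  codeUnionRel_subset_closure h one_le_bouqLen fun n _ hp c c' =>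
    code_mem_coprimePairs (one_le_bouqLen n) rfl (fun _ hx c => code_mem_codeUnion hx c) hp c c'

end Bouquet

end CPE

namespace CPE

open Order

theorem exists_odd_seq {ω : Ordinal.{0}} (hω : IsSuccLimit ω) (hc : ω.card ≤ Cardinal.aleph0) :
    ∃ o : ℕ → Ordinal.{0}, (∀ n, o n % 2 = 1 ∧ o n < ω) ∧
      ∀ β < ω, ∀ J : ℕ, ∃ n ≥ J, β < o n := by
  have hcount : (Set.Iio ω).Countable := by
    rw [← Cardinal.le_aleph0_iff_set_countable, Cardinal.mk_Iio_ordinal]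
    rw [Cardinal.lift_le_aleph0]
    exact hc
  have hne : (Set.Iio ω).Nonempty := ⟨0, pos_iff_ne_zero.2 hω.ne_bot⟩
  obtain ⟨f, hf⟩ := hcount.exists_eq_range hne
  have hodd : ∀ γ : Ordinal.{0}, ∃ δ, γ < ω → δ % 2 = 1 ∧ δ < ω ∧ γ < δ := by
    intro γ
    rcases ordinal_mod_two γ with h | h
    · exact ⟨γ + 1, fun hγ => ⟨ordinal_even_add_one h, hω.add_one_lt hγ, lt_add_one γ⟩⟩
    · exact ⟨γ + 1 + 1, fun hγ => ⟨ordinal_even_add_one (ordinal_odd_add_one h),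
        hω.add_one_lt (hω.add_one_lt hγ), (lt_add_one γ).trans (lt_add_one _)⟩⟩
  choose g hg using hodd
  have hfω : ∀ n, f n < ω := fun n => by
    have : f n ∈ Set.range f := ⟨n, rfl⟩
    rwa [← hf] at this
  refine ⟨fun n => g (f n.unpair.1), fun n => ⟨(hg _ (hfω _)).1, (hg _ (hfω _)).2.1⟩,
    fun β hβ J => ?_⟩
  obtain ⟨k, rfl⟩ : β ∈ Set.range f := hf ▸ hβ
  refine ⟨Nat.pair k J, Nat.right_le_pair k J, ?_⟩
  simp only [Nat.unpair_pair]
  exact (hg _ hβ).2.2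

theorem exists_good (α : Ordinal.{0}) (hα : α % 2 = 1) (hc : α.card ≤ Cardinal.aleph0) :
    ∃ D R, Good D R α := by
  induction α using WellFoundedLT.induction with
  | ind α ih =>
    rcases ordinal_cases α with rfl | ⟨δ, rfl⟩ | hl
    · simp at hα
    · rcases ordinal_mod_two δ with hδ | hδ
      · rcases ordinal_cases δ with rfl | ⟨ω, rfl⟩ | hl
        · rw [zero_add]
          exact ⟨univ, univ, good_univ⟩
        · have hω : ω % 2 = 1 := by
            rcases ordinal_mod_two ω with h | h
            · rw [ordinal_even_add_one h] at hδ; exact absurd hδ one_ne_zero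
            · exact h
          have hlt : ω < ω + 1 + 1 := (lt_add_one ω).trans (lt_add_one _)
          obtain ⟨D, R, h⟩ := ih ω hlt hω ((Ordinal.card_le_card hlt.le).trans hc)
          exact ⟨_, _, good_chain (fun _ : ℕ => h) hδ (by simp) (fun _ => (lt_add_one ω).le)
            fun p hp hp2 => chain_sparse_odd (fun _ => h) hω (fun _ => rfl) hp hp2⟩
        · obtain ⟨o, ho, hco⟩ := exists_odd_seq hl
            ((Ordinal.card_le_card (lt_add_one δ).le).trans hc)
          have hlt : ∀ n, o n < δ + 1 := fun n => (ho n).2.trans (lt_add_one δ)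
          choose D R h using fun n => ih (o n) (hlt n) (ho n).1
            ((Ordinal.card_le_card (hlt n).le).trans hc)
          exact ⟨_, _, good_chain h hδ hl.ne_bot (fun n => (ho n).2.le)
            fun p hp hp2 => chain_sparse_limit h hl hco hp hp2⟩
      · rw [ordinal_odd_add_one hδ] at hα; exact absurd hα zero_ne_one
    · rw [ordinal_limit_even hl] at hα; exact absurd hα zero_ne_one

theorem cpe_class_of_rel {X : Set Cfg} {R : Set (Cfg × Cfg)} {α : Ordinal.{0}} (hα : 1 ≤ α)
    (hX : IsClosed X) (hs : ∀ x ∈ X, ∀ c, shiftZ c x ∈ X) (hne : X.Nonempty) (hR : IsClosed R)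
    (hRX : R ⊆ X ×ˢ X) (hrefl : ∀ x ∈ X, (x, x) ∈ R) (hsat : Saturated R)
    (hcp : R ⊆ closure (coprimePairs X)) (htop : closeUp R α = X ×ˢ X)
    (hlow : ∀ β, 1 ≤ β → β < α → closeUp R β ≠ X ×ˢ X) :
    ∃ (n : ℕ) (X : Set (ℤ → Fin n)), IsSubshift X ∧ X.Nonempty ∧
      (∃ o : Ordinal, closeUp (EP X) o = X ×ˢ X) ∧ closeUpRank (EP X) = α := by
  have hEP : EP X = R := EP_eq_of_saturated hs hR hRX hrefl hsat hcp
  refine ⟨2, X, isSubshift_of_shiftZ hX hs, hne, ⟨α, ?_⟩, ?_⟩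
  · rw [hEP, htop]
  · rw [hEP]
    exact closeUpRank_eq hX hR hRX hα htop hlow

theorem cpe_class_of_bouquet {D : ℕ → Set Cfg} {R : ℕ → Set (Cfg × Cfg)} {o : ℕ → Ordinal.{0}}
    (h : ∀ n, Good (D n) (R n) (o n)) {δ : Ordinal.{0}} (hδ : δ % 2 = 0)
    (hδ0 : δ ≠ 0) (ho : ∀ n, o n ≤ δ)
    (hlow : ∀ β, 1 ≤ β → β < δ →
      closeUp (codeUnionRel bouqLen R) β ≠ codeUnion bouqLen D ×ˢ codeUnion bouqLen D) :
    ∃ (n : ℕ) (X : Set (ℤ → Fin n)), IsSubshift X ∧ X.Nonempty ∧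
      (∃ o : Ordinal, closeUp (EP X) o = X ×ˢ X) ∧ closeUpRank (EP X) = δ :=
  cpe_class_of_rel (one_le_iff_ne_zero.2 hδ0) isClosed_codeUnion codeUnion_shift_mem
    ⟨1, one_mem_bouq h⟩ isClosed_codeUnionRel (codeUnionRel_subset_prod h) (codeUnionRel_refl h)
    saturated_codeUnionRel (bouq_subset_closure h) (bouq_closeUp_eq h hδ hδ0 ho) hlow

end CPE

open CPE in
/-- For every countable ordinal `α ≥ 1` there exists a finite alphabet `A` (w.l.o.g. `Fin n`)
and a subshift `X ⊆ A^ℤ` in CPE class `α`, i.e. `EP(X)` is equalizing (some close-up stage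
equals `X × X`) and has close-up rank `α`. -/
theorem cpe_class_realized_by_subshift (α : Ordinal) (hα : 1 ≤ α)
    (hcount : α.card ≤ Cardinal.aleph0) :
    ∃ (n : ℕ) (X : Set (ℤ → Fin n)), IsSubshift X ∧ X.Nonempty ∧
      (∃ o : Ordinal, closeUp (EP X) o = X ×ˢ X) ∧ closeUpRank (EP X) = α := by
  rcases ordinal_mod_two α with hα2 | hα2
  · rcases ordinal_cases α with rfl | ⟨ω, rfl⟩ | hl
    · simp at hα
    · have hω : ω % 2 = 1 := by
        rcases ordinal_mod_two ω with h | h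
        · rw [ordinal_even_add_one h] at hα2; exact absurd hα2 one_ne_zero
        · exact h
      have hlt := Order.lt_add_one_iff.2 (le_refl ω)
      obtain ⟨D, R, h⟩ := exists_good ω hω ((Ordinal.card_le_card hlt.le).trans hcount)
      exact cpe_class_of_bouquet (fun _ : ℕ => h) hα2 (by simp) (fun _ => hlt.le)
        fun β _ hβ => bouq_ne_odd (fun _ : ℕ => h) hω (fun _ => rfl) hβ
    · obtain ⟨o, ho, hco⟩ := exists_odd_seq hl hcount
      choose D R h using fun n => exists_good (o n) (ho n).1
        ((Ordinal.card_le_card (ho n).2.le).trans hcount)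
      refine cpe_class_of_bouquet h hα2 hl.ne_bot (fun n => (ho n).2.le) fun β hβ1 hβ => ?_
      obtain ⟨n, -, hn⟩ := hco β hβ 0
      exact bouq_ne_of_lt h hβ1 hn
  · obtain ⟨D, R, h⟩ := exists_good α hα2 hcount
    refine cpe_class_of_rel hα h.isClosed h.shift_mem ⟨0, h.zero_mem⟩ h.isClosed_rel h.rel_subset
      h.refl h.saturated (h.rel_subset_closure.trans
        (closure_mono (unimodularPairs_subset_coprimePairs D))) h.closeUp_eq fun β hβ1 hβ hc => ?_
    exact h.separated β hβ1 hβ 1 (hc.symm ▸ ⟨h.one_mem, h.zero_mem⟩) ⟨rfl, rfl⟩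
end

section
/- For every countable ordinal λ ≥ 1, there exists a closed countable set X ⊆ [0,1] and an equalizing closed symmetric reflexive relation E ⊆ X² whose close-up rank is λ. -/
open Filter Topology Set

namespace CPE

open Ordinal Order

universe v w

/-! ### The close-up process with an independently chosen universe of stages -/

/-- The close-up process on a relation, indexed by the ordinals of an arbitrary universe. -/
noncomputable def closeUpStage {α : Type v} [TopologicalSpace α] (E : Set (α × α))
    (o : Ordinal.{w}) : Set (α × α) :=
  Ordinal.limitRecOn o E
    (fun β ih => if β % 2 = 0 then closure ih
      else {p | Relation.TransGen (fun a b => (a, b) ∈ ih) p.1 p.2})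
    (fun β _ ih => ⋃ γ : Set.Iio β, ih γ.1 γ.2)

theorem closeUp_eq_closeUpStage {α : Type u} [TopologicalSpace α] (E : Set (α × α))
    (o : Ordinal.{u}) : closeUp E o = closeUpStage E o := rfl

section Stage

variable {α : Type v} [TopologicalSpace α] (E : Set (α × α))

theorem closeUpStage_zero : closeUpStage E (0 : Ordinal.{w}) = E :=
  Ordinal.limitRecOn_zero ..

theorem closeUpStage_add_one_of_even {o : Ordinal.{w}} (h : o % 2 = 0) :
    closeUpStage E (o + 1) = closure (closeUpStage E o) := by
  unfold closeUpStage
  rw [Ordinal.limitRecOn_add_one, if_pos h]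

theorem closeUpStage_add_one_of_odd {o : Ordinal.{w}} (h : o % 2 ≠ 0) :
    closeUpStage E (o + 1) =
      {p | Relation.TransGen (fun a b => (a, b) ∈ closeUpStage E o) p.1 p.2} := by
  unfold closeUpStage
  rw [Ordinal.limitRecOn_add_one, if_neg h]

theorem closeUpStage_limit {o : Ordinal.{w}} (h : IsSuccLimit o) :
    closeUpStage E o = ⋃ γ : Set.Iio o, closeUpStage E γ.1 := by
  unfold closeUpStage
  rw [Ordinal.limitRecOn_limit _ _ _ _ h]

theorem closeUpStage_subset_add_one (o : Ordinal.{w}) :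
    closeUpStage E o ⊆ closeUpStage E (o + 1) := by
  by_cases h : o % 2 = 0
  · rw [closeUpStage_add_one_of_even E h]
    exact subset_closure
  · rw [closeUpStage_add_one_of_odd E h]
    exact fun p hp => Relation.TransGen.single hp

theorem closeUpStage_mono : Monotone (closeUpStage E : Ordinal.{w} → Set (α × α)) := by
  intro a b hab
  induction b using Ordinal.limitRecOn with
  | zero => rw [nonpos_iff_eq_zero.1 hab]
  | add_one b ih =>
    rcases hab.lt_or_eq with h | rfl
    · exact (ih (Order.lt_add_one_iff.1 h)).trans (closeUpStage_subset_add_one E b)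
    · exact subset_rfl
  | limit b hb _ =>
    rcases hab.lt_or_eq with h | rfl
    · rw [closeUpStage_limit E hb]
      exact subset_iUnion (fun γ : Set.Iio b => closeUpStage E γ.1) ⟨a, h⟩
    · exact subset_rfl

theorem closeUpStage_subset {T : Set (α × α)} (hE : E ⊆ T) (hc : IsClosed T)
    (ht : ∀ x y z, (x, y) ∈ T → (y, z) ∈ T → (x, z) ∈ T) (o : Ordinal.{w}) :
    closeUpStage E o ⊆ T := by
  induction o using Ordinal.limitRecOn with
  | zero => rwa [closeUpStage_zero]
  | add_one b ih =>
    by_cases h : b % 2 = 0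
    · rw [closeUpStage_add_one_of_even E h]
      exact closure_minimal ih hc
    · rw [closeUpStage_add_one_of_odd E h]
      rintro ⟨x, y⟩ hxy
      change Relation.TransGen _ x y at hxy
      induction hxy with
      | single h => exact ih h
      | tail _ h ih' => exact ht _ _ _ ih' (ih h)
  | limit b hb ih =>
    rw [closeUpStage_limit E hb]
    exact iUnion_subset fun γ => ih γ.1 γ.2

theorem closeUpStage_symm {E : Set (α × α)} (hE : ∀ x y, (x, y) ∈ E → (y, x) ∈ E)
    (o : Ordinal.{w}) :
    ∀ x y, (x, y) ∈ closeUpStage E o → (y, x) ∈ closeUpStage E o := by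
  induction o using Ordinal.limitRecOn with
  | zero => rwa [closeUpStage_zero]
  | add_one b ih =>
    intro x y hxy
    by_cases h : b % 2 = 0
    · rw [closeUpStage_add_one_of_even E h] at hxy ⊢
      have hmaps : MapsTo Prod.swap (closeUpStage E b) (closeUpStage E b) :=
        fun p hp => ih p.1 p.2 hp
      exact hmaps.closure continuous_swap hxy
    · rw [closeUpStage_add_one_of_odd E h] at hxy ⊢
      change Relation.TransGen _ x y at hxy
      change Relation.TransGen _ y x
      induction hxy with
      | single h => exact Relation.TransGen.single (ih _ _ h)
      | tail _ h ih' => exact Relation.TransGen.head (ih _ _ h) ih'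
  | limit b hb ih =>
    intro x y hxy
    rw [closeUpStage_limit E hb, mem_iUnion] at hxy ⊢
    exact hxy.imp fun γ => ih γ.1 γ.2 x y

/-- The close-up process on a compact square commutes with continuous injections. -/
theorem closeUpStage_image {β : Type*} [TopologicalSpace β] [T2Space α] [T2Space β] {f : α → β}
    (hf : Continuous f) {K : Set α} (hK : IsCompact K) (hinj : InjOn f K) (hE : E ⊆ K ×ˢ K)
    (o : Ordinal.{w}) :
    closeUpStage (Prod.map f f '' E) o = Prod.map f f '' closeUpStage E o := by
  have hKK : IsCompact (K ×ˢ K) := hK.prod hK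
  have hsub : ∀ o : Ordinal.{w}, closeUpStage E o ⊆ K ×ˢ K :=
    closeUpStage_subset E hE hKK.isClosed fun x y z h₁ h₂ => ⟨h₁.1, h₂.2⟩
  induction o using Ordinal.limitRecOn with
  | zero => simp only [closeUpStage_zero]
  | add_one b ih =>
    by_cases h : b % 2 = 0
    · rw [closeUpStage_add_one_of_even _ h, closeUpStage_add_one_of_even _ h, ih]
      exact (image_closure_of_isCompact (hKK.of_isClosed_subset isClosed_closure
        (closure_minimal (hsub b) hKK.isClosed)) (hf.prodMap hf).continuousOn).symm
    · rw [closeUpStage_add_one_of_odd _ h, closeUpStage_add_one_of_odd _ h, ih]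
      ext ⟨x, y⟩
      constructor
      · intro hxy
        change Relation.TransGen _ x y at hxy
        induction hxy with
        | single h =>
          obtain ⟨p, hp, hpe⟩ := h
          exact ⟨p, Relation.TransGen.single hp, hpe⟩
        | tail _ h ih' =>
          obtain ⟨⟨a, b'⟩, hp, hpe⟩ := ih'
          obtain ⟨⟨c, d⟩, hq, hqe⟩ := h
          simp only [Prod.map_apply, Prod.mk.injEq] at hpe hqe
          have hb' : (a, b') ∈ closeUpStage E (b + 1) := by
            rw [closeUpStage_add_one_of_odd _ h]
            exact hp
          obtain rfl : b' = c :=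
            hinj (hsub _ hb').2 (hsub _ hq).1 (hpe.2.trans hqe.1.symm)
          exact ⟨(a, d), Relation.TransGen.tail hp hq, Prod.ext hpe.1 hqe.2⟩
      · rintro ⟨⟨a, c⟩, hac, hpe⟩
        simp only [Prod.map_apply, Prod.mk.injEq] at hpe
        obtain ⟨rfl, rfl⟩ := hpe
        change Relation.TransGen _ a c at hac
        induction hac with
        | single h => exact Relation.TransGen.single ⟨_, h, rfl⟩
        | tail _ h ih' => exact Relation.TransGen.tail ih' ⟨_, h, rfl⟩
  | limit b hb ih =>
    rw [closeUpStage_limit _ hb, closeUpStage_limit _ hb, image_iUnion]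
    exact iUnion_congr fun γ => ih γ.1 γ.2

theorem closeUpStage_two_mul_add_one (ν : Ordinal.{w}) :
    closeUpStage E (2 * ν + 1) = closure (closeUpStage E (2 * ν)) :=
  closeUpStage_add_one_of_even E (Ordinal.mul_mod 2 ν)

theorem closeUpStage_two_mul_add_two (ν : Ordinal.{w}) :
    closeUpStage E (2 * (ν + 1)) =
      {p | Relation.TransGen (fun a b => (a, b) ∈ closeUpStage E (2 * ν + 1)) p.1 p.2} := by
  have h : (2 : Ordinal.{w}) * (ν + 1) = 2 * ν + 1 + 1 := by
    rw [mul_add_one, add_assoc, one_add_one_eq_two]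
  rw [h, closeUpStage_add_one_of_odd]
  rw [Ordinal.mul_add_mod_self, Ordinal.mod_eq_of_lt one_lt_two]
  exact one_ne_zero

end Stage

theorem exists_two_mul_or_two_mul_add_one (o : Ordinal.{w}) :
    ∃ ν, o = 2 * ν ∨ o = 2 * ν + 1 := by
  refine ⟨o / 2, ?_⟩
  have h := Ordinal.div_add_mod o 2
  have h2 : o % 2 < 2 := Ordinal.mod_lt o two_ne_zero
  rw [← one_add_one_eq_two, Order.lt_add_one_iff, Order.le_one_iff] at h2
  rw [one_add_one_eq_two] at h2
  rcases h2 with h2 | h2 <;> rw [h2] at h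
  · left; rw [← h]; simp
  · right; exact h.symm

/-! ### Absorption for powers of `ω` -/

theorem add_opow_le_of_lt {x y ν : Ordinal.{w}} (h : x < y + ω ^ ν) :
    x + ω ^ ν ≤ y + ω ^ ν := by
  obtain ⟨s, hs, hx⟩ := (Ordinal.lt_add_iff (opow_pos ν omega0_pos).ne').1 h
  calc x + ω ^ ν ≤ y + s + ω ^ ν := by gcongr
    _ = y + ω ^ ν := by rw [add_assoc, add_omega0_opow hs]

theorem opow_lt_opow_add_one (ν : Ordinal.{w}) : (ω : Ordinal.{w}) ^ ν < ω ^ (ν + 1) :=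
  (opow_lt_opow_iff_right one_lt_omega0).2 (lt_add_one ν)

theorem opow_le_opow_omega0 {μ ν : Ordinal.{w}} (h : μ ≤ ν) : (ω : Ordinal.{w}) ^ μ ≤ ω ^ ν :=
  opow_le_opow_right omega0_pos h

/-! ### A relation on an initial segment of the ordinals -/

open Classical in
/-- The map sending the endpoint `κ` to `0` if `b` holds, and fixing all other ordinals. -/
noncomputable def collapse (b : Prop) (κ x : Ordinal.{w}) : Ordinal.{w} :=
  if b ∧ x = κ then 0 else x

/-- Points of `[0, ω ^ α]` at distance less than `ω ^ ν`, where the endpoints are identified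
if `b` holds. -/
def nearLT (b : Prop) (α ν : Ordinal.{w}) : Set (Ordinal.{w} × Ordinal.{w}) :=
  {p | (p.1 ≤ ω ^ α ∧ p.2 ≤ ω ^ α) ∧
    collapse b (ω ^ α) p.1 < collapse b (ω ^ α) p.2 + ω ^ ν ∧
    collapse b (ω ^ α) p.2 < collapse b (ω ^ α) p.1 + ω ^ ν}

/-- Points of `[0, ω ^ α]` at distance at most `ω ^ ν`, where the right endpoint is also related
to `[0, ω ^ ν]` if `b` holds. -/
def nearLE (b : Prop) (α ν : Ordinal.{w}) : Set (Ordinal.{w} × Ordinal.{w}) :=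
  {p | (p.1 ≤ ω ^ α ∧ p.2 ≤ ω ^ α) ∧
    ((p.1 ≤ p.2 + ω ^ ν ∧ p.2 ≤ p.1 + ω ^ ν) ∨
      ((b ∧ p.1 = ω ^ α) ∧ p.2 ≤ ω ^ ν) ∨ ((b ∧ p.2 = ω ^ α) ∧ p.1 ≤ ω ^ ν))}

section Near

variable {b : Prop} {α ν : Ordinal.{w}}

theorem collapse_endpoint {κ : Ordinal.{w}} (hb : b) : collapse b κ κ = 0 := if_pos ⟨hb, rfl⟩

theorem collapse_of_not {κ x : Ordinal.{w}} (h : ¬ (b ∧ x = κ)) : collapse b κ x = x := if_neg h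

theorem collapse_of_ne {κ x : Ordinal.{w}} (h : x ≠ κ) : collapse b κ x = x :=
  collapse_of_not fun h' => h h'.2

theorem collapse_le_self {κ : Ordinal.{w}} (x : Ordinal.{w}) : collapse b κ x ≤ x := by
  unfold collapse
  split_ifs
  exacts [zero_le, le_rfl]

theorem collapse_collapse {κ : Ordinal.{w}} (x : Ordinal.{w}) :
    collapse b κ (collapse b κ x) = collapse b κ x := by
  by_cases h : b ∧ x = κ
  · obtain ⟨hb, rfl⟩ := h
    rw [collapse_endpoint hb]
    exact nonpos_iff_eq_zero.1 (collapse_le_self 0)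
  · rw [collapse_of_not h, collapse_of_not h]

theorem nearLT_symm {x y : Ordinal.{w}} (h : (x, y) ∈ nearLT b α ν) : (y, x) ∈ nearLT b α ν :=
  ⟨h.1.symm, h.2.symm⟩

theorem nearLT_trans {x y z : Ordinal.{w}} (h : (x, y) ∈ nearLT b α ν)
    (h' : (y, z) ∈ nearLT b α ν) : (x, z) ∈ nearLT b α ν :=
  ⟨⟨h.1.1, h'.1.2⟩, h.2.1.trans_le (add_opow_le_of_lt h'.2.1),
    h'.2.2.trans_le (add_opow_le_of_lt h.2.2)⟩

theorem nearLT_mono {μ : Ordinal.{w}} (h : μ ≤ ν) : nearLT b α μ ⊆ nearLT b α ν := by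
  have := opow_le_opow_omega0 h
  exact fun p hp => ⟨hp.1, hp.2.1.trans_le (by gcongr), hp.2.2.trans_le (by gcongr)⟩

theorem nearLT_limit (hν : IsSuccLimit ν) {p : Ordinal.{w} × Ordinal.{w}}
    (hp : p ∈ nearLT b α ν) : ∃ μ < ν, p ∈ nearLT b α μ := by
  have key : ∀ {x y : Ordinal.{w}}, x < y + ω ^ ν → ∃ μ < ν, x < y + ω ^ μ := by
    intro x y h
    obtain ⟨s, hs, hx⟩ := (Ordinal.lt_add_iff (opow_pos ν omega0_pos).ne').1 h
    obtain ⟨μ, hμ, hs⟩ := (lt_opow_of_isSuccLimit omega0_ne_zero hν).1 hs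
    exact ⟨μ, hμ, hx.trans_lt (by gcongr)⟩
  obtain ⟨hK, h₁, h₂⟩ := hp
  obtain ⟨μ₁, hμ₁, h₁⟩ := key h₁
  obtain ⟨μ₂, hμ₂, h₂⟩ := key h₂
  refine ⟨max μ₁ μ₂, max_lt hμ₁ hμ₂, hK, h₁.trans_le ?_, h₂.trans_le ?_⟩
  · have := opow_le_opow_omega0 (le_max_left μ₁ μ₂)
    gcongr
  · have := opow_le_opow_omega0 (le_max_right μ₁ μ₂)
    gcongr

theorem nearLT_subset_nearLE : nearLT b α ν ⊆ nearLE b α ν := by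
  rintro ⟨x, y⟩ ⟨⟨hx, hy⟩, h₁, h₂⟩
  refine ⟨⟨hx, hy⟩, ?_⟩
  dsimp only at *
  by_cases hbx : b ∧ x = ω ^ α <;> by_cases hby : b ∧ y = ω ^ α
  · left
    rw [hbx.2, hby.2]
    exact ⟨le_self_add, le_self_add⟩
  · right; left
    refine ⟨hbx, ?_⟩
    rw [collapse_of_not hby, hbx.2, collapse_endpoint hbx.1, zero_add] at h₂
    exact h₂.le
  · right; right
    refine ⟨hby, ?_⟩
    rw [collapse_of_not hbx, hby.2, collapse_endpoint hby.1, zero_add] at h₁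
    exact h₁.le
  · left
    rw [collapse_of_not hbx, collapse_of_not hby] at h₁ h₂
    exact ⟨h₁.le, h₂.le⟩

theorem nearLE_symm {x y : Ordinal.{w}} (h : (x, y) ∈ nearLE b α ν) : (y, x) ∈ nearLE b α ν :=
  ⟨h.1.symm, h.2.imp And.symm Or.symm⟩

theorem mem_nearLT_of_endpoint (hν : ν < α) (hb : b) {y : Ordinal.{w}}
    (h : (ω ^ α, y) ∈ nearLE b α ν) : (ω ^ α, y) ∈ nearLT b α (ν + 1) := by
  obtain ⟨hK, h⟩ := h
  refine ⟨hK, ?_⟩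
  dsimp only at *
  have hω : (0 : Ordinal.{w}) < ω ^ (ν + 1) := opow_pos _ omega0_pos
  have hνα : (ω : Ordinal.{w}) ^ ν < ω ^ α := (opow_lt_opow_iff_right one_lt_omega0).2 hν
  rw [collapse_endpoint hb]
  rcases eq_or_ne y (ω ^ α) with rfl | hy
  · rw [collapse_endpoint hb, zero_add]
    exact ⟨hω, hω⟩
  rw [collapse_of_ne hy, zero_add]
  refine ⟨hω.trans_le le_add_self, ?_⟩
  rcases h with h | h | h
  · exact absurd h.1 (isPrincipal_add_omega0_opow α (hK.2.lt_of_ne hy) hνα).not_ge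
  · exact h.2.trans_lt (opow_lt_opow_add_one ν)
  · exact absurd h.1.2 hy

theorem nearLE_subset_nearLT (hν : ν < α) : nearLE b α ν ⊆ nearLT b α (ν + 1) := by
  rintro ⟨x, y⟩ h
  by_cases hbx : b ∧ x = ω ^ α
  · obtain ⟨hb, rfl⟩ := hbx
    exact mem_nearLT_of_endpoint hν hb h
  by_cases hby : b ∧ y = ω ^ α
  · obtain ⟨hb, rfl⟩ := hby
    exact nearLT_symm (mem_nearLT_of_endpoint hν hb (nearLE_symm h))
  refine ⟨h.1, ?_⟩
  rw [collapse_of_not hbx, collapse_of_not hby]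
  rcases h.2 with h | h | h
  · have := opow_lt_opow_add_one ν
    exact ⟨h.1.trans_lt (by gcongr), h.2.trans_lt (by gcongr)⟩
  · exact absurd h.1 hbx
  · exact absurd h.1 hby

theorem isClosed_setOf_le_add (c : Ordinal.{w}) :
    IsClosed {p : Ordinal.{w} × Ordinal.{w} | p.1 ≤ p.2 + c} := by
  rw [← isOpen_compl_iff, isOpen_iff_mem_nhds]
  rintro ⟨x, y⟩ h
  simp only [mem_compl_iff, mem_ofPred_eq, not_le] at h
  have h₁ : Ioi (y + c) ∈ 𝓝 x := Ioi_mem_nhds h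
  have h₂ : Iio (y + 1) ∈ 𝓝 y := Iio_mem_nhds (lt_add_one y)
  filter_upwards [prod_mem_nhds h₁ h₂] with q hq
  simp only [mem_compl_iff, mem_ofPred_eq, not_le]
  have hq₂ : q.2 ≤ y := Order.lt_add_one_iff.1 hq.2
  exact lt_of_le_of_lt (by gcongr) hq.1

theorem isClosed_nearLE : IsClosed (nearLE b α ν) := by
  have hs : IsClosed {p : Ordinal.{w} × Ordinal.{w} | p.2 ≤ p.1 + ω ^ ν} :=
    (isClosed_setOf_le_add (ω ^ ν)).preimage continuous_swap
  have hcst : ∀ c, IsClosed {_p : Ordinal.{w} × Ordinal.{w} | c} := fun c => isClosed_const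
  refine IsClosed.inter (IsClosed.inter ?_ ?_)
    (((isClosed_setOf_le_add (ω ^ ν)).inter hs).union
      (IsClosed.union (((hcst b).inter ?_).inter ?_) (((hcst b).inter ?_).inter ?_)))
  · exact isClosed_le continuous_fst continuous_const
  · exact isClosed_le continuous_snd continuous_const
  · exact isClosed_eq continuous_fst continuous_const
  · exact isClosed_le continuous_snd continuous_const
  · exact isClosed_eq continuous_snd continuous_const
  · exact isClosed_le continuous_fst continuous_const

theorem nearLE_subset_prod : nearLE b α ν ⊆ Iic (ω ^ α) ×ˢ Iic (ω ^ α) := fun _ hp => hp.1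

/-! ### The stages of the close-up process -/

theorem closeUpStage_subset_nearLT {E : Set (Ordinal.{w} × Ordinal.{w})} (hE : E ⊆ nearLE b α 0)
    (h0 : 0 < ν) (hν : ν ≤ α) : closeUpStage E (2 * ν) ⊆ nearLT b α ν := by
  induction ν using Ordinal.limitRecOn with
  | zero => exact absurd h0 (lt_irrefl _)
  | add_one ν ih =>
    have hνα : ν < α := Order.add_one_le_iff.1 hν
    have h1 : closeUpStage E (2 * ν) ⊆ nearLE b α ν := by
      rcases eq_or_ne ν 0 with rfl | hne
      · rwa [mul_zero, closeUpStage_zero]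
      · exact (ih (pos_iff_ne_zero.2 hne) hνα.le).trans nearLT_subset_nearLE
    have h2 : closeUpStage E (2 * ν + 1) ⊆ nearLT b α (ν + 1) := by
      rw [closeUpStage_two_mul_add_one]
      exact (closure_minimal h1 isClosed_nearLE).trans (nearLE_subset_nearLT hνα)
    rw [closeUpStage_two_mul_add_two]
    rintro ⟨x, y⟩ hxy
    change Relation.TransGen _ x y at hxy
    induction hxy with
    | single h => exact h2 h
    | tail _ h ih' => exact nearLT_trans ih' (h2 h)
  | limit ν hν' ih =>
    rw [closeUpStage_limit E (isSuccLimit_mul_right two_pos hν')]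
    refine iUnion_subset ?_
    rintro ⟨γ, hγ⟩
    have hlt : γ / 2 < ν := (lt_mul_iff_div_lt two_ne_zero).1 hγ
    have hlt' : γ / 2 + 1 < ν := hν'.add_one_lt hlt
    have hle : γ ≤ 2 * (γ / 2 + 1) := (lt_mul_succ_div γ two_ne_zero).le
    exact (closeUpStage_mono E hle).trans <|
      (ih _ hlt' (by positivity) (hlt'.le.trans hν)).trans (nearLT_mono hlt'.le)

theorem closeUpStage_subset_nearLE {E : Set (Ordinal.{w} × Ordinal.{w})} (hE : E ⊆ nearLE b α 0)
    (hν : ν ≤ α) : closeUpStage E (2 * ν + 1) ⊆ nearLE b α ν := by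
  rw [closeUpStage_two_mul_add_one]
  refine closure_minimal ?_ isClosed_nearLE
  rcases eq_or_ne ν 0 with rfl | hne
  · rwa [mul_zero, closeUpStage_zero]
  · exact (closeUpStage_subset_nearLT hE (pos_iff_ne_zero.2 hne) hν).trans nearLT_subset_nearLE

theorem mem_nearLT_of_lt_add {x y : Ordinal.{w}} (hν : ν ≤ α) (hxy : x ≤ y) (hy : y ≤ ω ^ α)
    (h : y < x + ω ^ ν) : (x, y) ∈ nearLT b α ν := by
  have hω : (0 : Ordinal.{w}) < ω ^ ν := opow_pos _ omega0_pos
  refine ⟨⟨hxy.trans hy, hy⟩, ?_⟩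
  dsimp only
  rcases hxy.eq_or_lt with rfl | hlt
  · exact ⟨lt_add_of_pos_right _ hω, lt_add_of_pos_right _ hω⟩
  have hx : x < ω ^ α := hlt.trans_le hy
  have hy' : y ≠ ω ^ α := by
    rintro rfl
    refine h.not_ge ?_
    calc x + ω ^ ν ≤ x + ω ^ α := by gcongr; exact omega0_pos
      _ = ω ^ α := add_omega0_opow hx
  rw [collapse_of_ne hx.ne, collapse_of_ne hy']
  exact ⟨hlt.trans_le le_self_add, h⟩

/-- Once a stage contains `nearLT b α ν`, its closure relates `x` and `x + ω ^ ν`. -/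
theorem mem_closeUpStage_add_opow {E : Set (Ordinal.{w} × Ordinal.{w})} (hE : nearLE b α 0 ⊆ E)
    (hν : ν ≤ α) (h : nearLT b α ν ⊆ closeUpStage E (2 * ν)) {x : Ordinal.{w}}
    (hx : x + ω ^ ν ≤ ω ^ α) : (x, x + ω ^ ν) ∈ closeUpStage E (2 * ν + 1) := by
  rcases eq_or_ne ν 0 with rfl | hne
  · refine closeUpStage_mono E zero_le ?_
    rw [closeUpStage_zero]
    refine hE ⟨⟨le_self_add.trans hx, hx⟩, Or.inl ⟨?_, le_rfl⟩⟩
    exact le_self_add.trans le_self_add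
  rw [closeUpStage_two_mul_add_one]
  refine closure_mono h ?_
  have hlim : IsSuccLimit (x + ω ^ ν) :=
    isSuccLimit_add x (isSuccLimit_opow_left isSuccLimit_omega0 hne)
  have hmem : x + ω ^ ν ∈ closure (Ico x (x + ω ^ ν)) := by
    have hlt : x < x + ω ^ ν := lt_add_of_pos_right x (opow_pos ν omega0_pos)
    refine IsLUB.mem_closure ⟨fun y hy => hy.2.le, fun u hu => ?_⟩ ⟨x, le_rfl, hlt⟩
    by_contra! hlu
    have hmax : max x u + 1 < x + ω ^ ν := hlim.add_one_lt (max_lt hlt hlu)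
    have := hu ⟨(le_max_left x u).trans le_self_add, hmax⟩
    exact (lt_add_one (max x u)).not_ge (this.trans (le_max_right x u))
  have hmaps : MapsTo (fun y => (x, y)) (Ico x (x + ω ^ ν)) (nearLT b α ν) :=
    fun y hy => mem_nearLT_of_lt_add hν hy.1 (hy.2.le.trans hx) hy.2
  exact hmaps.closure (by fun_prop) hmem

theorem nearLT_subset_closeUpStage {E : Set (Ordinal.{w} × Ordinal.{w})} (hE : nearLE b α 0 ⊆ E)
    (hsymm : ∀ x y, (x, y) ∈ E → (y, x) ∈ E) (hν : ν ≤ α) :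
    nearLT b α ν ⊆ closeUpStage E (2 * ν) := by
  induction ν using Ordinal.limitRecOn with
  | zero =>
    rw [mul_zero, closeUpStage_zero]
    exact nearLT_subset_nearLE.trans hE
  | add_one ν ih =>
    have hνα : ν < α := Order.add_one_le_iff.1 hν
    have hlow := ih hνα.le
    set S := closeUpStage E (2 * ν + 1) with hS
    have hlow' : nearLT b α ν ⊆ S := hlow.trans (closeUpStage_subset_add_one E _)
    have hadd := fun {x : Ordinal.{w}} => mem_closeUpStage_add_opow (x := x) hE hνα.le hlow
    set R := closeUpStage E (2 * (ν + 1)) with hR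
    have hSR : ∀ {x y}, (x, y) ∈ S → (x, y) ∈ R := fun h => by
      rw [hR, closeUpStage_two_mul_add_two]
      exact Relation.TransGen.single h
    have htrans : ∀ {x y z}, (x, y) ∈ R → (y, z) ∈ R → (x, z) ∈ R := fun h h' => by
      rw [hR, closeUpStage_two_mul_add_two] at h h' ⊢
      exact Relation.TransGen.trans h h'
    have hsR : ∀ {x y}, (x, y) ∈ R → (y, x) ∈ R := closeUpStage_symm hsymm _ _ _
    have hstep : ∀ n : ℕ, ∀ x y : Ordinal.{w}, x ≤ y → y ≤ ω ^ α → y < x + ω ^ ν * n →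
        (x, y) ∈ R := by
      intro n
      induction n with
      | zero =>
        intro x y hxy _ h
        rw [Nat.cast_zero, mul_zero, add_zero] at h
        exact absurd hxy h.not_ge
      | succ n ihn =>
        intro x y hxy hy h
        rcases lt_or_ge y (x + ω ^ ν) with hlt | hge
        · exact hSR (hlow' (mem_nearLT_of_lt_add hνα.le hxy hy hlt))
        · refine htrans (hSR (hadd (hge.trans hy))) (ihn _ y hge hy ?_)
          rwa [add_assoc, ← mul_one_add, ← Nat.cast_one_add, add_comm 1 n]
    have hle : ∀ x y : Ordinal.{w}, x ≤ y → y ≤ ω ^ α → y < x + ω ^ (ν + 1) → (x, y) ∈ R := by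
      intro x y hxy hy h
      obtain ⟨s, hs, hys⟩ := (Ordinal.lt_add_iff (opow_pos (ν + 1) omega0_pos).ne').1 h
      obtain ⟨n, hn⟩ := lt_omega0_opow_succ.1 hs
      exact hstep n x y hxy hy (hys.trans_lt (by gcongr))
    have hlt : ∀ x y : Ordinal.{w}, x ≤ ω ^ α → y ≤ ω ^ α → x < y + ω ^ (ν + 1) →
        y < x + ω ^ (ν + 1) → (x, y) ∈ R := by
      intro x y hx hy h₁ h₂
      rcases le_total x y with h | h
      · exact hle x y h hy h₂
      · exact hsR (hle y x h hx h₁)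
    have hcol : ∀ x : Ordinal.{w}, x ≤ ω ^ α → (x, collapse b (ω ^ α) x) ∈ R := by
      intro x hx
      have hω : (0 : Ordinal.{w}) < ω ^ ν := opow_pos _ omega0_pos
      refine hSR (hlow' ⟨⟨hx, (collapse_le_self x).trans hx⟩, ?_⟩)
      rw [collapse_collapse]
      exact ⟨lt_add_of_pos_right _ hω, lt_add_of_pos_right _ hω⟩
    rintro ⟨x, y⟩ ⟨⟨hx, hy⟩, h₁, h₂⟩
    exact htrans (hcol x hx) (htrans (hlt _ _ ((collapse_le_self x).trans hx)
      ((collapse_le_self y).trans hy) h₁ h₂) (hsR (hcol y hy)))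
  | limit ν hν' ih =>
    intro p hp
    obtain ⟨μ, hμ, hp⟩ := nearLT_limit hν' hp
    exact closeUpStage_mono E (mul_le_mul_right hμ.le 2) (ih μ hμ (hμ.le.trans hν) hp)

theorem closeUpStage_nearLE_even_ne (h0 : 0 < ν) (hν : ν ≤ α) (hb : ν < α ∨ ¬ b) :
    closeUpStage (nearLE b α 0) (2 * ν) ≠ closeUpStage (nearLE b α 0) (2 * ν + 1) := by
  intro heq
  have hω : (0 : Ordinal.{w}) < ω ^ ν := opow_pos _ omega0_pos
  have hle : 0 + (ω : Ordinal.{w}) ^ ν ≤ ω ^ α := by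
    rw [zero_add]
    exact opow_le_opow_omega0 hν
  have hmem := mem_closeUpStage_add_opow subset_rfl hν
    (nearLT_subset_closeUpStage (b := b) subset_rfl (fun _ _ => nearLE_symm) hν) hle
  rw [← heq, zero_add] at hmem
  have h := (closeUpStage_subset_nearLT subset_rfl h0 hν hmem).2.2
  have hc : collapse b ((ω : Ordinal.{w}) ^ α) (ω ^ ν) = ω ^ ν := by
    refine collapse_of_not ?_
    rintro ⟨hb', he⟩
    rcases hb with hb | hb
    · exact ((opow_lt_opow_iff_right one_lt_omega0).2 hb).ne he
    · exact hb hb'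
  have hc0 : collapse b ((ω : Ordinal.{w}) ^ α) 0 = 0 := nonpos_iff_eq_zero.1 (collapse_le_self 0)
  dsimp only at h
  rw [hc, hc0, zero_add] at h
  exact lt_irrefl _ h

theorem closeUpStage_nearLE_odd_ne (hν : ν < α) :
    closeUpStage (nearLE b α 0) (2 * ν + 1) ≠ closeUpStage (nearLE b α 0) (2 * (ν + 1)) := by
  intro heq
  have hν' : ν + 1 ≤ α := Order.add_one_le_iff.2 hν
  have hlt : (ω : Ordinal.{w}) ^ ν + 1 < ω ^ (ν + 1) :=
    isPrincipal_add_omega0_opow (ν + 1) (opow_lt_opow_add_one ν)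
      ((one_le_iff_pos.2 (opow_pos ν omega0_pos)).trans_lt (opow_lt_opow_add_one ν))
  have hlt' : (ω : Ordinal.{w}) ^ ν + 1 < ω ^ α := hlt.trans_le (opow_le_opow_omega0 hν')
  have hmem : (0, (ω : Ordinal.{w}) ^ ν + 1) ∈ nearLT b α (ν + 1) :=
    mem_nearLT_of_lt_add hν' zero_le hlt'.le (by rwa [zero_add])
  have h := closeUpStage_subset_nearLE subset_rfl hν.le
    (heq ▸ nearLT_subset_closeUpStage (b := b) subset_rfl (fun _ _ => nearLE_symm) hν' hmem)
  rcases h.2 with h | h | h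
  · have := h.2
    dsimp only at this
    rw [zero_add] at this
    exact (lt_add_one _).not_ge this
  · exact (opow_pos α omega0_pos).ne h.1.2
  · exact hlt'.ne h.1.2

theorem closeUpStage_nearLE_ne {o : Ordinal.{w}} (h1 : 1 ≤ o)
    (ho : o < 2 * α ∨ (o = 2 * α ∧ ¬ b)) :
    closeUpStage (nearLE b α 0) o ≠ closeUpStage (nearLE b α 0) (o + 1) := by
  obtain ⟨ν, rfl | rfl⟩ := exists_two_mul_or_two_mul_add_one o
  · have h0 : 0 < ν := by
      rw [pos_iff_ne_zero]
      rintro rfl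
      rw [mul_zero] at h1
      exact zero_lt_one.not_ge h1
    rcases ho with ho | ⟨ho, hb⟩
    · have hν : ν < α := lt_of_mul_lt_mul_left ho zero_le
      exact closeUpStage_nearLE_even_ne h0 hν.le (Or.inl hν)
    · exact closeUpStage_nearLE_even_ne h0 (le_of_mul_le_mul_left ho.le two_pos) (Or.inr hb)
  · have hν : ν < α := by
      refine lt_of_mul_lt_mul_left (a := 2) ?_ zero_le
      rcases ho with ho | ⟨ho, -⟩
      · exact (le_self_add).trans_lt ho
      · exact (lt_add_one _).trans_eq ho
    have h2 : (2 : Ordinal.{w}) * ν + 1 + 1 = 2 * (ν + 1) := by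
      rw [mul_add_one, add_assoc, one_add_one_eq_two]
    rw [h2]
    exact closeUpStage_nearLE_odd_ne hν

theorem closeUpStage_nearLE_subset_prod (o : Ordinal.{w}) :
    closeUpStage (nearLE b α 0) o ⊆ Iic (ω ^ α) ×ˢ Iic (ω ^ α) :=
  closeUpStage_subset _ nearLE_subset_prod (isClosed_Iic.prod isClosed_Iic)
    (fun _ _ _ h₁ h₂ => ⟨h₁.1, h₂.2⟩) o

theorem mem_closeUpStage_of_collapse_lt {x y : Ordinal.{w}} (hx : x ≤ ω ^ α) (hy : y ≤ ω ^ α)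
    (hx' : collapse b (ω ^ α) x < ω ^ α) (hy' : collapse b (ω ^ α) y < ω ^ α) :
    (x, y) ∈ closeUpStage (nearLE b α 0) (2 * α) :=
  nearLT_subset_closeUpStage subset_rfl (fun _ _ => nearLE_symm) le_rfl
    ⟨⟨hx, hy⟩, hx'.trans_le le_add_self, hy'.trans_le le_add_self⟩

theorem closeUpStage_nearLE_two_mul (hb : b) :
    closeUpStage (nearLE b α 0) (2 * α) = Iic (ω ^ α) ×ˢ Iic (ω ^ α) := by
  refine (closeUpStage_nearLE_subset_prod _).antisymm ?_
  have hlt : ∀ x ≤ (ω : Ordinal.{w}) ^ α, collapse b (ω ^ α) x < ω ^ α := by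
    intro x hx
    rcases hx.eq_or_lt with rfl | hx
    · rw [collapse_endpoint hb]
      exact opow_pos α omega0_pos
    · exact (collapse_le_self x).trans_lt hx
  exact fun p hp => mem_closeUpStage_of_collapse_lt hp.1 hp.2 (hlt _ hp.1) (hlt _ hp.2)

theorem closeUpStage_nearLE_two_mul_add_one :
    closeUpStage (nearLE b α 0) (2 * α + 1) = Iic (ω ^ α) ×ˢ Iic (ω ^ α) := by
  refine (closeUpStage_nearLE_subset_prod _).antisymm ?_
  have hend : ∀ x ≤ (ω : Ordinal.{w}) ^ α,
      (x, ω ^ α) ∈ closeUpStage (nearLE b α 0) (2 * α + 1) := by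
    intro x hx
    rcases hx.eq_or_lt with rfl | hx
    · refine closeUpStage_mono _ (zero_le (a := 2 * α + 1)) ?_
      rw [closeUpStage_zero]
      exact ⟨⟨le_rfl, le_rfl⟩, Or.inl ⟨le_self_add, le_self_add⟩⟩
    · have h := mem_closeUpStage_add_opow (b := b) (x := x) subset_rfl le_rfl
        (nearLT_subset_closeUpStage subset_rfl (fun _ _ => nearLE_symm) le_rfl)
        (add_omega0_opow hx).le
      rwa [add_omega0_opow hx] at h
  rintro ⟨x, y⟩ ⟨hx, hy⟩
  rcases (mem_Iic.1 hy).eq_or_lt with rfl | hy'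
  · exact hend x hx
  rcases (mem_Iic.1 hx).eq_or_lt with rfl | hx'
  · exact closeUpStage_symm (fun _ _ => nearLE_symm) _ _ _ (hend y hy)
  · exact closeUpStage_subset_add_one _ _ <| mem_closeUpStage_of_collapse_lt hx hy
      ((collapse_le_self x).trans_lt hx') ((collapse_le_self y).trans_lt hy')

end Near

theorem exists_nearLE_stabilizing {o : Ordinal.{w}} (h1 : 1 ≤ o) :
    ∃ (b : Prop) (α : Ordinal.{w}), α ≤ o ∧
      closeUpStage (nearLE b α 0) o = Iic (ω ^ α) ×ˢ Iic (ω ^ α) ∧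
      ∀ μ < o, 1 ≤ μ →
        closeUpStage (nearLE b α 0) μ ≠ closeUpStage (nearLE b α 0) (μ + 1) := by
  obtain ⟨α, rfl | rfl⟩ := exists_two_mul_or_two_mul_add_one o
  · exact ⟨True, α, le_mul_right α two_pos, closeUpStage_nearLE_two_mul trivial,
      fun μ hμ hμ1 => closeUpStage_nearLE_ne hμ1 (Or.inl hμ)⟩
  · refine ⟨False, α, (le_mul_right α two_pos).trans le_self_add,
      closeUpStage_nearLE_two_mul_add_one, fun μ hμ hμ1 => closeUpStage_nearLE_ne hμ1 ?_⟩
    exact (Order.lt_add_one_iff.1 hμ).lt_or_eq.imp id fun h => ⟨h, id⟩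

/-! ### Countable initial segments of the ordinals embed in the unit interval -/

theorem countable_Iic_opow {α : Ordinal.{w}} (h : α.card ≤ Cardinal.aleph0) :
    (Iic ((ω : Ordinal.{w}) ^ α)).Countable := by
  have hc : ((ω : Ordinal.{w}) ^ α).card ≤ Cardinal.aleph0 := by
    refine (card_opow_le ω α).trans ?_
    rw [card_omega0]
    exact max_le le_rfl (max_le le_rfl h)
  rw [← Iio_insert]
  refine Set.Countable.insert _ ?_
  rw [← Cardinal.le_aleph0_iff_set_countable, Cardinal.mk_Iio_ordinal]
  exact Cardinal.lift_le_aleph0.2 hc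

theorem exists_continuous_injOn_Iic {κ : Ordinal.{w}} (h : (Iic κ).Countable) :
    ∃ f : Ordinal.{w} → ℝ, Continuous f ∧ InjOn f (Iic κ) ∧ ∀ x, f x ∈ Icc (0 : ℝ) 1 := by
  obtain ⟨e, he⟩ := h.exists_eq_range nonempty_Iic
  let g : ℕ → Ordinal.{w} → ℝ := fun n => (Ioi (e n)).indicator fun _ => (1 / 2 : ℝ) ^ (n + 1)
  have hs : HasSum (fun n : ℕ => (1 / 2 : ℝ) ^ (n + 1)) 1 := by
    have := hasSum_geometric_two.mul_right (1 / 2)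
    simpa [pow_succ] using this
  have hg0 : ∀ n x, 0 ≤ g n x := fun n x => indicator_nonneg (fun _ _ => by positivity) x
  have hg1 : ∀ n x, g n x ≤ (1 / 2 : ℝ) ^ (n + 1) := fun n x =>
    indicator_le_self' (fun _ _ => by positivity) x
  have hsum : ∀ x, Summable fun n => g n x := fun x =>
    Summable.of_nonneg_of_le (fun n => hg0 n x) (fun n => hg1 n x) hs.summable
  have hmono : ∀ x y, x < y → x ≤ κ → ∑' n, g n x < ∑' n, g n y := by
    intro x y hxy hx
    obtain ⟨n, rfl⟩ : x ∈ range e := he ▸ hx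
    refine Summable.tsum_lt_tsum (i := n) (fun m => ?_) ?_ (hsum _) (hsum _)
    · by_cases hm : e n ∈ Ioi (e m)
      · have h₁ : g m (e n) = (1 / 2 : ℝ) ^ (m + 1) := indicator_of_mem hm _
        have h₂ : g m y = (1 / 2 : ℝ) ^ (m + 1) := indicator_of_mem (mem_Ioi.2 (lt_trans hm hxy)) _
        rw [h₁, h₂]
      · have h₁ : g m (e n) = 0 := indicator_of_notMem hm _
        rw [h₁]
        exact hg0 m y
    · have h₁ : g n (e n) = 0 := indicator_of_notMem self_notMem_Ioi _
      have h₂ : g n y = (1 / 2 : ℝ) ^ (n + 1) := indicator_of_mem (mem_Ioi.2 hxy) _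
      rw [h₁, h₂]
      positivity
  refine ⟨fun x => ∑' n, g n x, ?_, ?_, ?_⟩
  · refine continuous_tsum (fun n => ?_) hs.summable fun n x => ?_
    · have hcl : IsClopen (Ioi (e n)) := by
        refine ⟨?_, isOpen_Ioi⟩
        rw [← Order.Ici_succ]
        exact isClosed_Ici
      exact hcl.continuous_indicator continuous_const
    · rw [Real.norm_of_nonneg (hg0 n x)]
      exact hg1 n x
  · intro x hx y hy hxy
    by_contra hne
    rcases lt_or_gt_of_ne hne with hlt | hlt
    · exact (hmono x y hlt hx).ne hxy
    · exact (hmono y x hlt hy).ne' hxy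
  · exact fun x => ⟨tsum_nonneg fun n => hg0 n x,
      ((hsum x).tsum_le_tsum (fun n => hg1 n x) hs.summable).trans_eq hs.tsum_eq⟩

end CPE

open CPE in
/-- For every countable ordinal `λ ≥ 1` there is a closed countable `X ⊆ [0,1]` and an
equalizing closed symmetric reflexive relation `E ⊆ X²` with close-up rank `λ`. -/
theorem closeUpRank_realized_on_interval (lam : Ordinal) (hlam : 1 ≤ lam)
    (hcount : lam.card ≤ Cardinal.aleph0) :
    ∃ X : Set ℝ, X ⊆ Set.Icc 0 1 ∧ IsClosed X ∧ X.Countable ∧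
      ∃ E : Set (ℝ × ℝ), E ⊆ X ×ˢ X ∧ IsClosed E ∧
        (∀ x ∈ X, (x, x) ∈ E) ∧ (∀ p ∈ E, (p.2, p.1) ∈ E) ∧
        (∃ o : Ordinal, closeUp E o = X ×ˢ X) ∧ closeUpRank E = lam := by
  obtain ⟨b, α, hα, hfull, hne⟩ := exists_nearLE_stabilizing hlam
  set κ : Ordinal := Ordinal.omega0 ^ α with hκ
  have hcκ : (Set.Iic κ).Countable := countable_Iic_opow ((Ordinal.card_le_card hα).trans hcount)
  obtain ⟨f, hf, hinj, hf01⟩ := exists_continuous_injOn_Iic hcκ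
  have hK : IsCompact (Set.Iic κ) := by
    rw [← Set.Icc_bot]
    exact isCompact_Icc
  have hE : nearLE b α 0 ⊆ Set.Iic κ ×ˢ Set.Iic κ := nearLE_subset_prod
  have hstage : ∀ o : Ordinal, closeUp (Prod.map f f '' nearLE b α 0) o =
      Prod.map f f '' closeUpStage (nearLE b α 0) o := fun o => by
    rw [closeUp_eq_closeUpStage, closeUpStage_image _ hf hK hinj hE]
  have hinj2 : Set.InjOn (Prod.map f f) (Set.Iic κ ×ˢ Set.Iic κ) := hinj.prodMap hinj
  have hEc : IsClosed (Prod.map f f '' nearLE b α 0) :=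
    (((hK.prod hK).of_isClosed_subset isClosed_nearLE hE).image (hf.prodMap hf)).isClosed
  have hfull' : closeUp (Prod.map f f '' nearLE b α 0) lam =
      (f '' Set.Iic κ) ×ˢ (f '' Set.Iic κ) := by
    rw [hstage, hfull, Set.prodMap_image_prod]
  refine ⟨f '' Set.Iic κ, Set.image_subset_iff.2 fun x _ => hf01 x, (hK.image hf).isClosed,
    hcκ.image f, Prod.map f f '' nearLE b α 0, ?_, hEc, ?_, ?_, ⟨lam, hfull'⟩, ?_⟩
  · rw [← Set.prodMap_image_prod]
    exact Set.image_mono hE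
  · rintro _ ⟨x, hx, rfl⟩
    exact ⟨(x, x), ⟨⟨hx, hx⟩, Or.inl ⟨le_self_add, le_self_add⟩⟩, rfl⟩
  · rintro _ ⟨⟨x, y⟩, hxy, rfl⟩
    exact ⟨(y, x), nearLE_symm hxy, rfl⟩
  · have hmem : lam ∈ {o : Ordinal | (IsClosed (Prod.map f f '' nearLE b α 0) → 1 ≤ o) ∧
        closeUp (Prod.map f f '' nearLE b α 0) o =
          closeUp (Prod.map f f '' nearLE b α 0) (o + 1)} := by
      refine ⟨fun _ => hlam, ?_⟩
      rw [hstage, hstage]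
      congr 1
      refine (closeUpStage_subset_add_one _ _).antisymm ?_
      rw [hfull]
      exact closeUpStage_nearLE_subset_prod _
    refine le_antisymm (csInf_le' hmem) (le_csInf ⟨lam, hmem⟩ ?_)
    rintro o ⟨ho1, ho⟩
    by_contra! hlt
    rw [hstage, hstage] at ho
    exact hne o hlt (ho1 hEc) ((hinj2.image_eq_image_iff (closeUpStage_nearLE_subset_prod _)
      (closeUpStage_nearLE_subset_prod _)).1 ho)
end
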